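/- The Hochschild cohomology of U = Diff(𝒜) has Hilbert series 1 + 3t + 6t² + 4t³; that is, the k-vector space HH⁰(U) has dimension 1, HH¹(U) has dimension 3, HH²(U) has dimension 6, HH³(U) has dimension 4, and HHⁿ(U) = 0 for every n ≥ 4. -/

import Mathlib

/-!
Let `k` be a field of characteristic zero, `t ∈ k`, `t ≠ 0`, and let `U = Diff 𝒜` be the
algebra of differential operators tangent to the central arrangement `𝒜` of the three lines
`x = 0`, `y = 0`, `tx + y = 0` in `k²`, presented by generators `x, y, D, E` and relations
`[y,x] = 0`, `[D,x] = 0`, `[D,y] = y² + txy`, `[E,x] = x`, `[E,y] = y`, `[E,D] = D`.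
Then the Hilbert series of the Hochschild cohomology `HH^•(U)` is `1 + 3t + 6t² + 4t³`.
-/

open TensorProduct CategoryTheory

/-- Relations presenting `Diff 𝒜`; the generators are `x = ι 0`, `y = ι 1`, `D = ι 2`,
`E = ι 3`. -/
inductive DiffRel (k : Type) [Field k] (t : k) :
    FreeAlgebra k (Fin 4) → FreeAlgebra k (Fin 4) → Prop
  | yx : DiffRel k t (FreeAlgebra.ι k 1 * FreeAlgebra.ι k 0)
      (FreeAlgebra.ι k 0 * FreeAlgebra.ι k 1)
  | Dx : DiffRel k t (FreeAlgebra.ι k 2 * FreeAlgebra.ι k 0)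
      (FreeAlgebra.ι k 0 * FreeAlgebra.ι k 2)
  | Dy : DiffRel k t (FreeAlgebra.ι k 2 * FreeAlgebra.ι k 1)
      (FreeAlgebra.ι k 1 * FreeAlgebra.ι k 2 +
        (FreeAlgebra.ι k 1 * FreeAlgebra.ι k 1 + t • (FreeAlgebra.ι k 0 * FreeAlgebra.ι k 1)))
  | Ex : DiffRel k t (FreeAlgebra.ι k 3 * FreeAlgebra.ι k 0)
      (FreeAlgebra.ι k 0 * FreeAlgebra.ι k 3 + FreeAlgebra.ι k 0)
  | Ey : DiffRel k t (FreeAlgebra.ι k 3 * FreeAlgebra.ι k 1)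
      (FreeAlgebra.ι k 1 * FreeAlgebra.ι k 3 + FreeAlgebra.ι k 1)
  | ED : DiffRel k t (FreeAlgebra.ι k 3 * FreeAlgebra.ι k 2)
      (FreeAlgebra.ι k 2 * FreeAlgebra.ι k 3 + FreeAlgebra.ι k 2)

/-- The algebra `Diff 𝒜` of differential operators tangent to a central arrangement of
three lines, as the quotient of the free algebra on `x, y, D, E` by the two-sided ideal
generated by the six relations. -/
abbrev DiffA (k : Type) [Field k] (t : k) : Type := RingQuot (DiffRel k t)

attribute [local instance] TensorProduct.Algebra.module

/-- The `n`-th Hochschild cohomology of a `k`-algebra `A` with coefficients in `A` itself, i.e.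
`Ext^n` over the enveloping algebra `A ⊗[k] Aᵒᵖ` of `A` with itself. -/
noncomputable def HH (k : Type) [Field k] (A : Type) [Ring A] [Algebra k A] (n : ℕ) :
    ModuleCat k :=
  ((Ext k (ModuleCat (A ⊗[k] Aᵐᵒᵖ)) n).obj
      (Opposite.op (ModuleCat.of (A ⊗[k] Aᵐᵒᵖ) A))).obj
    (ModuleCat.of (A ⊗[k] Aᵐᵒᵖ) A)



section PartA

structure PBW (k U : Type) [Field k] [Ring U] [Algebra k U] (t : k) where
  x : U
  y : U
  D : U
  E : U
  yx : y * x = x * y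
  Dx : D * x = x * D
  Dy : D * y = y * D + (y * y + t • (x * y))
  Ex : E * x = x * E + x
  Ey : E * y = y * E + y
  ED : E * D = D * E + D
  b : Module.Basis (ℕ × ℕ × ℕ × ℕ) k U
  hb : ∀ i j l m, b (i, j, l, m) = x ^ i * y ^ j * D ^ l * E ^ m

variable {k : Type} [Field k] {t : k}

lemma pbw_Dyj {U : Type} [Ring U] [Algebra k U] {x y D : U} (yx : y * x = x * y)
    (Dy : D * y = y * D + (y * y + t • (x * y))) (j : ℕ) :
    D * y ^ j = y ^ j * D + (j : k) • (y ^ (j+1) + t • (x * y ^ j)) := by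
  have yxj : ∀ j, y ^ j * x = x * y ^ j := fun j => (Commute.pow_left yx j)
  induction j with
  | zero => simp
  | succ j ih =>
    rw [pow_succ, ← mul_assoc, ih, add_mul, mul_assoc _ D y, Dy, mul_add, ← mul_assoc, ← pow_succ]
    simp only [mul_add, smul_mul_assoc, add_mul, mul_smul_comm, ← mul_assoc, yxj]
    simp only [mul_assoc, ← pow_succ]
    push_cast
    module

lemma adE_mul {U : Type} [Ring U] [Algebra k U] {E u v : U} {p q : k} (hu : E * u = u * E + p • u)
    (hv : E * v = v * E + q • v) : E * (u * v) = (u * v) * E + (p + q) • (u * v) := by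
  rw [← mul_assoc, hu, add_mul, mul_assoc, hv, mul_add, ← mul_assoc]
  simp only [smul_mul_assoc, mul_smul_comm]
  module

lemma adE_pow {U : Type} [Ring U] [Algebra k U] {E u : U} {p : k} (hu : E * u = u * E + p • u) (n : ℕ) :
    E * u ^ n = u ^ n * E + ((n : k) * p) • u ^ n := by
  induction n with
  | zero => simp
  | succ n ih =>
    rw [pow_succ, adE_mul ih hu]
    push_cast
    module

lemma adE_mon {U : Type} [Ring U] [Algebra k U] {x y D E : U}
    (Ex : E * x = x * E + x) (Ey : E * y = y * E + y) (ED : E * D = D * E + D) (i j l m : ℕ) :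
    E * (x ^ i * y ^ j * D ^ l * E ^ m) = (x ^ i * y ^ j * D ^ l * E ^ m) * E
       + ((i + j + l : ℕ) : k) • (x ^ i * y ^ j * D ^ l * E ^ m) := by
  have h : ∀ z : U, E * z = z * E + z → E * z = z * E + (1 : k) • z := fun z hz => by rw [hz, one_smul]
  have hE : E * E = E * E + (0 : k) • E := by simp
  rw [adE_mul (adE_mul (adE_mul (adE_pow (h x Ex) i) (adE_pow (h y Ey) j)) (adE_pow (h D ED) l))
    (adE_pow hE m)]
  push_cast
  congr 2
  ring

/-- spanning -/
lemma pbw_span {U : Type} [Ring U] [Algebra k U] {x y D E : U} (yx : y * x = x * y)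
    (Dx : D * x = x * D)
    (Dy : D * y = y * D + (y * y + t • (x * y))) 
    (Ex : E * x = x * E + x)
    (Ey : E * y = y * E + y)
    (ED : E * D = D * E + D) (hgen : Algebra.adjoin k {x, y, D, E} = ⊤) :
    ⊤ ≤ Submodule.span k (Set.range fun p : ℕ × ℕ × ℕ × ℕ =>
      x ^ p.1 * y ^ p.2.1 * D ^ p.2.2.1 * E ^ p.2.2.2) := by
  set S := Submodule.span k (Set.range fun p : ℕ × ℕ × ℕ × ℕ =>
      x ^ p.1 * y ^ p.2.1 * D ^ p.2.2.1 * E ^ p.2.2.2) with hS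
  have hm : ∀ i j l m, x ^ i * y ^ j * D ^ l * E ^ m ∈ S := fun i j l m =>
    Submodule.subset_span ⟨(i, j, l, m), rfl⟩
  have key : ∀ z : U, (∀ i j l m, z * (x ^ i * y ^ j * D ^ l * E ^ m) ∈ S) → ∀ u ∈ S, z * u ∈ S := by
    intro z hz u hu
    induction hu using Submodule.span_induction with
    | mem u hu => obtain ⟨⟨i, j, l, m⟩, rfl⟩ := hu; exact hz i j l m
    | zero => simp
    | add u v _ _ hu hv => rw [mul_add]; exact S.add_mem hu hv
    | smul c u _ hu => rw [mul_smul_comm]; exact S.smul_mem c hu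
  have hx : ∀ u ∈ S, x * u ∈ S := key x fun i j l m => by
    have := hm (i+1) j l m
    rwa [pow_succ', mul_assoc, mul_assoc, mul_assoc, ← mul_assoc (x^i), ← mul_assoc (x^i * _), ] at this
  have yxi : ∀ i, y * x ^ i = x ^ i * y := fun i => Commute.pow_right yx i
  have Dxi : ∀ i, D * x ^ i = x ^ i * D := fun i => Commute.pow_right Dx i
  have hy : ∀ u ∈ S, y * u ∈ S := key y fun i j l m => by
    have := hm i (j+1) l m
    rwa [pow_succ', ← mul_assoc (x^i), ← yxi, mul_assoc, mul_assoc, mul_assoc, ← mul_assoc (x^i), ← mul_assoc (x^i * _)] at this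
  have hD : ∀ u ∈ S, D * u ∈ S := key D fun i j l m => by
    have : D * (x ^ i * y ^ j * D ^ l * E ^ m) = x ^ i * y ^ j * D ^ (l+1) * E ^ m
       + (j : k) • (x ^ i * y ^ (j+1) * D ^ l * E ^ m + t • (x ^ (i+1) * y ^ j * D ^ l * E ^ m)) := by
      simp only [← mul_assoc]
      rw [Dxi, mul_assoc _ D, pbw_Dyj yx Dy]
      simp only [mul_add, add_mul, smul_mul_assoc, mul_smul_comm, pow_succ' D, pow_succ x, mul_assoc]
    rw [this]
    exact S.add_mem (hm _ _ _ _) (S.smul_mem _ (S.add_mem (hm _ _ _ _) (S.smul_mem _ (hm _ _ _ _))))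
  have hE : ∀ u ∈ S, E * u ∈ S := key E fun i j l m => by
    have : E * (x ^ i * y ^ j * D ^ l * E ^ m) = x ^ i * y ^ j * D ^ l * E ^ (m+1)
       + ((i + j + l : ℕ) : k) • (x ^ i * y ^ j * D ^ l * E ^ m) := by
      rw [adE_mon (k := k) Ex Ey ED, mul_assoc _ (E ^ m) E, ← pow_succ]
    rw [this]
    exact S.add_mem (hm _ _ _ _) (S.smul_mem _ (hm _ _ _ _))
  have h1 : (1 : U) ∈ S := by simpa using hm 0 0 0 0
  have hall : ∀ z ∈ Algebra.adjoin k {x, y, D, E}, ∀ u ∈ S, z * u ∈ S := by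
    intro z hz
    induction hz using Algebra.adjoin_induction with
    | mem z hz =>
      rcases hz with rfl | rfl | rfl | rfl
      exacts [hx, hy, hD, hE]
    | algebraMap c => intro u hu; rw [← Algebra.smul_def]; exact S.smul_mem c hu
    | add a b _ _ ha hb => intro u hu; rw [add_mul]; exact S.add_mem (ha u hu) (hb u hu)
    | mul a b _ _ ha hb => intro u hu; rw [mul_assoc]; exact ha _ (hb u hu)
  intro z _
  have := hall z (by rw [hgen]; trivial) 1 h1
  rwa [mul_one] at this

open MvPolynomial in
/-- the action on polynomials -/
noncomputable def pbwGen (k : Type) [Field k] (t : k) : Fin 4 → Module.End k (MvPolynomial (Fin 4) k) :=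
  ![LinearMap.mulLeft k (X 0), LinearMap.mulLeft k (X 1),
    LinearMap.mulLeft k (X 2) + (mkDerivation k ![0, X 1 * X 1 + t • (X 0 * X 1), 0, 0] : Derivation k _ _).toLinearMap,
    LinearMap.mulLeft k (X 3) + (mkDerivation k ![X 0, X 1, X 2, 0] : Derivation k _ _).toLinearMap]


open MvPolynomial in
lemma pbwGen_rel (a b : FreeAlgebra k (Fin 4)) (h : DiffRel k t a b) :
    FreeAlgebra.lift k (pbwGen k t) a = FreeAlgebra.lift k (pbwGen k t) b := by
  have hc : ⁅(mkDerivation k ![X 0, X 1, X 2, 0] : Derivation k (MvPolynomial (Fin 4) k) (MvPolynomial (Fin 4) k)),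
      (mkDerivation k ![0, X 1 * X 1 + t • (X 0 * X 1), 0, 0] : Derivation k (MvPolynomial (Fin 4) k) (MvPolynomial (Fin 4) k))⁆
      = (mkDerivation k ![0, X 1 * X 1 + t • (X 0 * X 1), 0, 0] : Derivation k (MvPolynomial (Fin 4) k) (MvPolynomial (Fin 4) k)) := by
    refine MvPolynomial.derivation_ext (σ := Fin 4) (R := k) ?_
    intro i
    rw [Derivation.commutator_apply]
    fin_cases i <;> simp [mkDerivation_X, Derivation.leibniz]
    simp only [Algebra.smul_def]
    ring
  have hc' : ∀ f : MvPolynomial (Fin 4) k,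
      (mkDerivation k ![X 0, X 1, X 2, 0] : Derivation k (MvPolynomial (Fin 4) k) (MvPolynomial (Fin 4) k))
        ((mkDerivation k ![0, X 1 * X 1 + t • (X 0 * X 1), 0, 0] : Derivation k (MvPolynomial (Fin 4) k) (MvPolynomial (Fin 4) k)) f)
     = (mkDerivation k ![0, X 1 * X 1 + t • (X 0 * X 1), 0, 0] : Derivation k (MvPolynomial (Fin 4) k) (MvPolynomial (Fin 4) k))
      ((mkDerivation k ![X 0, X 1, X 2, 0] : Derivation k (MvPolynomial (Fin 4) k) (MvPolynomial (Fin 4) k)) f) +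
      (mkDerivation k ![0, X 1 * X 1 + t • (X 0 * X 1), 0, 0] : Derivation k (MvPolynomial (Fin 4) k) (MvPolynomial (Fin 4) k)) f := by
    intro f
    have := congrArg (fun d : Derivation k (MvPolynomial (Fin 4) k) (MvPolynomial (Fin 4) k) => d f) hc
    simp only [Derivation.commutator_apply] at this
    exact sub_eq_iff_eq_add'.1 this
  induction h <;>
  · simp only [map_mul, map_add, map_smul, FreeAlgebra.lift_ι_apply]
    refine LinearMap.ext fun f => ?_
    simp only [pbwGen, Matrix.cons_val, Module.End.mul_apply, LinearMap.add_apply, LinearMap.mulLeft_apply,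
      LinearMap.smul_apply, Derivation.coeFn_coe, map_add, Derivation.leibniz, mkDerivation_X,
      smul_eq_mul, hc']
    try simp only [Algebra.smul_def]
    ring

noncomputable def pbwRep (k : Type) [Field k] (t : k) :
    DiffA k t →ₐ[k] Module.End k (MvPolynomial (Fin 4) k) :=
  RingQuot.liftAlgHom k ⟨FreeAlgebra.lift k (pbwGen k t), fun a b h => pbwGen_rel a b h⟩

noncomputable def dgen (k : Type) [Field k] (t : k) (i : Fin 4) : DiffA k t :=
  RingQuot.mkAlgHom k (DiffRel k t) (FreeAlgebra.ι k i)

lemma pbwRep_gen (i : Fin 4) : pbwRep k t (dgen k t i) = pbwGen k t i := by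
  simp [pbwRep, dgen]

lemma drel {a b : FreeAlgebra k (Fin 4)} (h : DiffRel k t a b) :
    RingQuot.mkAlgHom k (DiffRel k t) a = RingQuot.mkAlgHom k (DiffRel k t) b :=
  RingQuot.mkAlgHom_rel k h

lemma dgen_adjoin : Algebra.adjoin k {dgen k t 0, dgen k t 1, dgen k t 2, dgen k t 3} = ⊤ := by
  have h := FreeAlgebra.adjoin_range_ι (R := k) (X := Fin 4)
  have h2 := congrArg (Subalgebra.map (RingQuot.mkAlgHom k (DiffRel k t))) h
  rw [AlgHom.map_adjoin, Algebra.map_top, (AlgHom.range_eq_top _).2 (RingQuot.mkAlgHom_surjective k (DiffRel k t))] at h2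
  rw [← h2]
  congr 1
  ext z
  simp only [Set.mem_insert_iff, Set.mem_singleton_iff, Set.mem_image, Set.mem_range, Fin.exists_fin_succ, dgen]
  simp [eq_comm]

open MvPolynomial in
lemma pbwGen_mon (i j l m : ℕ) :
    (pbwGen k t 0 ^ i * pbwGen k t 1 ^ j * pbwGen k t 2 ^ l * pbwGen k t 3 ^ m) 1
      = X 0 ^ i * X 1 ^ j * X 2 ^ l * (X 3 : MvPolynomial (Fin 4) k) ^ m := by
  have h3 : ∀ m, (pbwGen k t 3 ^ m) 1 = (X 3 : MvPolynomial (Fin 4) k) ^ m := by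
    intro m
    induction m with
    | zero => simp
    | succ m ih =>
      rw [pow_succ', Module.End.mul_apply, ih]
      simp [pbwGen, pow_succ', Derivation.leibniz_pow, mkDerivation_X]
  have h2 : ∀ l m, (pbwGen k t 2 ^ l) ((X 3 : MvPolynomial (Fin 4) k) ^ m) = X 2 ^ l * X 3 ^ m := by
    intro l m
    induction l with
    | zero => simp
    | succ l ih =>
      rw [pow_succ', Module.End.mul_apply, ih]
      simp [pbwGen, pow_succ', Derivation.leibniz_pow, mkDerivation_X, mul_assoc]
  have h1 : ∀ j f, (pbwGen k t 1 ^ j) f = (X 1 : MvPolynomial (Fin 4) k) ^ j * f := by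
    intro j f
    simp [pbwGen, LinearMap.pow_mulLeft]
  have h0 : ∀ j f, (pbwGen k t 0 ^ j) f = (X 0 : MvPolynomial (Fin 4) k) ^ j * f := by
    intro j f
    simp [pbwGen, LinearMap.pow_mulLeft]
  simp only [Module.End.mul_apply, h3, h2, h1, h0, mul_assoc]

open MvPolynomial in
lemma dgen_li : LinearIndependent k (fun p : ℕ × ℕ × ℕ × ℕ =>
      dgen k t 0 ^ p.1 * dgen k t 1 ^ p.2.1 * dgen k t 2 ^ p.2.2.1 * dgen k t 3 ^ p.2.2.2) := by
  let φ : DiffA k t →ₗ[k] MvPolynomial (Fin 4) k :=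
    (LinearMap.applyₗ (1 : MvPolynomial (Fin 4) k)).comp (pbwRep k t).toLinearMap
  apply LinearIndependent.of_comp φ
  let g : ℕ × ℕ × ℕ × ℕ → (Fin 4 →₀ ℕ) := fun p => Finsupp.equivFunOnFinite.symm ![p.1, p.2.1, p.2.2.1, p.2.2.2]
  have hg : Function.Injective g := by
    rintro ⟨a, b, c, d⟩ ⟨a', b', c', d'⟩ h
    have := Finsupp.equivFunOnFinite.symm.injective h
    have h0 := congrFun this 0
    have h1 := congrFun this 1
    have h2 := congrFun this 2
    have h3 := congrFun this 3
    simp at h0 h1 h2 h3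
    simp [*]
  have := (MvPolynomial.basisMonomials (Fin 4) k).linearIndependent.comp g hg
  refine Eq.mp ?_ this
  congr 1
  symm
  funext p
  obtain ⟨i, j, l, m⟩ := p
  have := pbwGen_mon (k := k) (t := t) i j l m
  simp only [← pbwRep_gen, ← map_pow, ← map_mul] at this
  refine this.trans ?_
  simp only [Function.comp, coe_basisMonomials, g]
  rw [MvPolynomial.monomial_eq]
  rw [Finsupp.prod_fintype _ _ (by simp)]
  simp [Fin.prod_univ_four]

noncomputable def dpbw (k : Type) [Field k] (t : k) : PBW k (DiffA k t) t where
  x := dgen k t 0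
  y := dgen k t 1
  D := dgen k t 2
  E := dgen k t 3
  yx := by simpa [dgen] using drel (k := k) (t := t) .yx
  Dx := by simpa [dgen] using drel (k := k) (t := t) .Dx
  Dy := by simpa [dgen] using drel (k := k) (t := t) .Dy
  Ex := by simpa [dgen] using drel (k := k) (t := t) .Ex
  Ey := by simpa [dgen] using drel (k := k) (t := t) .Ey
  ED := by simpa [dgen] using drel (k := k) (t := t) .ED
  b := Module.Basis.mk dgen_li (pbw_span (by simpa [dgen] using drel (k := k) (t := t) .yx)
    (by simpa [dgen] using drel (k := k) (t := t) .Dx)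
    (by simpa [dgen] using drel (k := k) (t := t) .Dy)
    (by simpa [dgen] using drel (k := k) (t := t) .Ex)
    (by simpa [dgen] using drel (k := k) (t := t) .Ey)
    (by simpa [dgen] using drel (k := k) (t := t) .ED) dgen_adjoin)
  hb i j l m := by rw [Module.Basis.mk_apply]

end PartA


section PartC

lemma sc_crit {k : Type} [Field k] (S : ShortComplex (ModuleCat.{0} k)) {V : Type} [AddCommGroup V]
    [Module k V] (σ : V →ₗ[k] S.X₂) (h1 : ∀ v, S.g.hom (σ v) = 0)
    (h2 : ∀ z, S.g.hom z = 0 → ∃ v w, z = σ v + S.f.hom w)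
    (h3 : ∀ v w, σ v = S.f.hom w → v = 0) : Nonempty (S.homology ≃ₗ[k] V) := by
  let σ' : V →ₗ[k] LinearMap.ker S.g.hom := σ.codRestrict _ (fun v => by simpa using h1 v)
  let q := (LinearMap.range S.moduleCatToCycles).mkQ.comp σ'
  have hq : Function.Bijective q := by
    constructor
    · rw [← LinearMap.ker_eq_bot, LinearMap.ker_eq_bot']
      intro v hv
      have : σ' v ∈ LinearMap.range S.moduleCatToCycles := by
        rw [← Submodule.ker_mkQ (LinearMap.range S.moduleCatToCycles)]; exact hv
      obtain ⟨w, hw⟩ := this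
      exact h3 v w (congrArg Subtype.val hw).symm
    · intro z
      obtain ⟨⟨z, hz⟩, rfl⟩ := Submodule.mkQ_surjective _ z
      obtain ⟨v, w, h⟩ := h2 z (by simpa using hz)
      refine ⟨v, ?_⟩
      rw [← sub_eq_zero]
      change (LinearMap.range S.moduleCatToCycles).mkQ (σ' v) - _ = 0
      rw [← map_sub, ← LinearMap.mem_ker, Submodule.ker_mkQ]
      refine ⟨-w, Subtype.ext ?_⟩
      change S.f.hom (-w) = σ v - z
      rw [h]; simp
  exact ⟨(S.moduleCatHomologyIso.toLinearEquiv).trans (LinearEquiv.ofBijective q hq).symm⟩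

variable {R : Type} [Ring R]

noncomputable def resOf (X : ℕ → ModuleCat.{0} R) (d : ∀ n, X (n+1) ⟶ X n) (A : ModuleCat.{0} R)
    (p : X 0 ⟶ A) (hP : ∀ n, Projective (X n))
    (hex : ∀ n, Function.Exact (d (n+1)).hom (d n).hom)
    (h0 : Function.Exact (d 0).hom p.hom) (hs : Function.Surjective p.hom) :
    ProjectiveResolution A where
  complex := ChainComplex.of X d (fun n => by
    ext x; exact (hex n).apply_apply_eq_zero x)
  projective := hP
  π := (ChainComplex.toSingle₀Equiv _ _).symm ⟨p, by
    refine (congrArg (· ≫ p) (ChainComplex.of_d X d 0)).trans ?_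
    ext x; exact h0.apply_apply_eq_zero x⟩
  quasiIso := ⟨fun n => by
    cases n with
    | zero =>
      rw [ChainComplex.quasiIsoAt₀_iff, ShortComplex.quasiIso_iff_of_zeros']
      · refine (ShortComplex.exact_and_epi_g_iff_of_iso (S₂ := ShortComplex.mk (d 0) p (by
          ext x; exact h0.apply_apply_eq_zero x)) ?_).2
          ⟨(ShortComplex.ShortExact.moduleCat_exact_iff_function_exact _).2 h0,
            (ModuleCat.epi_iff_surjective _).2 hs⟩
        exact ShortComplex.isoMk (Iso.refl _) (Iso.refl _) (Iso.refl _)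
          ((Category.id_comp _).trans ((ChainComplex.of_d X d 0).symm.trans
            (Category.comp_id _).symm))
          (by
            have key := ChainComplex.toSingle₀Equiv_symm_apply_f_zero
              (C := ChainComplex.of X d (fun n => by
                ext x; exact (hex n).apply_apply_eq_zero x)) (X := A) p (by
              refine (congrArg (· ≫ p) (ChainComplex.of_d X d 0)).trans ?_
              ext x; exact h0.apply_apply_eq_zero x)
            refine (Category.id_comp p).trans (Eq.trans key.symm ?_)
            exact (Category.comp_id _).symm)
      all_goals rfl
    | succ n =>
      rw [quasiIsoAt_iff_exactAt']
      · rw [HomologicalComplex.exactAt_iff' _ (n + 1 + 1) (n + 1) n (by simp) (by simp)]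
        rw [ShortComplex.ShortExact.moduleCat_exact_iff_function_exact]
        change Function.Exact (ModuleCat.Hom.hom (ChainComplex.of.d X d (n+1+1) (n+1)))
          (ModuleCat.Hom.hom (ChainComplex.of.d X d (n+1) n))
        rw [ChainComplex.of_d, ChainComplex.of_d]
        exact hex n
      · apply ChainComplex.exactAt_succ_single_obj⟩


/-- Computation of `Ext` from a resolution, elementwise. -/
lemma ext_crit {k : Type} [Field k] [Algebra k R]
    (X : ℕ → ModuleCat.{0} R) (d : ∀ n, X (n+1) ⟶ X n) (A : ModuleCat.{0} R)
    (p : X 0 ⟶ A) (hP : ∀ n, Projective (X n))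
    (hex : ∀ n, Function.Exact (d (n+1)).hom (d n).hom)
    (h0 : Function.Exact (d 0).hom p.hom) (hs : Function.Surjective p.hom)
    (n : ℕ) {V : Type} [AddCommGroup V] [Module k V] (σ : V →ₗ[k] (X (n+1) ⟶ A))
    (h1 : ∀ v, d (n+1) ≫ σ v = 0)
    (h2 : ∀ z : X (n+1) ⟶ A, d (n+1) ≫ z = 0 → ∃ v, ∃ w : X n ⟶ A, z = σ v + d n ≫ w)
    (h3 : ∀ v, ∀ w : X n ⟶ A, σ v = d n ≫ w → v = 0) :
    Nonempty (((Ext k (ModuleCat.{0} R) (n+1)).obj (Opposite.op A)).obj A ≃ₗ[k] V) := by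
  let P := resOf X d A p hP hex h0 hs
  have e1 := (P.isoExt (R := k) (n+1) A).toLinearEquiv
  let C := P.complex.linearYonedaObj k A
  have e2 := (ShortComplex.homologyMapIso (C.isoSc' n (n+1) (n+2) (by simp) (by simp))).toLinearEquiv
  have hd : ∀ j, P.complex.d (j+1) j = d j := fun j => ChainComplex.of_d X d j
  have hf : ∀ w : X n ⟶ A, (C.sc' n (n+1) (n+2)).f.hom w = d n ≫ w := fun w =>
    congrArg (· ≫ w) (hd n)
  have hg : ∀ w : X (n+1) ⟶ A, (C.sc' n (n+1) (n+2)).g.hom w = d (n+1) ≫ w := fun w =>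
    congrArg (· ≫ w) (hd (n+1))
  obtain ⟨e3⟩ := sc_crit (C.sc' n (n+1) (n+2)) (V := V) σ (fun v => (hg _).trans (h1 v))
    (fun z hz => by
      obtain ⟨v, w, h⟩ := h2 z ((hg z).symm.trans hz)
      exact ⟨v, w, h.trans (congrArg (σ v + ·) (hf w).symm)⟩)
    (fun v w h => h3 v w (h.trans (hf w)))
  exact ⟨e1.trans (e2.trans e3)⟩

lemma ext_crit0 {k : Type} [Field k] [Algebra k R]
    (X : ℕ → ModuleCat.{0} R) (d : ∀ n, X (n+1) ⟶ X n) (A : ModuleCat.{0} R)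
    (p : X 0 ⟶ A) (hP : ∀ n, Projective (X n))
    (hex : ∀ n, Function.Exact (d (n+1)).hom (d n).hom)
    (h0 : Function.Exact (d 0).hom p.hom) (hs : Function.Surjective p.hom)
    {V : Type} [AddCommGroup V] [Module k V] (σ : V →ₗ[k] (X 0 ⟶ A))
    (h1 : ∀ v, d 0 ≫ σ v = 0)
    (h2 : ∀ z : X 0 ⟶ A, d 0 ≫ z = 0 → ∃ v, z = σ v)
    (h3 : ∀ v, σ v = 0 → v = 0) :
    Nonempty (((Ext k (ModuleCat.{0} R) 0).obj (Opposite.op A)).obj A ≃ₗ[k] V) := by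
  let P := resOf X d A p hP hex h0 hs
  have e1 := (P.isoExt (R := k) 0 A).toLinearEquiv
  let C := P.complex.linearYonedaObj k A
  have e2 := (ShortComplex.homologyMapIso (C.isoSc' 0 0 1 (by simp) (by simp))).toLinearEquiv
  have hd : ∀ j, P.complex.d (j+1) j = d j := fun j => ChainComplex.of_d X d j
  have hf : ∀ w : X 0 ⟶ A, (C.sc' 0 0 1).f.hom w = 0 := fun w => by
    have : C.d 0 0 = 0 := C.shape _ _ (by simp)
    exact congrArg (fun g => (ModuleCat.Hom.hom g) w) this
  have hg : ∀ w : X 0 ⟶ A, (C.sc' 0 0 1).g.hom w = d 0 ≫ w := fun w =>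
    congrArg (· ≫ w) (hd 0)
  obtain ⟨e3⟩ := sc_crit (C.sc' 0 0 1) (V := V) σ (fun v => (hg _).trans (h1 v))
    (fun z hz => by
      obtain ⟨v, h⟩ := h2 z ((hg z).symm.trans hz)
      refine ⟨v, 0, h.trans ?_⟩
      rw [map_zero, add_zero]
      rfl)
    (fun v w h => h3 v (h.trans (hf w)))
  exact ⟨e1.trans (e2.trans e3)⟩

end PartC
section PartC2

variable {k R : Type} [Field k] [Ring R] [Algebra k R]

/-- `Q` represents the `k`-module of `R`-linear maps `P → A`. -/
structure DualRep (k R A P Q : Type) [Field k] [Ring R] [Algebra k R] [AddCommGroup A] [Module R A]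
    [AddCommGroup P] [Module R P] [AddCommGroup Q] [Module k Q] where
  th : Q →+ (P →ₗ[R] A)
  bij : Function.Bijective th
  smul : ∀ (c : k) q p, th (c • q) p = algebraMap k R c • th q p

variable {A : Type} [AddCommGroup A] [Module R A] [Module k A]

def DualRep.self (hs : ∀ (c : k) (a : A), algebraMap k R c • a = c • a) : DualRep k R A R A where
  th := { toFun := fun a => LinearMap.toSpanSingleton R A a
          map_zero' := by ext; simp
          map_add' := by intros; ext; simp }
  bij := by
    constructor
    · intro a b h
      simpa using congrArg (fun f => f 1) h
    · intro f
      exact ⟨f 1, by ext; simp⟩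
  smul := fun c q p => by
    simp only [AddMonoidHom.coe_mk, ZeroHom.coe_mk, LinearMap.toSpanSingleton_apply]
    rw [← hs, ← mul_smul, ← mul_smul, Algebra.commutes]

def DualRep.prod {P Q P' Q' : Type} [AddCommGroup P] [Module R P] [AddCommGroup Q] [Module k Q]
    [AddCommGroup P'] [Module R P'] [AddCommGroup Q'] [Module k Q']
    (a : DualRep k R A P Q) (b : DualRep k R A P' Q') : DualRep k R A (P × P') (Q × Q') where
  th := { toFun := fun q => (a.th q.1).coprod (b.th q.2)
          map_zero' := by ext <;> simp
          map_add' := by intros; ext <;> simp }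
  bij := by
    constructor
    · rintro ⟨q, q'⟩ ⟨r, r'⟩ h
      have h1 : a.th q = a.th r := by
        ext p; simpa using congrArg (fun f => f (p, 0)) h
      have h2 : b.th q' = b.th r' := by
        ext p; simpa using congrArg (fun f => f (0, p)) h
      exact Prod.ext (a.bij.1 h1) (b.bij.1 h2)
    · intro f
      obtain ⟨q, hq⟩ := a.bij.2 (f.comp (LinearMap.inl _ _ _))
      obtain ⟨q', hq'⟩ := b.bij.2 (f.comp (LinearMap.inr _ _ _))
      refine ⟨(q, q'), ?_⟩
      ext p <;> simp [hq, hq']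
  smul := fun c q p => by
    simp [a.smul, b.smul]

variable (P0 P1 P2 P3 P4 : Type)
  [AddCommGroup P0] [Module R P0] [AddCommGroup P1] [Module R P1]
  [AddCommGroup P2] [Module R P2] [AddCommGroup P3] [Module R P3] [AddCommGroup P4] [Module R P4]

variable (R) in
def resX : ℕ → ModuleCat.{0} R
  | 0 => ModuleCat.of R P0
  | 1 => ModuleCat.of R P1
  | 2 => ModuleCat.of R P2
  | 3 => ModuleCat.of R P3
  | 4 => ModuleCat.of R P4
  | _ => ModuleCat.of R PUnit

variable {P0 P1 P2 P3 P4}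
variable (d1 : P1 →ₗ[R] P0) (d2 : P2 →ₗ[R] P1) (d3 : P3 →ₗ[R] P2) (d4 : P4 →ₗ[R] P3)

def resD : ∀ n, resX R P0 P1 P2 P3 P4 (n+1) ⟶ resX R P0 P1 P2 P3 P4 n
  | 0 => ModuleCat.ofHom d1
  | 1 => ModuleCat.ofHom d2
  | 2 => ModuleCat.ofHom d3
  | 3 => ModuleCat.ofHom d4
  | 4 => ModuleCat.ofHom 0
  | _ + 5 => ModuleCat.ofHom 0

variable (ep : P0 →ₗ[R] A)

lemma resX_proj [Module.Projective R P0] [Module.Projective R P1] [Module.Projective R P2]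
    [Module.Projective R P3] [Module.Projective R P4] (n : ℕ) :
    Projective (resX R P0 P1 P2 P3 P4 n) := by
  rcases n with _ | _ | _ | _ | _ | n
  · exact (IsProjective.iff_projective P0).1 inferInstance
  · exact (IsProjective.iff_projective P1).1 inferInstance
  · exact (IsProjective.iff_projective P2).1 inferInstance
  · exact (IsProjective.iff_projective P3).1 inferInstance
  · exact (IsProjective.iff_projective P4).1 inferInstance
  · exact (IsProjective.iff_projective PUnit).1 inferInstance

variable {d1 d2 d3 d4}

lemma resD_exact (h1 : Function.Exact d2 d1) (h2 : Function.Exact d3 d2)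
    (h3 : Function.Exact d4 d3) (h4 : Function.Injective d4) (n : ℕ) :
    Function.Exact (resD d1 d2 d3 d4 (n+1)).hom (resD d1 d2 d3 d4 n).hom := by
  rcases n with _ | _ | _ | _ | _ | n
  · exact h1
  · exact h2
  · exact h3
  · intro x
    constructor
    · intro h
      exact ⟨PUnit.unit, (h4 (h.trans (map_zero d4).symm)).symm⟩
    · rintro ⟨y, rfl⟩
      exact map_zero d4
  · intro x; exact ⟨fun _ => ⟨PUnit.unit, Subsingleton.elim (α := PUnit) _ _⟩, fun _ => rfl⟩
  · intro x; exact ⟨fun _ => ⟨PUnit.unit, Subsingleton.elim (α := PUnit) _ _⟩, fun _ => rfl⟩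

/-- Lift of a linear map to `Q` to the category of modules. -/
def DualRep.lift {P Q V : Type} [AddCommGroup P] [Module R P] [AddCommGroup Q] [Module k Q]
    [AddCommGroup V] [Module k V] (r : DualRep k R A P Q) (s : V →ₗ[k] Q) :
    V →ₗ[k] (ModuleCat.of R P ⟶ ModuleCat.of R A) where
  toFun v := ModuleCat.ofHom (r.th (s v))
  map_add' := by intros; simp
  map_smul' := fun c v => by
    ext p
    simp only [map_smul]
    exact r.smul c (s v) p

variable {Q0 Q1 Q2 Q3 Q4 : Type}
  [AddCommGroup Q0] [Module k Q0] [AddCommGroup Q1] [Module k Q1]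
  [AddCommGroup Q2] [Module k Q2] [AddCommGroup Q3] [Module k Q3] [AddCommGroup Q4] [Module k Q4]
  (r0 : DualRep k R A P0 Q0) (r1 : DualRep k R A P1 Q1) (r2 : DualRep k R A P2 Q2)
  (r3 : DualRep k R A P3 Q3) (r4 : DualRep k R A P4 Q4)

lemma DualRep.step {P Q P' Q' V P'' Q'' : Type} [AddCommGroup P] [Module R P] [AddCommGroup Q]
    [Module k Q]
    [AddCommGroup P'] [Module R P'] [AddCommGroup Q'] [Module k Q']
    [AddCommGroup P''] [Module R P''] [AddCommGroup Q''] [Module k Q'']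
    [AddCommGroup V] [Module k V] (r : DualRep k R A P Q) (r' : DualRep k R A P' Q')
    (r'' : DualRep k R A P'' Q'')
    (d : P' →ₗ[R] P) (d' : P'' →ₗ[R] P') (f : Q →ₗ[k] Q') (f' : Q' →ₗ[k] Q'')
    (hf : ∀ q, r'.th (f q) = (r.th q).comp d)
    (hf' : ∀ q, r''.th (f' q) = (r'.th q).comp d') (s : V →ₗ[k] Q')
    (h1 : ∀ v, f' (s v) = 0)
    (h2 : ∀ z, f' z = 0 → ∃ v w, z = s v + f w)
    (h3 : ∀ v w, s v = f w → v = 0) :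
    (∀ v, ModuleCat.ofHom d' ≫ r'.lift s v = 0) ∧
    (∀ z : ModuleCat.of R P' ⟶ ModuleCat.of R A, ModuleCat.ofHom d' ≫ z = 0 →
      ∃ v, ∃ w : ModuleCat.of R P ⟶ ModuleCat.of R A, z = r'.lift s v + ModuleCat.ofHom d ≫ w) ∧
    (∀ v, ∀ w : ModuleCat.of R P ⟶ ModuleCat.of R A, r'.lift s v = ModuleCat.ofHom d ≫ w →
      v = 0) := by
  refine ⟨fun v => ?_, fun z hz => ?_, fun v w h => ?_⟩
  · have := hf' (s v)
    rw [h1, map_zero] at this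
    change ModuleCat.ofHom ((r'.th (s v)).comp d') = 0
    rw [← this]; rfl
  · obtain ⟨q, hq⟩ := r'.bij.2 z.hom
    have h0 : f' q = 0 := by
      apply r''.bij.1
      rw [hf', hq, map_zero]
      exact congrArg ModuleCat.Hom.hom hz
    obtain ⟨v, w, h⟩ := h2 q h0
    refine ⟨v, ModuleCat.ofHom (r.th w), ?_⟩
    apply ModuleCat.hom_ext
    rw [← hq, h, map_add, hf]; rfl
  · obtain ⟨q, hq⟩ := r.bij.2 w.hom
    refine h3 v q (r'.bij.1 ?_)
    rw [hf, hq]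
    exact congrArg ModuleCat.Hom.hom h

/-- All Ext groups computed by a length-four resolution. -/
theorem ext_main [Module.Projective R P0] [Module.Projective R P1] [Module.Projective R P2]
    [Module.Projective R P3] [Module.Projective R P4]
    (he1 : Function.Exact d2 d1) (he2 : Function.Exact d3 d2)
    (he3 : Function.Exact d4 d3) (he4 : Function.Injective d4)
    (he0 : Function.Exact d1 ep) (hes : Function.Surjective ep)
    {f0 : Q0 →ₗ[k] Q1} {f1 : Q1 →ₗ[k] Q2} {f2 : Q2 →ₗ[k] Q3} {f3 : Q3 →ₗ[k] Q4}
    (hf0 : ∀ q, r1.th (f0 q) = (r0.th q).comp d1)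
    (hf1 : ∀ q, r2.th (f1 q) = (r1.th q).comp d2)
    (hf2 : ∀ q, r3.th (f2 q) = (r2.th q).comp d3)
    (hf3 : ∀ q, r4.th (f3 q) = (r3.th q).comp d4)
    {V0 V1 V2 V3 : Type} [AddCommGroup V0] [Module k V0] [AddCommGroup V1] [Module k V1]
    [AddCommGroup V2] [Module k V2] [AddCommGroup V3] [Module k V3]
    (s0 : V0 →ₗ[k] Q0) (s1 : V1 →ₗ[k] Q1) (s2 : V2 →ₗ[k] Q2) (s3 : V3 →ₗ[k] Q3)
    (a0 : (∀ v, f0 (s0 v) = 0) ∧ (∀ z, f0 z = 0 → ∃ v, z = s0 v) ∧ (∀ v, s0 v = 0 → v = 0))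
    (a1 : (∀ v, f1 (s1 v) = 0) ∧ (∀ z, f1 z = 0 → ∃ v w, z = s1 v + f0 w) ∧
      (∀ v w, s1 v = f0 w → v = 0))
    (a2 : (∀ v, f2 (s2 v) = 0) ∧ (∀ z, f2 z = 0 → ∃ v w, z = s2 v + f1 w) ∧
      (∀ v w, s2 v = f1 w → v = 0))
    (a3 : (∀ v, f3 (s3 v) = 0) ∧ (∀ z, f3 z = 0 → ∃ v w, z = s3 v + f2 w) ∧
      (∀ v w, s3 v = f2 w → v = 0))
    (a4 : Function.Surjective f3) :
    let H : ℕ → ModuleCat.{0} k := fun n => ((Ext k (ModuleCat.{0} R) n).obj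
      (Opposite.op (ModuleCat.of R A))).obj (ModuleCat.of R A)
    Nonempty (H 0 ≃ₗ[k] V0) ∧ Nonempty (H 1 ≃ₗ[k] V1) ∧ Nonempty (H 2 ≃ₗ[k] V2) ∧
    Nonempty (H 3 ≃ₗ[k] V3) ∧ ∀ n, 4 ≤ n → Subsingleton (H n) := by
  intro H
  have hP := resX_proj (R := R) (P0 := P0) (P1 := P1) (P2 := P2) (P3 := P3) (P4 := P4)
  have hex := resD_exact he1 he2 he3 he4
  refine ⟨?_, ?_, ?_, ?_, ?_⟩
  · refine ext_crit0 (resX R P0 P1 P2 P3 P4) (resD d1 d2 d3 d4) (ModuleCat.of R A)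
      (ModuleCat.ofHom ep) hP hex he0 hes (r0.lift s0) ?_ ?_ ?_
    · exact (DualRep.step (f := (0 : PUnit →ₗ[k] Q0)) (d := (0 : P0 →ₗ[R] PUnit))
        ⟨0, ⟨fun _ _ _ => rfl, fun x => ⟨0, Subsingleton.elim _ _⟩⟩, by simp⟩ r0 r1 d1 f0
        (fun q => by simp) hf0 s0 a0.1 (fun z hz => by
          obtain ⟨v, h⟩ := a0.2.1 z hz; exact ⟨v, 0, by simpa using h⟩)
          (fun v w h => a0.2.2 v h)).1
    · intro z hz
      obtain ⟨q, hq⟩ := r0.bij.2 (ModuleCat.Hom.hom z)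
      obtain ⟨v, hv⟩ := a0.2.1 q (by
        apply r1.bij.1
        rw [hf0, hq, map_zero]
        exact congrArg ModuleCat.Hom.hom hz)
      refine ⟨v, ModuleCat.hom_ext ?_⟩
      rw [← hq, hv]; rfl
    · intro v hv
      refine a0.2.2 v (r0.bij.1 ?_)
      rw [map_zero]
      exact congrArg ModuleCat.Hom.hom hv
  · obtain ⟨x1, x2, x3⟩ := DualRep.step r0 r1 r2 d1 d2 f0 f1 hf0 hf1 s1 a1.1 a1.2.1 a1.2.2
    exact ext_crit (resX R P0 P1 P2 P3 P4) (resD d1 d2 d3 d4) (ModuleCat.of R A)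
      (ModuleCat.ofHom ep) hP hex he0 hes 0 (r1.lift s1) x1 x2 x3
  · obtain ⟨x1, x2, x3⟩ := DualRep.step r1 r2 r3 d2 d3 f1 f2 hf1 hf2 s2 a2.1 a2.2.1 a2.2.2
    exact ext_crit (resX R P0 P1 P2 P3 P4) (resD d1 d2 d3 d4) (ModuleCat.of R A)
      (ModuleCat.ofHom ep) hP hex he0 hes 1 (r2.lift s2) x1 x2 x3
  · obtain ⟨x1, x2, x3⟩ := DualRep.step r2 r3 r4 d3 d4 f2 f3 hf2 hf3 s3 a3.1 a3.2.1 a3.2.2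
    exact ext_crit (resX R P0 P1 P2 P3 P4) (resD d1 d2 d3 d4) (ModuleCat.of R A)
      (ModuleCat.ofHom ep) hP hex he0 hes 2 (r3.lift s3) x1 x2 x3
  · intro n hn
    obtain ⟨m, rfl⟩ := Nat.exists_eq_add_of_le' hn
    suffices Nonempty (H (m+3+1) ≃ₗ[k] PUnit) by
      obtain ⟨e⟩ := this
      exact e.toEquiv.subsingleton
    refine ext_crit (resX R P0 P1 P2 P3 P4) (resD d1 d2 d3 d4) (ModuleCat.of R A)
      (ModuleCat.ofHom ep) hP hex he0 hes (m+3) 0 ?_ ?_ ?_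
    · intro v; simp
    · intro z hz
      refine ⟨0, ?_⟩
      rcases m with _ | m
      · obtain ⟨q, hq⟩ := r4.bij.2 (ModuleCat.Hom.hom z)
        obtain ⟨w, hw⟩ := a4 q
        refine ⟨ModuleCat.ofHom (r3.th w), ModuleCat.hom_ext ?_⟩
        rw [← hq, ← hw, hf3]
        exact (congrArg ModuleCat.Hom.hom
          (zero_add (ModuleCat.ofHom ((r3.th w).comp d4)))).symm
      · refine ⟨0, ModuleCat.hom_ext (LinearMap.ext fun x => ?_)⟩
        have : x = 0 := Subsingleton.elim (α := PUnit) _ _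
        rw [this, map_zero, map_zero]
    · intro v w h; rfl

end PartC2


section PartB

section cone
variable {R : Type} [Ring R] {P0 P1 P2 P3 : Type} [AddCommGroup P0] [Module R P0] [AddCommGroup P1] [Module R P1]
  [AddCommGroup P2] [Module R P2] [AddCommGroup P3] [Module R P3]

def cD (d' : P2 →ₗ[R] P1) (φ : P1 →ₗ[R] P1) (d : P1 →ₗ[R] P0) : P2 × P1 →ₗ[R] P1 × P0 :=
  (d'.coprod φ).prod (-(d.comp (LinearMap.snd R P2 P1)))
def cD0 (d' : P1 →ₗ[R] P0) (φ : P0 →ₗ[R] P0) : P1 × P0 →ₗ[R] P0 := d'.coprod φ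
def cDt (φ : P1 →ₗ[R] P1) (d : P1 →ₗ[R] P0) : P1 →ₗ[R] P1 × P0 := φ.prod (-d)

lemma cD_apply (d' : P2 →ₗ[R] P1) (φ : P1 →ₗ[R] P1) (d : P1 →ₗ[R] P0) (z) :
   cD d' φ d z = (d' z.1 + φ z.2, - d z.2) := rfl
lemma cD0_apply (d' : P1 →ₗ[R] P0) (φ : P0 →ₗ[R] P0) (z) : cD0 d' φ z = d' z.1 + φ z.2 := rfl
lemma cDt_apply (φ : P1 →ₗ[R] P1) (d : P1 →ₗ[R] P0) (z) : cDt φ d z = (φ z, - d z) := rfl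

lemma cone_top_inj (φ : P1 →ₗ[R] P1) (d : P1 →ₗ[R] P0) (h : Function.Injective d) :
    Function.Injective (cDt φ d) := by
  intro a b hab
  simp only [cDt_apply, Prod.mk.injEq, neg_inj] at hab
  exact h hab.2

lemma cone_mid (d3 : P3 →ₗ[R] P2) (d2 : P2 →ₗ[R] P1) (d1 : P1 →ₗ[R] P0) (φ2 : P2 →ₗ[R] P2) (φ1 : P1 →ₗ[R] P1)
    (h1 : Function.Exact d2 d1) (h2 : Function.Exact d3 d2)
    (c2 : ∀ z, d2 (φ2 z) = φ1 (d2 z)) : Function.Exact (cD d3 φ2 d2) (cD d2 φ1 d1) := by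
  rintro ⟨u, v⟩
  constructor
  · intro h
    simp only [cD_apply, Prod.mk_eq_zero, neg_eq_zero] at h
    obtain ⟨w, rfl⟩ := (h1 v).1 h.2
    obtain ⟨z, hz⟩ := (h2 (u + φ2 w)).1 (by rw [map_add, c2, h.1])
    exact ⟨(z, -w), by simp [cD_apply, hz]⟩
  · rintro ⟨⟨z, w⟩, h⟩
    rw [← h]
    simp [cD_apply, c2, h1.apply_apply_eq_zero, h2.apply_apply_eq_zero]

lemma cone_mid_top (d2 : P2 →ₗ[R] P1) (d1 : P1 →ₗ[R] P0) (φ2 : P2 →ₗ[R] P2) (φ1 : P1 →ₗ[R] P1)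
    (h1 : Function.Exact d2 d1) (h2 : Function.Injective d2)
    (c2 : ∀ z, d2 (φ2 z) = φ1 (d2 z)) : Function.Exact (cDt φ2 d2) (cD d2 φ1 d1) := by
  rintro ⟨u, v⟩
  constructor
  · intro h
    simp only [cD_apply, Prod.mk_eq_zero, neg_eq_zero] at h
    obtain ⟨w, rfl⟩ := (h1 v).1 h.2
    have hz : u + φ2 w = 0 := h2 (by rw [map_add, c2, h.1, map_zero])
    exact ⟨-w, by simp [cDt_apply, eq_neg_of_add_eq_zero_left hz]⟩
  · rintro ⟨w, h⟩
    rw [← h]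
    simp [cD_apply, cDt_apply, c2, h1.apply_apply_eq_zero]

variable {N N' : Type} [AddCommGroup N] [AddCommGroup N'] (π : P0 →+ N) (Θ : N →+ N) (ev : N →+ N')

lemma cone_one (d2 : P2 →ₗ[R] P1) (d1 : P1 →ₗ[R] P0) (φ1 : P1 →ₗ[R] P1)
    (φ0 : P0 →ₗ[R] P0)
    (h1 : Function.Exact d2 d1) (h0 : Function.Exact d1 π) (hπ : ∀ z, π (φ0 z) = Θ (π z))
    (hΘ : Function.Injective Θ) (c1 : ∀ z, d1 (φ1 z) = φ0 (d1 z)) :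
    Function.Exact (cD d2 φ1 d1) (cD0 d1 φ0) := by
  rintro ⟨u, v⟩
  constructor
  · intro h
    rw [cD0_apply] at h
    have hv : π v = 0 := hΘ (by
      have := congrArg π h
      simp only [map_add, hπ, map_zero, h0.apply_apply_eq_zero, zero_add] at this
      rw [this, map_zero])
    obtain ⟨w, rfl⟩ := (h0 v).1 hv
    obtain ⟨z, hz⟩ := (h1 (u + φ1 w)).1 (by rw [map_add, c1, h])
    exact ⟨(z, -w), by simp [cD_apply, hz]⟩
  · rintro ⟨⟨z, w⟩, h⟩
    rw [← h]
    simp [cD_apply, cD0_apply, c1, h1.apply_apply_eq_zero]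

lemma cone_one_top (d1 : P1 →ₗ[R] P0) (φ1 : P1 →ₗ[R] P1)
    (φ0 : P0 →ₗ[R] P0)
    (h1 : Function.Injective d1) (h0 : Function.Exact d1 π) (hπ : ∀ z, π (φ0 z) = Θ (π z))
    (hΘ : Function.Injective Θ) (c1 : ∀ z, d1 (φ1 z) = φ0 (d1 z)) :
    Function.Exact (cDt φ1 d1) (cD0 d1 φ0) := by
  rintro ⟨u, v⟩
  constructor
  · intro h
    rw [cD0_apply] at h
    have hv : π v = 0 := hΘ (by
      have := congrArg π h
      simp only [map_add, hπ, map_zero, h0.apply_apply_eq_zero, zero_add] at this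
      rw [this, map_zero])
    obtain ⟨w, rfl⟩ := (h0 v).1 hv
    have hz : u + φ1 w = 0 := h1 (by rw [map_add, c1, h, map_zero])
    exact ⟨-w, by simp [cDt_apply, eq_neg_of_add_eq_zero_left hz]⟩
  · rintro ⟨w, h⟩
    rw [← h]
    simp [cDt_apply, cD0_apply, c1]

lemma cone_zero (d1 : P1 →ₗ[R] P0) (φ0 : P0 →ₗ[R] P0) (π' : P0 →+ N')
    (h0 : Function.Exact d1 π) (hs : Function.Surjective π) (hπ : ∀ z, π (φ0 z) = Θ (π z))
    (hE : Function.Exact Θ ev) (he : ∀ z, π' z = ev (π z)) :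
    Function.Exact (cD0 d1 φ0) π' := by
  intro r
  rw [he]
  constructor
  · intro h
    obtain ⟨n, hn⟩ := (hE _).1 h
    obtain ⟨v, rfl⟩ := hs n
    obtain ⟨u, hu⟩ := (h0 (r - φ0 v)).1 (by rw [map_sub, hπ, hn, sub_self])
    exact ⟨(u, v), by rw [cD0_apply]; simp [hu]⟩
  · rintro ⟨⟨u, v⟩, rfl⟩
    rw [cD0_apply]
    simp [hπ, h0.apply_apply_eq_zero, hE.apply_apply_eq_zero]

end cone

section poly
open Polynomial
variable {S : Type} [Ring S] (z : S)

noncomputable def pTh : S[X] →+ S[X] := AddMonoidHom.mulRight (C z - X)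
noncomputable def pEv : S[X] →+ S := (leval z).toAddMonoidHom

lemma pTh_apply (p : S[X]) : pTh z p = p * (C z - X) := rfl
lemma pEv_apply (p : S[X]) : pEv z p = p.eval z := rfl

lemma pTh_inj : Function.Injective (pTh z) := by
  rw [injective_iff_map_eq_zero]
  intro p hp
  rw [pTh_apply, ← neg_sub, mul_neg, neg_eq_zero] at hp
  exact (Monic.mul_left_eq_zero_iff (monic_X_sub_C z)).1 hp

lemma pEv_exact : Function.Exact (pTh z) (pEv z) := by
  intro p
  constructor
  · have key : ∀ p : S[X], ∃ q, p - C (p.eval z) = q * (C z - X) := by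
      intro p
      induction p using Polynomial.induction_on' with
      | add p q hp hq =>
        obtain ⟨a, ha⟩ := hp
        obtain ⟨b, hb⟩ := hq
        exact ⟨a + b, by rw [add_mul, ← ha, ← hb, eval_add, C_add]; abel⟩
      | monomial n a =>
        induction n with
        | zero => exact ⟨0, by simp⟩
        | succ n ih =>
          obtain ⟨q, hq⟩ := ih
          have e : (C (eval z (monomial n a)) : S[X]) = monomial n a - q * (C z - X) := by rw [← hq]; abel
          refine ⟨q * C z - monomial n a, ?_⟩
          have : (C (eval z (monomial (n+1) a)) : S[X]) = C (eval z (monomial n a)) * C z := by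
            simp [pow_succ, mul_assoc]
          rw [this, e, ← monomial_mul_X, sub_mul, sub_mul, mul_sub (q), mul_sub (q * _), sub_mul, mul_sub (monomial n a),
            mul_assoc q X, X_mul]
          simp only [mul_assoc]
          abel
    intro h
    obtain ⟨q, hq⟩ := key p
    rw [pEv_apply] at h
    exact ⟨q, by rw [pTh_apply, ← hq, h]; simp⟩
  · rintro ⟨q, rfl⟩
    rw [pTh_apply, pEv_apply, ← neg_sub, mul_neg, eval_neg, eval_mul_X_sub_C, neg_zero]

lemma pEv_surj : Function.Surjective (pEv z) := fun a => ⟨C a, by simp [pEv_apply]⟩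
end poly

end PartB


section PartB2
open Polynomial

variable {k U : Type} [Field k] [Ring U] [Algebra k U] {t : k}

lemma basis_ind {ι : Type} (b : Module.Basis ι k U) {P : U → Prop} (h0 : P 0) (ha : ∀ u v, P u → P v → P (u + v))
    (hs : ∀ (c : k) u, P u → P (c • u)) (hb : ∀ i, P (b i)) (u : U) : P u := by
  have := b.mem_span u
  induction this using Submodule.span_induction with
  | mem u hu => obtain ⟨i, rfl⟩ := hu; exact hb i
  | zero => exact h0
  | add u v _ _ hu hv => exact ha u v hu hv
  | smul c u _ hu => exact hs c u hu

noncomputable def piOf {N : Type} [Ring N] [Algebra k N] (c : U →ₐ[k] N) (T : U →ₗ[k] N) : U ⊗[k] Uᵐᵒᵖ →ₗ[k] N :=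
  TensorProduct.lift (((LinearMap.mul k N).comp c.toLinearMap).compl₂
    (T.comp (MulOpposite.opLinearEquiv k).symm.toLinearMap))

lemma piOf_tmul {N : Type} [Ring N] [Algebra k N] (c : U →ₐ[k] N) (T : U →ₗ[k] N) (u : U) (v : Uᵐᵒᵖ) :
    piOf c T (u ⊗ₜ v) = c u * T v.unop := by
  simp [piOf]

abbrev lft (k : Type) [Field k] {U : Type} [Ring U] [Algebra k U] (z : U) : U ⊗[k] Uᵐᵒᵖ := z ⊗ₜ 1
abbrev rgt (k : Type) [Field k] {U : Type} [Ring U] [Algebra k U] (z : U) : U ⊗[k] Uᵐᵒᵖ := 1 ⊗ₜ MulOpposite.op z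
abbrev dif (k : Type) [Field k] {U : Type} [Ring U] [Algebra k U] (z : U) : U ⊗[k] Uᵐᵒᵖ := lft k z - rgt k z

lemma piOf_dif {S : Type} [Ring S] [Algebra k S] (b : Module.Basis (ℕ × ℕ × ℕ × ℕ) k U)
    (c : U →ₐ[k] S) (T : U →ₗ[k] S[X]) (z : U)
    (h : ∀ p, T (z * b p) = C (c z) * T (b p) - T (b p) * (C (c z) - X)) (r : U ⊗[k] Uᵐᵒᵖ) :
    piOf (CAlgHom.comp c) T (r * dif k z) = pTh (c z) (piOf (CAlgHom.comp c) T r) := by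
  have h' : ∀ v, T (z * v) = C (c z) * T v - T v * (C (c z) - X) := by
    intro v
    induction v using basis_ind b with
    | h0 => simp
    | ha u v hu hv => rw [mul_add, map_add, map_add, hu, hv, mul_add, add_mul]; abel
    | hs a p hp => rw [mul_smul_comm, map_smul, map_smul, hp, mul_smul_comm, smul_mul_assoc, smul_sub]
    | hb p => exact h p
  induction r using TensorProduct.induction_on with
  | zero => simp
  | add r s hr hs => rw [add_mul, map_add, map_add, hr, hs, map_add]
  | tmul u v =>
    rw [mul_sub, map_sub, Algebra.TensorProduct.tmul_mul_tmul, Algebra.TensorProduct.tmul_mul_tmul, piOf_tmul,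
      piOf_tmul, piOf_tmul, mul_one, mul_one, MulOpposite.unop_mul, MulOpposite.unop_op, h', pTh_apply]
    simp only [AlgHom.comp_apply, map_mul, CAlgHom_apply]
    rw [mul_sub, mul_assoc]; simp only [mul_assoc]; abel

lemma piOf_ev {S : Type} [Ring S] [Algebra k S] (b : Module.Basis (ℕ × ℕ × ℕ × ℕ) k U)
    (c : U →ₐ[k] S) (T : U →ₗ[k] S[X]) (T' : U →ₗ[k] S) (z : S)
    (h : ∀ p, T' (b p) = (T (b p)).eval z) (r : U ⊗[k] Uᵐᵒᵖ) :
    piOf c T' r = pEv z (piOf (CAlgHom.comp c) T r) := by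
  have h' : ∀ v, T' v = (T v).eval z := by
    intro v
    induction v using basis_ind b with
    | h0 => simp
    | ha u v hu hv => simp [hu, hv]
    | hs a p hp => rw [map_smul, map_smul, hp, eval_smul]
    | hb p => exact h p
  induction r using TensorProduct.induction_on with
  | zero => simp
  | add r s hr hs => rw [map_add, map_add, hr, hs, map_add]
  | tmul u v =>
    rw [piOf_tmul, piOf_tmul, h', pEv_apply]
    simp [eval_C_mul]

namespace PBW
variable (B : PBW k U t)


def N1 (U : Type) [Ring U] : Type := U[X]
noncomputable instance {U : Type} [Ring U] : Ring (N1 U) := inferInstanceAs (Ring U[X])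
noncomputable instance {k U : Type} [Field k] [Ring U] [Algebra k U] : Algebra k (N1 U) := inferInstanceAs (Algebra k U[X])
def N2 (U : Type) [Ring U] : Type := (N1 U)[X]
noncomputable instance {U : Type} [Ring U] : Ring (N2 U) := inferInstanceAs (Ring (N1 U)[X])
noncomputable instance {k U : Type} [Field k] [Ring U] [Algebra k U] : Algebra k (N2 U) := inferInstanceAs (Algebra k (N1 U)[X])
def N3 (U : Type) [Ring U] : Type := (N2 U)[X]
noncomputable instance {U : Type} [Ring U] : Ring (N3 U) := inferInstanceAs (Ring (N2 U)[X])
noncomputable instance {k U : Type} [Field k] [Ring U] [Algebra k U] : Algebra k (N3 U) := inferInstanceAs (Algebra k (N2 U)[X])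

abbrev c0 (k : Type) [Field k] {U : Type} [Ring U] [Algebra k U] : U →ₐ[k] U := AlgHom.id k U
noncomputable def c1 (k : Type) [Field k] {U : Type} [Ring U] [Algebra k U] : U →ₐ[k] N1 U := (CAlgHom : U →ₐ[k] U[X]).comp (c0 k)
noncomputable def c2 (k : Type) [Field k] {U : Type} [Ring U] [Algebra k U] : U →ₐ[k] N2 U := (CAlgHom : N1 U →ₐ[k] (N1 U)[X]).comp (c1 k)
noncomputable def c3 (k : Type) [Field k] {U : Type} [Ring U] [Algebra k U] : U →ₐ[k] N3 U := (CAlgHom : N2 U →ₐ[k] (N2 U)[X]).comp (c2 k)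

noncomputable def kmon (k : Type) [Field k] {S : Type} [Ring S] [Algebra k S] (i : ℕ) : S →ₗ[k] S[X] where
  toFun := monomial i
  map_add' := by simp
  map_smul' c a := by rw [RingHom.id_apply, smul_monomial]

lemma kmon_apply {S : Type} [Ring S] [Algebra k S] (i : ℕ) (a : S) : kmon k i a = monomial i a := rfl

noncomputable def n1 (k : Type) [Field k] {U : Type} [Ring U] [Algebra k U] (m : ℕ) : U →ₗ[k] N1 U := (kmon k m : U →ₗ[k] U[X])
noncomputable def n2 (k : Type) [Field k] {U : Type} [Ring U] [Algebra k U] (l m : ℕ) : U →ₗ[k] N2 U :=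
  (kmon k l : N1 U →ₗ[k] (N1 U)[X]).comp (n1 k m)
noncomputable def n3 (k : Type) [Field k] {U : Type} [Ring U] [Algebra k U] (j l m : ℕ) : U →ₗ[k] N3 U :=
  (kmon k j : N2 U →ₗ[k] (N2 U)[X]).comp (n2 k l m)

lemma n1_l (m : ℕ) (a u : U) : c1 k a * n1 k m u = n1 k m (a * u) := C_mul_monomial (R := U)
lemma n1_r (m : ℕ) (a u : U) : n1 k m u * c1 k a = n1 k m (u * a) := monomial_mul_C (R := U)
lemma n2_l (l m : ℕ) (a u : U) : c2 k a * n2 k l m u = n2 k l m (a * u) :=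
  (C_mul_monomial (R := N1 U)).trans (congrArg (kmon k l : N1 U →ₗ[k] (N1 U)[X]) (n1_l m a u))
lemma n2_r (l m : ℕ) (a u : U) : n2 k l m u * c2 k a = n2 k l m (u * a) :=
  (monomial_mul_C (R := N1 U)).trans (congrArg (kmon k l : N1 U →ₗ[k] (N1 U)[X]) (n1_r m a u))
lemma n3_l (j l m : ℕ) (a u : U) : c3 k a * n3 k j l m u = n3 k j l m (a * u) :=
  (C_mul_monomial (R := N2 U)).trans (congrArg (kmon k j : N2 U →ₗ[k] (N2 U)[X]) (n2_l l m a u))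
lemma n3_r (j l m : ℕ) (a u : U) : n3 k j l m u * c3 k a = n3 k j l m (u * a) :=
  (monomial_mul_C (R := N2 U)).trans (congrArg (kmon k j : N2 U →ₗ[k] (N2 U)[X]) (n2_r l m a u))

noncomputable def T4 : U →ₗ[k] (N3 U)[X] :=
  B.b.constr k fun p => kmon k p.1 (n3 k p.2.1 p.2.2.1 p.2.2.2 1)
noncomputable def T3 : U →ₗ[k] (N2 U)[X] :=
  B.b.constr k fun p => kmon k p.2.1 (n2 k p.2.2.1 p.2.2.2 (B.x ^ p.1))
noncomputable def T2 : U →ₗ[k] (N1 U)[X] :=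
  B.b.constr k fun p => kmon k p.2.2.1 (n1 k p.2.2.2 (B.x ^ p.1 * B.y ^ p.2.1))
noncomputable def T1 : U →ₗ[k] U[X] :=
  B.b.constr k fun p => kmon k p.2.2.2 (B.x ^ p.1 * B.y ^ p.2.1 * B.D ^ p.2.2.1)

lemma T4b (i j l m : ℕ) : B.T4 (B.b (i, j, l, m)) = kmon k i (n3 k j l m 1) := by
  rw [T4, Module.Basis.constr_basis]
lemma T3b (i j l m : ℕ) : B.T3 (B.b (i, j, l, m)) = kmon k j (n2 k l m (B.x ^ i)) := by
  rw [T3, Module.Basis.constr_basis]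
lemma T2b (i j l m : ℕ) : B.T2 (B.b (i, j, l, m)) = kmon k l (n1 k m (B.x ^ i * B.y ^ j)) := by
  rw [T2, Module.Basis.constr_basis]
lemma T1b (i j l m : ℕ) : B.T1 (B.b (i, j, l, m)) = kmon k m (B.x ^ i * B.y ^ j * B.D ^ l) := by
  rw [T1, Module.Basis.constr_basis]

lemma kmon_th {S : Type} [Ring S] [Algebra k S] (i : ℕ) (z a : S) :
    C z * kmon k i a - kmon k i a * (C z - X) = kmon k i (z * a) - kmon k i (a * z) + kmon k (i+1) a := by
  simp only [kmon_apply, C_mul_monomial, mul_sub, monomial_mul_C, monomial_mul_X]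
  abel

lemma yxi (i : ℕ) : B.y * B.x ^ i = B.x ^ i * B.y := Commute.pow_right B.yx i
lemma Dxi (i : ℕ) : B.D * B.x ^ i = B.x ^ i * B.D := Commute.pow_right B.Dx i

lemma xb (i j l m : ℕ) : B.x * B.b (i, j, l, m) = B.b (i+1, j, l, m) := by
  simp only [B.hb, pow_succ', mul_assoc]
lemma yb (i j l m : ℕ) : B.y * B.b (i, j, l, m) = B.b (i, j+1, l, m) := by
  simp only [B.hb, ← mul_assoc, B.yxi]
  simp only [pow_succ', mul_assoc]
lemma Db (i j l m : ℕ) : B.D * B.b (i, j, l, m) = B.b (i, j, l+1, m) +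
    (j : k) • (B.b (i, j+1, l, m) + t • B.b (i+1, j, l, m)) := by
  simp only [B.hb, ← mul_assoc]
  rw [Dxi, mul_assoc _ B.D, pbw_Dyj B.yx B.Dy]
  simp only [mul_add, add_mul, smul_mul_assoc, mul_smul_comm, pow_succ' B.D, pow_succ B.x, mul_assoc]
lemma Eb' (i j l m : ℕ) : B.E * B.b (i, j, l, m) = B.b (i, j, l, m) * B.E + ((i + j + l : ℕ) : k) • B.b (i, j, l, m) := by
  simp only [B.hb]
  exact adE_mon B.Ex B.Ey B.ED i j l m
lemma Eb (i j l m : ℕ) : B.E * B.b (i, j, l, m) = B.b (i, j, l, m+1) + ((i + j + l : ℕ) : k) • B.b (i, j, l, m) := by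
  rw [Eb']
  simp only [B.hb, mul_assoc, pow_succ]

lemma hT4 (p) : B.T4 (B.x * B.b p) = C (c3 k B.x) * B.T4 (B.b p) - B.T4 (B.b p) * (C (c3 k B.x) - X) := by
  obtain ⟨i, j, l, m⟩ := p
  rw [xb, T4b, T4b, kmon_th, n3_l, n3_r]
  simp

lemma hT3 (p) : B.T3 (B.y * B.b p) = C (c2 k B.y) * B.T3 (B.b p) - B.T3 (B.b p) * (C (c2 k B.y) - X) := by
  obtain ⟨i, j, l, m⟩ := p
  rw [yb, T3b, T3b, kmon_th, n2_l, n2_r, yxi]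
  simp

lemma hT2 (p) : B.T2 (B.D * B.b p) = C (c1 k B.D) * B.T2 (B.b p) - B.T2 (B.b p) * (C (c1 k B.D) - X) := by
  obtain ⟨i, j, l, m⟩ := p
  rw [Db, map_add, map_smul, map_add, map_smul, T2b, T2b, T2b, T2b, kmon_th, n1_l, n1_r]
  have : B.D * (B.x ^ i * B.y ^ j) = B.x ^ i * B.y ^ j * B.D + (j : k) • (B.x ^ i * B.y ^ (j+1) + t • (B.x ^ (i+1) * B.y ^ j)) := by
    rw [← mul_assoc, Dxi, mul_assoc _ B.D, pbw_Dyj B.yx B.Dy]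
    simp only [mul_add, mul_smul_comm, pow_succ B.x, mul_assoc]
  rw [this]
  simp only [map_add, map_smul]
  abel

lemma hT1 (p) : B.T1 (B.E * B.b p) = C (c0 k B.E) * B.T1 (B.b p) - B.T1 (B.b p) * (C (c0 k B.E) - X) := by
  obtain ⟨i, j, l, m⟩ := p
  rw [Eb, map_add, map_smul, T1b, T1b, kmon_th]
  have := adE_mon (k := k) B.Ex B.Ey B.ED i j l 0
  simp only [pow_zero, mul_one] at this
  rw [AlgHom.id_apply, this]
  simp only [map_add, map_smul]
  abel

noncomputable def pi4 : U ⊗[k] Uᵐᵒᵖ →ₗ[k] (N3 U)[X] := piOf (CAlgHom.comp (c3 k)) B.T4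
noncomputable def pi3 : U ⊗[k] Uᵐᵒᵖ →ₗ[k] (N2 U)[X] := piOf (CAlgHom.comp (c2 k)) B.T3
noncomputable def pi2 : U ⊗[k] Uᵐᵒᵖ →ₗ[k] (N1 U)[X] := piOf (CAlgHom.comp (c1 k)) B.T2
noncomputable def pi1 : U ⊗[k] Uᵐᵒᵖ →ₗ[k] U[X] := piOf (CAlgHom.comp (c0 k)) B.T1
noncomputable def pi0 : U ⊗[k] Uᵐᵒᵖ →ₗ[k] U := piOf (c0 k) LinearMap.id

lemma pi4_mul (r) : B.pi4 (r * dif k B.x) = pTh (c3 k B.x) (B.pi4 r) := piOf_dif B.b _ _ _ B.hT4 r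
lemma pi3_mul (r) : B.pi3 (r * dif k B.y) = pTh (c2 k B.y) (B.pi3 r) := piOf_dif B.b _ _ _ B.hT3 r
lemma pi2_mul (r) : B.pi2 (r * dif k B.D) = pTh (c1 k B.D) (B.pi2 r) := piOf_dif B.b _ _ _ B.hT2 r
lemma pi1_mul (r) : B.pi1 (r * dif k B.E) = pTh (c0 k B.E) (B.pi1 r) := piOf_dif B.b _ _ _ B.hT1 r

lemma kmon_ev {S : Type} [Ring S] [Algebra k S] (i : ℕ) (z a : S) : (kmon k i a).eval z = a * z ^ i := by
  simp [kmon_apply]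

lemma T4ev (i j l m) : (B.T4 (B.b (i, j, l, m))).eval (c3 k B.x) = n3 k j l m (B.x ^ i) := by
  rw [T4b, kmon_ev, ← map_pow, n3_r, one_mul]
lemma T3ev (i j l m) : (B.T3 (B.b (i, j, l, m))).eval (c2 k B.y) = n2 k l m (B.x ^ i * B.y ^ j) := by
  rw [T3b, kmon_ev, ← map_pow, n2_r]
lemma T2ev (i j l m) : (B.T2 (B.b (i, j, l, m))).eval (c1 k B.D) = n1 k m (B.x ^ i * B.y ^ j * B.D ^ l) := by
  rw [T2b, kmon_ev, ← map_pow, n1_r]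

lemma pi4_ev (r) : B.pi3 r = pEv (c3 k B.x) (B.pi4 r) := piOf_ev B.b (c3 k) B.T4 B.T3 (c3 k B.x)
  (fun p => (B.T3b p.1 p.2.1 p.2.2.1 p.2.2.2).trans (B.T4ev p.1 p.2.1 p.2.2.1 p.2.2.2).symm) r
lemma pi3_ev (r) : B.pi2 r = pEv (c2 k B.y) (B.pi3 r) := piOf_ev B.b (c2 k) B.T3 B.T2 (c2 k B.y)
  (fun p => (B.T2b p.1 p.2.1 p.2.2.1 p.2.2.2).trans (B.T3ev p.1 p.2.1 p.2.2.1 p.2.2.2).symm) r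
lemma pi2_ev (r) : B.pi1 r = pEv (c1 k B.D) (B.pi2 r) := piOf_ev B.b (c1 k) B.T2 B.T1 (c1 k B.D)
  (fun p => (B.T1b p.1 p.2.1 p.2.2.1 p.2.2.2).trans (B.T2ev p.1 p.2.1 p.2.2.1 p.2.2.2).symm) r
lemma pi1_ev (r) : pi0 r = pEv (c0 k B.E) (B.pi1 r) := piOf_ev B.b _ _ _ _ (by
  rintro ⟨i, j, l, m⟩; rw [T1b, kmon_ev]; simp [B.hb]) r

lemma poly_range {S M : Type} [Ring S] [Algebra k S] [AddCommGroup M] [Module k M] (g : S[X] →ₗ[k] M) (W : Submodule k M)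
    (h : ∀ n a, g (monomial n a) ∈ W) (a : S[X]) : g a ∈ W := by
  induction a using Polynomial.induction_on' with
  | add p q hp hq => rw [map_add]; exact Submodule.add_mem _ hp hq
  | monomial n a => exact h _ _

lemma pi4_surj : Function.Surjective B.pi4 := by
  have h0 : ∀ (i j l m : ℕ) (a : U), kmon k i (n3 k j l m a) ∈ B.pi4.range := by
    intro i j l m a
    refine ⟨a ⊗ₜ MulOpposite.op (B.b (i, j, l, m)), ?_⟩
    rw [pi4, piOf_tmul, MulOpposite.unop_op, T4b]
    have := n3_l (k := k) j l m a 1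
    rw [mul_one] at this
    rw [← this, kmon_apply, kmon_apply, ← C_mul_monomial]
    rfl
  have h1 : ∀ (i j l : ℕ) (a : U[X]), ((kmon k i).comp ((kmon k j : N2 U →ₗ[k] N3 U).comp (kmon k l : N1 U →ₗ[k] N2 U))) a ∈ B.pi4.range := by
    intro i j l a
    refine poly_range _ _ (fun n a => ?_) a
    exact h0 _ _ _ _ _
  have h2 : ∀ (i j : ℕ) (a : (N1 U)[X]), ((kmon k i).comp (kmon k j : N2 U →ₗ[k] N3 U)) a ∈ B.pi4.range := by
    intro i j a
    refine poly_range _ _ (fun n a => ?_) a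
    exact h1 _ _ _ _
  have h3 : ∀ (i : ℕ) (a : (N2 U)[X]), (kmon k i : N3 U →ₗ[k] _) a ∈ B.pi4.range := by
    intro i a
    refine poly_range _ _ (fun n a => ?_) a
    exact h2 _ _ _
  intro a
  change a ∈ B.pi4.range
  induction a using Polynomial.induction_on' with
  | add p q hp hq => exact Submodule.add_mem _ hp hq
  | monomial n a => exact h3 _ _

noncomputable def kco (k : Type) [Field k] {S : Type} [Ring S] [Algebra k S] (i : ℕ) : S[X] →ₗ[k] S where
  toFun p := p.coeff i
  map_add' := by simp
  map_smul' c a := by rw [RingHom.id_apply, coeff_smul]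

lemma kco_kmon {S : Type} [Ring S] [Algebra k S] (i j : ℕ) (a : S) :
    kco k i (kmon k j a) = if j = i then a else 0 := coeff_monomial

noncomputable def co1 (k : Type) [Field k] {U : Type} [Ring U] [Algebra k U] (m : ℕ) : N1 U →ₗ[k] U := (kco k m : U[X] →ₗ[k] U)
noncomputable def co2 (k : Type) [Field k] {U : Type} [Ring U] [Algebra k U] (l m : ℕ) : N2 U →ₗ[k] U :=
  (co1 k m).comp (kco k l : (N1 U)[X] →ₗ[k] N1 U)
noncomputable def co3 (k : Type) [Field k] {U : Type} [Ring U] [Algebra k U] (j l m : ℕ) : N3 U →ₗ[k] U :=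
  (co2 k l m).comp (kco k j : (N2 U)[X] →ₗ[k] N2 U)

lemma co1_n1 (m m' : ℕ) (u : U) : co1 k m (n1 k m' u) = if m' = m then u else 0 := kco_kmon _ _ _
lemma co2_n2 (l l' m m' : ℕ) (u : U) : co2 k l m (n2 k l' m' u) = if l' = l ∧ m' = m then u else 0 := by
  refine (congrArg (co1 k m) (kco_kmon (k := k) l l' (n1 k m' u))).trans ?_
  by_cases h : l' = l <;> simp [h, co1_n1]
lemma co3_n3 (j j' l l' m m' : ℕ) (u : U) : co3 k j l m (n3 k j' l' m' u) =
    if j' = j ∧ l' = l ∧ m' = m then u else 0 := by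
  refine (congrArg (co2 k l m) (kco_kmon (k := k) j j' (n2 k l' m' u))).trans ?_
  by_cases h : j' = j <;> simp [h, co2_n2]

lemma pi4_inj : Function.Injective B.pi4 := by
  rw [injective_iff_map_eq_zero]
  intro r hr
  let e := TensorProduct.equivFinsuppOfBasisRight (M := U) (B.b.map (MulOpposite.opLinearEquiv k))
  have key : ∀ r i j l m, e r (i, j, l, m) = co3 k j l m (kco k i (B.pi4 r)) := by
    intro r i j l m
    induction r using TensorProduct.induction_on with
    | zero => simp only [map_zero, Finsupp.zero_apply]
    | add r s hr hs => simp only [map_add, Finsupp.add_apply, hr, hs]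
    | tmul u v =>
      obtain ⟨v, rfl⟩ := MulOpposite.op_surjective v
      induction v using basis_ind B.b with
      | h0 => simp only [MulOpposite.op_zero, tmul_zero, map_zero, Finsupp.zero_apply]
      | ha v w hv hw => simp only [MulOpposite.op_add, tmul_add, map_add, Finsupp.add_apply, hv, hw]
      | hs a v hv => simp only [MulOpposite.op_smul, tmul_smul, map_smul, Finsupp.smul_apply, hv]
      | hb p =>
        obtain ⟨i', j', l', m'⟩ := p
        have e1 : B.pi4 (u ⊗ₜ MulOpposite.op (B.b (i', j', l', m'))) = kmon k i' (n3 k j' l' m' u) := by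
          rw [pi4, piOf_tmul, MulOpposite.unop_op, T4b]
          have := n3_l (k := k) j' l' m' u 1
          rw [mul_one] at this
          rw [← this, kmon_apply, kmon_apply, ← C_mul_monomial]
          rfl
        have : MulOpposite.op (B.b (i', j', l', m')) = (B.b.map (MulOpposite.opLinearEquiv k)) (i', j', l', m') := by simp
        rw [e1, kco_kmon]
        simp only [e]
        rw [this, TensorProduct.equivFinsuppOfBasisRight_apply_tmul_apply, Module.Basis.repr_self]
        by_cases h1 : i' = i
        · rw [if_pos h1, co3_n3, Finsupp.single_apply]
          simp [h1]
        · rw [if_neg h1, map_zero, Finsupp.single_apply]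
          simp [h1]
  apply e.injective
  rw [map_zero]
  ext ⟨i, j, l, m⟩
  rw [key, hr]
  simp only [map_zero, Finsupp.zero_apply]

lemma pi3_surj : Function.Surjective B.pi3 := fun a => by
  obtain ⟨b, rfl⟩ := pEv_surj (c3 k B.x) a; obtain ⟨r, rfl⟩ := B.pi4_surj b; exact ⟨r, B.pi4_ev r⟩
lemma pi2_surj : Function.Surjective B.pi2 := fun a => by
  obtain ⟨b, rfl⟩ := pEv_surj (c2 k B.y) a; obtain ⟨r, rfl⟩ := B.pi3_surj b; exact ⟨r, B.pi3_ev r⟩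
lemma pi1_surj : Function.Surjective B.pi1 := fun a => by
  obtain ⟨b, rfl⟩ := pEv_surj (c1 k B.D) a; obtain ⟨r, rfl⟩ := B.pi2_surj b; exact ⟨r, B.pi2_ev r⟩

end PBW
end PartB2


section PartB3

section abs
variable {R : Type} [Ring R]

def mulR (a : R) : R →ₗ[R] R := LinearMap.toSpanSingleton R R a
lemma mulR_apply (a r : R) : mulR a r = r * a := rfl

structure KRel (X Y Dh W q Eh : R) : Prop where
  YX : ∀ r, r * Y * X = r * X * Y
  DX : ∀ r, r * Dh * X = r * X * Dh
  YD : ∀ r, r * Y * Dh = r * W * Y - r * q * X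
  qX : ∀ r, r * q * X = r * X * q
  WX : ∀ r, r * W * X = r * X * W
  XE : ∀ r (n : ℤ), r * X * (Eh - n) = r * (Eh - (n + 1 : ℤ)) * X
  YE : ∀ r (n : ℤ), r * Y * (Eh - n) = r * (Eh - (n + 1 : ℤ)) * Y
  DE : ∀ r (n : ℤ), r * Dh * (Eh - n) = r * (Eh - (n + 1 : ℤ)) * Dh
  WE : ∀ r (n : ℤ), r * W * (Eh - n) = r * (Eh - (n + 1 : ℤ)) * W
  qE : ∀ r (n : ℤ), r * q * (Eh - n) = r * (Eh - (n + 1 : ℤ)) * q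

variable (X Y Dh W q Eh : R)

def k2d1 : R × R →ₗ[R] R := cD0 (mulR X) (mulR Y)
def k2d2 : R →ₗ[R] R × R := cDt (mulR Y) (mulR X)
def kph1 : R × R →ₗ[R] R × R :=
  ((mulR Dh).coprod (-mulR q)).prod ((mulR W).comp (LinearMap.snd R R R))
lemma kph1_apply (z : R × R) : kph1 Dh W q z = (z.1 * Dh + -(z.2 * q), z.2 * W) := rfl
def k3d1 : (R × R) × R →ₗ[R] R := cD0 (k2d1 X Y) (mulR Dh)
def k3d2 : R × (R × R) →ₗ[R] (R × R) × R := cD (k2d2 X Y) (kph1 Dh W q) (k2d1 X Y)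
def k3d3 : R →ₗ[R] R × (R × R) := cDt (mulR W) (k2d2 X Y)
def kps0 : R →ₗ[R] R := mulR (Eh - (0 : ℤ))
def kps1 : (R × R) × R →ₗ[R] (R × R) × R :=
  ((mulR (Eh - (1 : ℤ))).prodMap (mulR (Eh - (1 : ℤ)))).prodMap (mulR (Eh - (1 : ℤ)))
def kps2 : R × (R × R) →ₗ[R] R × (R × R) :=
  (mulR (Eh - (2 : ℤ))).prodMap ((mulR (Eh - (2 : ℤ))).prodMap (mulR (Eh - (2 : ℤ))))
def kps3 : R →ₗ[R] R := mulR (Eh - (3 : ℤ))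
def k4d1 : ((R × R) × R) × R →ₗ[R] R := cD0 (k3d1 X Y Dh) (kps0 Eh)
def k4d2 : (R × (R × R)) × ((R × R) × R) →ₗ[R] ((R × R) × R) × R :=
  cD (k3d2 X Y Dh W q) (kps1 Eh) (k3d1 X Y Dh)
def k4d3 : R × (R × (R × R)) →ₗ[R] (R × (R × R)) × ((R × R) × R) :=
  cD (k3d3 X Y W) (kps2 Eh) (k3d2 X Y Dh W q)
def k4d4 : R →ₗ[R] R × (R × (R × R)) := cDt (kps3 Eh) (k3d3 X Y W)

variable {X Y Dh W q Eh} (K : KRel X Y Dh W q Eh)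
include K

lemma kc0 (z : R) : mulR X (mulR Y z) = mulR Y (mulR X z) := K.YX z

lemma kc1 (z : R × R) : k2d1 X Y (kph1 Dh W q z) = mulR Dh (k2d1 X Y z) := by
  obtain ⟨a, b⟩ := z
  simp only [k2d1, cD0_apply, kph1_apply, mulR_apply, add_mul, K.YD, K.DX, neg_mul, mul_neg]
  abel

lemma kc2 (z : R) : k2d2 X Y (mulR W z) = kph1 Dh W q (k2d2 X Y z) := by
  simp only [k2d2, cDt_apply, kph1_apply, mulR_apply, add_mul, K.YD, K.WX, K.qX, neg_mul, mul_neg]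
  ext <;> simp

lemma kd1 (z) : k3d1 X Y Dh (kps1 Eh z) = kps0 Eh (k3d1 X Y Dh z) := by
  obtain ⟨⟨a, b⟩, c⟩ := z
  simp only [k3d1, k2d1, cD0_apply, kps1, kps0, LinearMap.prodMap_apply, mulR_apply, add_mul, K.XE, K.YE, K.DE, zero_add]

lemma kd2 (z) : k3d2 X Y Dh W q (kps2 Eh z) = kps1 Eh (k3d2 X Y Dh W q z) := by
  obtain ⟨a, b, c⟩ := z
  have h2 : (1 + 1 : ℤ) = 2 := rfl
  simp only [k3d2, k2d1, k2d2, kph1_apply, cD0_apply, cDt_apply, cD_apply, kps2, kps1, LinearMap.prodMap_apply, mulR_apply, 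
    Prod.mk_add_mk,
    add_mul, neg_mul, K.XE, K.YE, K.DE, K.WE, K.qE, h2]

lemma kd3 (z) : k3d3 X Y W (kps3 Eh z) = kps2 Eh (k3d3 X Y W z) := by
  have h2 : (2 + 1 : ℤ) = 3 := rfl
  simp only [k3d3, k2d2, cDt_apply, kps2, kps3, LinearMap.prodMap_apply, mulR_apply, neg_mul, K.XE, K.YE, K.WE, h2,
    Prod.neg_mk, neg_neg]

variable {M4 M3 M2 M1 M0 : Type} [AddCommGroup M4] [AddCommGroup M3] [AddCommGroup M2] [AddCommGroup M1] [AddCommGroup M0]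
  {p4 : R →+ M4} {p3 : R →+ M3} {p2 : R →+ M2} {p1 : R →+ M1} {p0 : R →+ M0}
  {th4 : M4 →+ M4} {th3 : M3 →+ M3} {th2 : M2 →+ M2} {th1 : M1 →+ M1}
  {ev4 : M4 →+ M3} {ev3 : M3 →+ M2} {ev2 : M2 →+ M1} {ev1 : M1 →+ M0}

theorem k4_exact (i4 : Function.Injective p4) (s4 : Function.Surjective p4) (s3 : Function.Surjective p3)
    (s2 : Function.Surjective p2) (s1 : Function.Surjective p1)
    (m4 : ∀ r, p4 (r * X) = th4 (p4 r)) (m3 : ∀ r, p3 (r * Y) = th3 (p3 r)) 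
    (m2 : ∀ r, p2 (r * Dh) = th2 (p2 r)) (m1 : ∀ r, p1 (r * Eh) = th1 (p1 r))
    (t4 : Function.Injective th4) (t3 : Function.Injective th3) (t2 : Function.Injective th2) (t1 : Function.Injective th1)
    (x4 : Function.Exact th4 ev4) (x3 : Function.Exact th3 ev3) (x2 : Function.Exact th2 ev2) (x1 : Function.Exact th1 ev1)
    (e4 : ∀ r, p3 r = ev4 (p4 r)) (e3 : ∀ r, p2 r = ev3 (p3 r)) (e2 : ∀ r, p1 r = ev2 (p2 r)) (e1 : ∀ r, p0 r = ev1 (p1 r)) :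
    Function.Exact (k4d2 X Y Dh W q Eh) (k4d1 X Y Dh Eh) ∧ Function.Exact (k4d3 X Y Dh W q Eh) (k4d2 X Y Dh W q Eh) ∧
    Function.Exact (k4d4 X Y W Eh) (k4d3 X Y Dh W q Eh) ∧ Function.Injective (k4d4 X Y W Eh) ∧
    Function.Exact (k4d1 X Y Dh Eh) p0 := by
  have inj1 : Function.Injective (mulR X) := by
    intro a b hab
    apply i4; apply t4
    rw [← m4, ← m4]; exact congrArg p4 hab
  have z1 : Function.Exact (mulR X) p3 := by
    intro r
    rw [e4]
    constructor
    · intro h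
      obtain ⟨n, hn⟩ := (x4 _).1 h
      obtain ⟨v, rfl⟩ := s4 n
      exact ⟨v, i4 (by rw [← hn]; exact m4 v)⟩
    · rintro ⟨v, rfl⟩
      rw [mulR_apply, m4, x4.apply_apply_eq_zero]
  -- K2
  have inj2 : Function.Injective (k2d2 X Y) := cone_top_inj _ _ inj1
  have one2 : Function.Exact (k2d2 X Y) (k2d1 X Y) := cone_one_top p3 th3 _ _ _ inj1 z1 m3 t3 (kc0 K)
  have zero2 : Function.Exact (k2d1 X Y) p2 := cone_zero p3 th3 ev3 _ _ p2 z1 s3 m3 x3 e3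
  -- K3
  have inj3 : Function.Injective (k3d3 X Y W) := cone_top_inj _ _ inj2
  have two3 : Function.Exact (k3d3 X Y W) (k3d2 X Y Dh W q) := cone_mid_top _ _ _ _ one2 inj2 (kc2 K)
  have one3 : Function.Exact (k3d2 X Y Dh W q) (k3d1 X Y Dh) := cone_one p2 th2 _ _ _ _ one2 zero2 m2 t2 (kc1 K)
  have zero3 : Function.Exact (k3d1 X Y Dh) p1 := cone_zero p2 th2 ev2 _ _ p1 zero2 s2 m2 x2 e2
  have m1' : ∀ r, p1 (kps0 Eh r) = th1 (p1 r) := by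
    intro r
    simp only [kps0, mulR_apply, Int.cast_zero, sub_zero, m1]
  refine ⟨?_, ?_, ?_, ?_, ?_⟩
  · exact cone_one p1 th1 _ _ _ _ one3 zero3 m1' t1 (kd1 K)
  · exact cone_mid _ _ _ _ _ one3 two3 (kd2 K)
  · exact cone_mid_top _ _ _ _ two3 inj3 (kd3 K)
  · exact cone_top_inj _ _ inj3
  · exact cone_zero p1 th1 ev1 _ _ p0 zero3 s1 m1' x1 e1

end abs

section dual
variable {k R A : Type} [Field k] [Ring R] [Algebra k R] [AddCommGroup A] [Module R A] [Module k A]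

def IsDual {P P' Q Q' : Type} [AddCommGroup P] [Module R P] [AddCommGroup P'] [Module R P'] [AddCommGroup Q] [Module k Q]
   [AddCommGroup Q'] [Module k Q'] (a : DualRep k R A P Q) (a' : DualRep k R A P' Q') (d : P' →ₗ[R] P) (f : Q →ₗ[k] Q') : Prop :=
   ∀ q, a'.th (f q) = (a.th q).comp d

def actL (hs : ∀ (c : k) (a : A), algebraMap k R c • a = c • a) (r : R) : A →ₗ[k] A where
  toFun a := r • a
  map_add' := smul_add r
  map_smul' c a := by rw [RingHom.id_apply, ← hs, ← hs, smul_smul, smul_smul, Algebra.commutes]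

variable (hs : ∀ (c : k) (a : A), algebraMap k R c • a = c • a)

lemma dual_mulR (r : R) : IsDual (DualRep.self hs) (DualRep.self hs) (mulR r) (actL hs r) := by
  intro q
  ext
  simp [DualRep.self, actL, mulR]

variable {P0 P1 P2 P3 Q0 Q1 Q2 Q3 : Type} [AddCommGroup P0] [Module R P0] [AddCommGroup P1] [Module R P1]
  [AddCommGroup P2] [Module R P2] [AddCommGroup P3] [Module R P3] [AddCommGroup Q0] [Module k Q0] [AddCommGroup Q1] [Module k Q1]
  [AddCommGroup Q2] [Module k Q2] [AddCommGroup Q3] [Module k Q3]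
  {r0 : DualRep k R A P0 Q0} {r1 : DualRep k R A P1 Q1} {r2 : DualRep k R A P2 Q2} {r3 : DualRep k R A P3 Q3}

def fD (f' : Q1 →ₗ[k] Q2) (g : Q1 →ₗ[k] Q1) (f : Q0 →ₗ[k] Q1) : Q1 × Q0 →ₗ[k] Q2 × Q1 :=
  (f'.comp (LinearMap.fst k Q1 Q0)).prod (g.coprod (-f))
def fD0 (f' : Q0 →ₗ[k] Q1) (g : Q0 →ₗ[k] Q0) : Q0 →ₗ[k] Q1 × Q0 := f'.prod g
def fDt (g : Q1 →ₗ[k] Q1) (f : Q0 →ₗ[k] Q1) : Q1 × Q0 →ₗ[k] Q1 := g.coprod (-f)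

lemma fD_apply (f' : Q1 →ₗ[k] Q2) (g : Q1 →ₗ[k] Q1) (f : Q0 →ₗ[k] Q1) (z) :
    fD f' g f z = (f' z.1, g z.1 + -(f z.2)) := rfl
lemma fD0_apply (f' : Q0 →ₗ[k] Q1) (g : Q0 →ₗ[k] Q0) (z) : fD0 f' g z = (f' z, g z) := rfl
lemma fDt_apply (g : Q1 →ₗ[k] Q1) (f : Q0 →ₗ[k] Q1) (z) : fDt g f z = g z.1 + -(f z.2) := rfl

lemma dual_cD {d' : P2 →ₗ[R] P1} {φ : P1 →ₗ[R] P1} {d : P1 →ₗ[R] P0}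
    {f' : Q1 →ₗ[k] Q2} {g : Q1 →ₗ[k] Q1} {f : Q0 →ₗ[k] Q1} (h' : IsDual r1 r2 d' f') (hg : IsDual r1 r1 φ g)
    (h : IsDual r0 r1 d f) : IsDual (r1.prod r0) (r2.prod r1) (cD d' φ d) (fD f' g f) := by
  rintro ⟨a, b⟩
  simp only [DualRep.prod, AddMonoidHom.coe_mk, ZeroHom.coe_mk, fD_apply, map_add, map_neg, h' a, hg a, h b]
  refine LinearMap.ext fun z => ?_
  simp [cD_apply, add_assoc]

lemma dual_cD0 {d' : P1 →ₗ[R] P0} {φ : P0 →ₗ[R] P0}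
    {f' : Q0 →ₗ[k] Q1} {g : Q0 →ₗ[k] Q0} (h' : IsDual r0 r1 d' f') (hg : IsDual r0 r0 φ g) :
    IsDual r0 (r1.prod r0) (cD0 d' φ) (fD0 f' g) := by
  intro a
  simp only [DualRep.prod, AddMonoidHom.coe_mk, ZeroHom.coe_mk, fD0_apply, h' a, hg a]
  refine LinearMap.ext fun z => ?_
  simp [cD0_apply]

lemma dual_cDt {φ : P1 →ₗ[R] P1} {d : P1 →ₗ[R] P0}
    {g : Q1 →ₗ[k] Q1} {f : Q0 →ₗ[k] Q1} (hg : IsDual r1 r1 φ g)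
    (h : IsDual r0 r1 d f) : IsDual (r1.prod r0) r1 (cDt φ d) (fDt g f) := by
  rintro ⟨a, b⟩
  simp only [DualRep.prod, AddMonoidHom.coe_mk, ZeroHom.coe_mk, fDt_apply, map_add, map_neg, hg a, h b]
  refine LinearMap.ext fun z => ?_
  simp [cDt_apply]

lemma dual_prodMap {d : P0 →ₗ[R] P0} {d' : P1 →ₗ[R] P1} {f : Q0 →ₗ[k] Q0} {f' : Q1 →ₗ[k] Q1}
    (h : IsDual r0 r0 d f) (h' : IsDual r1 r1 d' f') : IsDual (r0.prod r1) (r0.prod r1) (d.prodMap d') (f.prodMap f') := by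
  rintro ⟨a, b⟩
  simp only [DualRep.prod, AddMonoidHom.coe_mk, ZeroHom.coe_mk, LinearMap.prodMap_apply, h a, h' b]
  refine LinearMap.ext fun z => ?_
  simp

/-- the dual of `kph1` -/
def fph1 (Dh W q : R) : A × A →ₗ[k] A × A :=
  ((actL hs Dh).comp (LinearMap.fst k A A)).prod ((-actL hs q).coprod (actL hs W))

lemma fph1_apply (Dh W q : R) (z : A × A) : fph1 hs Dh W q z = (Dh • z.1, -(q • z.1) + W • z.2) := rfl

lemma dual_kph1 (Dh W q : R) : IsDual ((DualRep.self hs).prod (DualRep.self hs)) ((DualRep.self hs).prod (DualRep.self hs))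
    (kph1 Dh W q) (fph1 hs Dh W q) := by
  rintro ⟨a, b⟩
  refine LinearMap.ext fun z => ?_
  simp [DualRep.prod, DualRep.self, fph1_apply, kph1_apply, smul_smul, add_smul, smul_add]
  abel

variable (X Y Dh W q Eh : R)
def f20 : A →ₗ[k] A × A := fD0 (actL hs X) (actL hs Y)
def f21 : A × A →ₗ[k] A := fDt (actL hs Y) (actL hs X)
def f30 : A →ₗ[k] (A × A) × A := fD0 (f20 hs X Y) (actL hs Dh)
def f31 : (A × A) × A →ₗ[k] A × (A × A) := fD (f21 hs X Y) (fph1 hs Dh W q) (f20 hs X Y)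
def f32 : A × (A × A) →ₗ[k] A := fDt (actL hs W) (f21 hs X Y)
def g0 : A →ₗ[k] A := actL hs (Eh - (0 : ℤ))
def g1 : (A × A) × A →ₗ[k] (A × A) × A :=
  ((actL hs (Eh - (1 : ℤ))).prodMap (actL hs (Eh - (1 : ℤ)))).prodMap (actL hs (Eh - (1 : ℤ)))
def g2 : A × (A × A) →ₗ[k] A × (A × A) :=
  (actL hs (Eh - (2 : ℤ))).prodMap ((actL hs (Eh - (2 : ℤ))).prodMap (actL hs (Eh - (2 : ℤ))))
def g3 : A →ₗ[k] A := actL hs (Eh - (3 : ℤ))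
def f40 : A →ₗ[k] ((A × A) × A) × A := fD0 (f30 hs X Y Dh) (g0 hs Eh)
def f41 : ((A × A) × A) × A →ₗ[k] (A × (A × A)) × ((A × A) × A) := fD (f31 hs X Y Dh W q) (g1 hs Eh) (f30 hs X Y Dh)
def f42 : (A × (A × A)) × ((A × A) × A) →ₗ[k] A × (A × (A × A)) := fD (f32 hs X Y W) (g2 hs Eh) (f31 hs X Y Dh W q)
def f43 : A × (A × (A × A)) →ₗ[k] A := fDt (g3 hs Eh) (f32 hs X Y W)

abbrev sf : DualRep k R A R A := DualRep.self hs

lemma dual_f2 : IsDual (sf hs) ((sf hs).prod (sf hs)) (k2d1 X Y) (f20 hs X Y) ∧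
   IsDual ((sf hs).prod (sf hs)) (sf hs) (k2d2 X Y) (f21 hs X Y) :=
  ⟨dual_cD0 (dual_mulR hs X) (dual_mulR hs Y), dual_cDt (dual_mulR hs Y) (dual_mulR hs X)⟩

lemma dual_f3 : IsDual (sf hs) (((sf hs).prod (sf hs)).prod (sf hs)) (k3d1 X Y Dh) (f30 hs X Y Dh) ∧
   IsDual (((sf hs).prod (sf hs)).prod (sf hs)) ((sf hs).prod ((sf hs).prod (sf hs))) (k3d2 X Y Dh W q) (f31 hs X Y Dh W q) ∧
   IsDual ((sf hs).prod ((sf hs).prod (sf hs))) (sf hs) (k3d3 X Y W) (f32 hs X Y W) :=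
  ⟨dual_cD0 (dual_f2 hs X Y).1 (dual_mulR hs Dh), dual_cD (dual_f2 hs X Y).2 (dual_kph1 hs Dh W q) (dual_f2 hs X Y).1,
    dual_cDt (dual_mulR hs W) (dual_f2 hs X Y).2⟩

lemma dual_f4 : IsDual (sf hs) ((((sf hs).prod (sf hs)).prod (sf hs)).prod (sf hs)) (k4d1 X Y Dh Eh) (f40 hs X Y Dh Eh) ∧
   IsDual ((((sf hs).prod (sf hs)).prod (sf hs)).prod (sf hs)) (((sf hs).prod ((sf hs).prod (sf hs))).prod (((sf hs).prod (sf hs)).prod (sf hs)))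
      (k4d2 X Y Dh W q Eh) (f41 hs X Y Dh W q Eh) ∧
   IsDual (((sf hs).prod ((sf hs).prod (sf hs))).prod (((sf hs).prod (sf hs)).prod (sf hs))) ((sf hs).prod ((sf hs).prod ((sf hs).prod (sf hs))))
      (k4d3 X Y Dh W q Eh) (f42 hs X Y Dh W q Eh) ∧
   IsDual ((sf hs).prod ((sf hs).prod ((sf hs).prod (sf hs)))) (sf hs) (k4d4 X Y W Eh) (f43 hs X Y W Eh) := by
  obtain ⟨a, b, c⟩ := dual_f3 hs X Y Dh W q
  refine ⟨dual_cD0 a (dual_mulR hs _), dual_cD b ?_ a, dual_cD c ?_ b, dual_cDt (dual_mulR hs _) c⟩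
  · exact dual_prodMap (dual_prodMap (dual_mulR hs _) (dual_mulR hs _)) (dual_mulR hs _)
  · exact dual_prodMap (dual_mulR hs _) (dual_prodMap (dual_mulR hs _) (dual_mulR hs _))

theorem ext_k4 (ep : R →ₗ[R] A) (he1 : Function.Exact (k4d2 X Y Dh W q Eh) (k4d1 X Y Dh Eh))
    (he2 : Function.Exact (k4d3 X Y Dh W q Eh) (k4d2 X Y Dh W q Eh))
    (he3 : Function.Exact (k4d4 X Y W Eh) (k4d3 X Y Dh W q Eh)) (he4 : Function.Injective (k4d4 X Y W Eh))
    (he0 : Function.Exact (k4d1 X Y Dh Eh) ep) (hes : Function.Surjective ep)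
    {V0 V1 V2 V3 : Type} [AddCommGroup V0] [Module k V0] [AddCommGroup V1] [Module k V1]
    [AddCommGroup V2] [Module k V2] [AddCommGroup V3] [Module k V3]
    (s0 : V0 →ₗ[k] A) (s1 : V1 →ₗ[k] ((A × A) × A) × A) (s2 : V2 →ₗ[k] (A × (A × A)) × ((A × A) × A))
    (s3 : V3 →ₗ[k] A × (A × (A × A)))
    (a0 : (∀ v, f40 hs X Y Dh Eh (s0 v) = 0) ∧ (∀ z, f40 hs X Y Dh Eh z = 0 → ∃ v, z = s0 v) ∧ (∀ v, s0 v = 0 → v = 0))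
    (a1 : (∀ v, f41 hs X Y Dh W q Eh (s1 v) = 0) ∧ (∀ z, f41 hs X Y Dh W q Eh z = 0 → ∃ v w, z = s1 v + f40 hs X Y Dh Eh w) ∧
      (∀ v w, s1 v = f40 hs X Y Dh Eh w → v = 0))
    (a2 : (∀ v, f42 hs X Y Dh W q Eh (s2 v) = 0) ∧ (∀ z, f42 hs X Y Dh W q Eh z = 0 → ∃ v w, z = s2 v + f41 hs X Y Dh W q Eh w) ∧
      (∀ v w, s2 v = f41 hs X Y Dh W q Eh w → v = 0))
    (a3 : (∀ v, f43 hs X Y W Eh (s3 v) = 0) ∧ (∀ z, f43 hs X Y W Eh z = 0 → ∃ v w, z = s3 v + f42 hs X Y Dh W q Eh w) ∧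
      (∀ v w, s3 v = f42 hs X Y Dh W q Eh w → v = 0))
    (a4 : Function.Surjective (f43 hs X Y W Eh)) :
    let H : ℕ → ModuleCat.{0} k := fun n => ((Ext k (ModuleCat.{0} R) n).obj
      (Opposite.op (ModuleCat.of R A))).obj (ModuleCat.of R A)
    Nonempty (H 0 ≃ₗ[k] V0) ∧ Nonempty (H 1 ≃ₗ[k] V1) ∧ Nonempty (H 2 ≃ₗ[k] V2) ∧
    Nonempty (H 3 ≃ₗ[k] V3) ∧ ∀ n, 4 ≤ n → Subsingleton (H n) := by
  obtain ⟨h1, h2, h3, h4⟩ := dual_f4 hs X Y Dh W q Eh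
  exact ext_main ep _ _ _ _ _ he1 he2 he3 he4 he0 hes h1 h2 h3 h4 s0 s1 s2 s3 a0 a1 a2 a3 a4

end dual
end PartB3


section PartB4
open Polynomial
variable {k U : Type} [Field k] [Ring U] [Algebra k U] {t : k}

lemma env_smul (u : U) (v : Uᵐᵒᵖ) (a : U) : (u ⊗ₜ[k] v) • a = u * a * v.unop := by
  rw [TensorProduct.Algebra.smul_def, MulOpposite.smul_eq_mul_unop, smul_eq_mul, mul_assoc]

lemma env_hs (c : k) (a : U) : algebraMap k (U ⊗[k] Uᵐᵒᵖ) c • a = c • a := by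
  rw [Algebra.TensorProduct.algebraMap_apply, env_smul, Algebra.smul_def]
  simp

noncomputable def epU (k : Type) [Field k] (U : Type) [Ring U] [Algebra k U] : U ⊗[k] Uᵐᵒᵖ →ₗ[U ⊗[k] Uᵐᵒᵖ] U :=
  LinearMap.toSpanSingleton _ _ 1

lemma epU_eq (r : U ⊗[k] Uᵐᵒᵖ) : epU k U r = PBW.pi0 r := by
  induction r using TensorProduct.induction_on with
  | zero => simp
  | add a b ha hb => rw [map_add, map_add, ha, hb]
  | tmul u v =>
    rw [PBW.pi0, piOf_tmul]
    change (u ⊗ₜ[k] v) • (1 : U) = _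
    rw [env_smul]; simp

namespace PBW
variable (B : PBW k U t)

noncomputable def rS : U ⊗[k] Uᵐᵒᵖ := lft k B.y + rgt k B.y + t • lft k B.x
noncomputable def rW : U ⊗[k] Uᵐᵒᵖ := dif k B.D - B.rS
noncomputable def rq : U ⊗[k] Uᵐᵒᵖ := t • rgt k B.y

lemma difE (z : U) (h : B.E * z = z * B.E + z) (n : ℤ) :
    lft k z * (dif k B.E - n) = (dif k B.E - (n + 1 : ℤ)) * lft k z := by
  simp only [dif, lft, rgt, sub_mul, mul_sub, Algebra.TensorProduct.tmul_mul_tmul, h, mul_one, one_mul, add_tmul, Int.cast_add, Int.cast_one, add_mul,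
    (Int.cast_commute n (_ : U ⊗[k] Uᵐᵒᵖ)).eq]
  abel

lemma difE' (z : U) (h : B.E * z = z * B.E + z) (n : ℤ) :
    rgt k z * (dif k B.E - n) = (dif k B.E - (n + 1 : ℤ)) * rgt k z := by
  simp only [dif, lft, rgt, sub_mul, mul_sub, Algebra.TensorProduct.tmul_mul_tmul, ← MulOpposite.op_mul, h, mul_one, one_mul, MulOpposite.op_add, tmul_add, Int.cast_add, Int.cast_one, add_mul,
    (Int.cast_commute n (_ : U ⊗[k] Uᵐᵒᵖ)).eq]
  abel

lemma krel : KRel (dif k B.x) (dif k B.y) (dif k B.D) B.rW B.rq (dif k B.E) := by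
  have YX : dif k B.y * dif k B.x = dif k B.x * dif k B.y := by
    simp only [dif, lft, rgt, sub_mul, mul_sub, Algebra.TensorProduct.tmul_mul_tmul, ← MulOpposite.op_mul, B.yx, mul_one, one_mul]
    abel
  have DX : dif k B.D * dif k B.x = dif k B.x * dif k B.D := by
    simp only [dif, lft, rgt, sub_mul, mul_sub, Algebra.TensorProduct.tmul_mul_tmul, ← MulOpposite.op_mul, B.Dx, mul_one, one_mul]
    abel
  have yX : lft k B.y * dif k B.x = dif k B.x * lft k B.y := by
    simp only [dif, lft, rgt, sub_mul, mul_sub, Algebra.TensorProduct.tmul_mul_tmul, ← MulOpposite.op_mul, B.yx, mul_one, one_mul]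
  have y'X : rgt k B.y * dif k B.x = dif k B.x * rgt k B.y := by
    simp only [dif, lft, rgt, sub_mul, mul_sub, Algebra.TensorProduct.tmul_mul_tmul, ← MulOpposite.op_mul, B.yx, mul_one, one_mul]
  have xX : lft k B.x * dif k B.x = dif k B.x * lft k B.x := by
    simp only [dif, lft, rgt, sub_mul, mul_sub, Algebra.TensorProduct.tmul_mul_tmul, ← MulOpposite.op_mul, B.yx, mul_one, one_mul]
  have qX : B.rq * dif k B.x = dif k B.x * B.rq := by
    simp only [rq, smul_mul_assoc, mul_smul_comm, y'X]
  have WX : B.rW * dif k B.x = dif k B.x * B.rW := by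
    simp only [rW, rS, sub_mul, mul_sub (dif k B.x), add_mul, mul_add, smul_mul_assoc, mul_smul_comm, DX, yX, y'X, xX]
  have YD : dif k B.y * dif k B.D = B.rW * dif k B.y - B.rq * dif k B.x := by
    simp only [rW, rS, rq, dif, lft, rgt, sub_mul, mul_sub, add_mul, smul_mul_assoc, Algebra.TensorProduct.tmul_mul_tmul, ← MulOpposite.op_mul, B.Dy, B.yx, mul_one, one_mul,
      MulOpposite.op_add, MulOpposite.op_smul, tmul_add, add_tmul, tmul_smul, ← smul_tmul', smul_sub]
    abel
  have E1 : ∀ z, B.E * z = z * B.E + z → ∀ n : ℤ, dif k z * (dif k B.E - n) = (dif k B.E - (n + 1 : ℤ)) * dif k z := by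
    intro z h n
    have := B.difE z h n
    have h2 := B.difE' z h n
    change (lft k z - rgt k z) * _ = _ * (lft k z - rgt k z)
    rw [sub_mul, mul_sub _ (lft k z), this, h2]
  have qE : ∀ n : ℤ, B.rq * (dif k B.E - n) = (dif k B.E - (n + 1 : ℤ)) * B.rq := by
    intro n
    rw [rq, smul_mul_assoc, B.difE' _ B.Ey, mul_smul_comm]
  have WE : ∀ n : ℤ, B.rW * (dif k B.E - n) = (dif k B.E - (n + 1 : ℤ)) * B.rW := by
    intro n
    rw [rW, rS, sub_mul, add_mul, add_mul, smul_mul_assoc, B.difE' _ B.Ey, B.difE _ B.Ey, B.difE _ B.Ex, E1 _ B.ED,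
      mul_sub _ (dif k B.D), mul_add, mul_add, mul_smul_comm]
  constructor
  · intro r; rw [mul_assoc, YX, mul_assoc]
  · intro r; rw [mul_assoc, DX, mul_assoc]
  · intro r; rw [mul_assoc, YD, mul_sub, mul_assoc, mul_assoc]
  · intro r; rw [mul_assoc, qX, mul_assoc]
  · intro r; rw [mul_assoc, WX, mul_assoc]
  · intro r n; rw [mul_assoc, E1 _ B.Ex, mul_assoc]
  · intro r n; rw [mul_assoc, E1 _ B.Ey, mul_assoc]
  · intro r n; rw [mul_assoc, E1 _ B.ED, mul_assoc]
  · intro r n; rw [mul_assoc, WE, mul_assoc]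
  · intro r n; rw [mul_assoc, qE, mul_assoc]

lemma exU : Function.Exact (k4d2 (dif k B.x) (dif k B.y) (dif k B.D) B.rW B.rq (dif k B.E)) (k4d1 (dif k B.x) (dif k B.y) (dif k B.D) (dif k B.E)) ∧
    Function.Exact (k4d3 (dif k B.x) (dif k B.y) (dif k B.D) B.rW B.rq (dif k B.E)) (k4d2 (dif k B.x) (dif k B.y) (dif k B.D) B.rW B.rq (dif k B.E)) ∧
    Function.Exact (k4d4 (dif k B.x) (dif k B.y) B.rW (dif k B.E)) (k4d3 (dif k B.x) (dif k B.y) (dif k B.D) B.rW B.rq (dif k B.E)) ∧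
    Function.Injective (k4d4 (dif k B.x) (dif k B.y) B.rW (dif k B.E)) ∧
    Function.Exact (k4d1 (dif k B.x) (dif k B.y) (dif k B.D) (dif k B.E)) (pi0 (k := k) (U := U)).toAddMonoidHom :=
  k4_exact (p4 := B.pi4.toAddMonoidHom) (p3 := B.pi3.toAddMonoidHom) (p2 := B.pi2.toAddMonoidHom) (p1 := B.pi1.toAddMonoidHom)
    (th4 := pTh (c3 k B.x)) (th3 := pTh (c2 k B.y)) (th2 := pTh (c1 k B.D)) (th1 := pTh (c0 k B.E))
    (ev4 := pEv (c3 k B.x)) (ev3 := pEv (c2 k B.y)) (ev2 := pEv (c1 k B.D)) (ev1 := pEv (c0 k B.E))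
    B.krel B.pi4_inj B.pi4_surj B.pi3_surj B.pi2_surj B.pi1_surj B.pi4_mul B.pi3_mul B.pi2_mul B.pi1_mul
    (pTh_inj _) (pTh_inj _) (pTh_inj _) (pTh_inj _) (pEv_exact _) (pEv_exact _) (pEv_exact _) (pEv_exact _)
    B.pi4_ev B.pi3_ev B.pi2_ev B.pi1_ev

noncomputable def F0 : U →ₗ[k] ((U × U) × U) × U := f40 (env_hs (k := k)) (dif k B.x) (dif k B.y) (dif k B.D) (dif k B.E)
noncomputable def F1 : ((U × U) × U) × U →ₗ[k] (U × (U × U)) × ((U × U) × U) :=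
  f41 (env_hs (k := k)) (dif k B.x) (dif k B.y) (dif k B.D) B.rW B.rq (dif k B.E)
noncomputable def F2 : (U × (U × U)) × ((U × U) × U) →ₗ[k] U × (U × (U × U)) :=
  f42 (env_hs (k := k)) (dif k B.x) (dif k B.y) (dif k B.D) B.rW B.rq (dif k B.E)
noncomputable def F3 : U × (U × (U × U)) →ₗ[k] U := f43 (env_hs (k := k)) (dif k B.x) (dif k B.y) B.rW (dif k B.E)

theorem hh_main
    {V0 V1 V2 V3 : Type} [AddCommGroup V0] [Module k V0] [AddCommGroup V1] [Module k V1]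
    [AddCommGroup V2] [Module k V2] [AddCommGroup V3] [Module k V3]
    (s0 : V0 →ₗ[k] U) (s1 : V1 →ₗ[k] ((U × U) × U) × U) (s2 : V2 →ₗ[k] (U × (U × U)) × ((U × U) × U)) (s3 : V3 →ₗ[k] U × (U × (U × U)))
    (a0 : (∀ v, B.F0 (s0 v) = 0) ∧ (∀ z, B.F0 z = 0 → ∃ v, z = s0 v) ∧ (∀ v, s0 v = 0 → v = 0))
    (a1 : (∀ v, B.F1 (s1 v) = 0) ∧ (∀ z, B.F1 z = 0 → ∃ v w, z = s1 v + B.F0 w) ∧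
      (∀ v w, s1 v = B.F0 w → v = 0))
    (a2 : (∀ v, B.F2 (s2 v) = 0) ∧ (∀ z, B.F2 z = 0 → ∃ v w, z = s2 v + B.F1 w) ∧
      (∀ v w, s2 v = B.F1 w → v = 0))
    (a3 : (∀ v, B.F3 (s3 v) = 0) ∧ (∀ z, B.F3 z = 0 → ∃ v w, z = s3 v + B.F2 w) ∧
      (∀ v w, s3 v = B.F2 w → v = 0))
    (a4 : Function.Surjective B.F3) :
    Nonempty (HH k U 0 ≃ₗ[k] V0) ∧ Nonempty (HH k U 1 ≃ₗ[k] V1) ∧ Nonempty (HH k U 2 ≃ₗ[k] V2) ∧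
    Nonempty (HH k U 3 ≃ₗ[k] V3) ∧ ∀ n, 4 ≤ n → Subsingleton (HH k U n) := by
  have e0' : Function.Exact (k4d1 (dif k B.x) (dif k B.y) (dif k B.D) (dif k B.E)) (epU k U) := by
    intro r; rw [epU_eq]; exact B.exU.2.2.2.2 r
  have es : Function.Surjective (epU k U) := fun u => ⟨lft k u, by
    rw [epU_eq, pi0, piOf_tmul]; simp⟩
  exact ext_k4 (env_hs (k := k) (U := U)) _ _ _ _ _ _ (epU k U) B.exU.1 B.exU.2.1 B.exU.2.2.1 B.exU.2.2.2.1 e0' es s0 s1 s2 s3 a0 a1 a2 a3 a4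

end PBW
end PartB4


section PartD1
variable {k : Type} [Field k]

/-- an endomorphism whose kernel and image are complementary -/
def Fit {Q : Type} [AddCommGroup Q] [Module k Q] (e : Q →ₗ[k] Q) : Prop :=
  (∀ c, ∃ c0 c', c = c0 + e c' ∧ e c0 = 0) ∧ ∀ c, e (e c) = 0 → e c = 0

lemma Fit.prodMap {Q Q' : Type} [AddCommGroup Q] [Module k Q] [AddCommGroup Q'] [Module k Q'] {e : Q →ₗ[k] Q} {e' : Q' →ₗ[k] Q'}
    (h : Fit e) (h' : Fit e') : Fit (e.prodMap e') := by
  constructor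
  · rintro ⟨a, b⟩
    obtain ⟨a0, a1, ha, ha'⟩ := h.1 a
    obtain ⟨b0, b1, hb, hb'⟩ := h'.1 b
    exact ⟨(a0, b0), (a1, b1), by simp [← ha, ← hb], by simp [ha', hb']⟩
  · rintro ⟨a, b⟩ hab
    simp only [LinearMap.prodMap_apply, Prod.mk_eq_zero] at hab ⊢
    exact ⟨h.2 a hab.1, h'.2 b hab.2⟩

lemma fit_of_basis {Q ι : Type} [Ring Q] [Algebra k Q] (b : Module.Basis ι k Q) (e : Q →ₗ[k] Q) (c : ι → k)
    (h : ∀ i, e (b i) = c i • b i) : Fit e := by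
  have key : ∀ u i, b.repr (e u) i = c i * b.repr u i := by
    intro u i
    refine basis_ind b (P := fun u => b.repr (e u) i = c i * b.repr u i) (by simp) (fun u v hu hv => by simp [hu, hv, mul_add])
      (fun r u hu => by simp [hu, mul_left_comm]) (fun j => ?_) u
    rw [h]; simp only [map_smul, Finsupp.smul_apply, smul_eq_mul, b.repr_self]
    by_cases hh : j = i
    · rw [hh]
    · simp [Finsupp.single_eq_of_ne (Ne.symm hh)]
  constructor
  · intro u
    refine basis_ind b (P := fun u => ∃ c0 c', u = c0 + e c' ∧ e c0 = 0) ⟨0, 0, by simp⟩ ?_ ?_ ?_ u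
    · rintro u v ⟨a, a', h1, h2⟩ ⟨d, d', h3, h4⟩
      exact ⟨a + d, a' + d', by rw [map_add, h1, h3]; abel, by rw [map_add, h2, h4, add_zero]⟩
    · rintro r u ⟨a, a', h1, h2⟩
      exact ⟨r • a, r • a', by rw [map_smul, ← smul_add, ← h1], by rw [map_smul, h2, smul_zero]⟩
    · intro j
      by_cases hj : c j = 0
      · exact ⟨b j, 0, by simp, by simp [h, hj]⟩
      · exact ⟨0, (c j)⁻¹ • b j, by simp [h, smul_smul, hj], by simp⟩
  · intro u hu
    apply b.repr.injective
    ext i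
    have := congrArg (fun z => b.repr z i) hu
    simp only [key, map_zero, Finsupp.coe_zero, Pi.zero_apply, mul_eq_zero] at this ⊢
    tauto

variable {K3 K2 K1 K0 V V' : Type} [AddCommGroup K3] [Module k K3] [AddCommGroup K2] [Module k K2] [AddCommGroup K1] [Module k K1]
  [AddCommGroup K0] [Module k K0] [AddCommGroup V] [Module k V] [AddCommGroup V'] [Module k V']

/-- `s` gives the cohomology at `K1` of the kernel of `e` -/
structure WH (f : K0 →ₗ[k] K1) (g : K1 →ₗ[k] K2) (e0 : K0 →ₗ[k] K0) (e1 : K1 →ₗ[k] K1) (s : V →ₗ[k] K1) : Prop where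
  es : ∀ v, e1 (s v) = 0
  gs : ∀ v, g (s v) = 0
  cp : ∀ z, e1 z = 0 → g z = 0 → ∃ v w, e0 w = 0 ∧ z = s v + f w
  id : ∀ v w, e0 w = 0 → s v = f w → v = 0

lemma cone_coh {f : K0 →ₗ[k] K1} {g : K1 →ₗ[k] K2} {h : K2 →ₗ[k] K3} {e0 : K0 →ₗ[k] K0} {e1 : K1 →ₗ[k] K1} {e2 : K2 →ₗ[k] K2}
    {s : V →ₗ[k] K1} {s' : V' →ₗ[k] K2} (w1 : WH f g e0 e1 s) (w2 : WH g h e1 e2 s')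
    (F0 : Fit e0) (F1 : Fit e1) (F2 : Fit e2) (c0 : ∀ z, f (e0 z) = e1 (f z)) (c1 : ∀ z, g (e1 z) = e2 (g z))
    (hf : ∀ z, g (f z) = 0) (hg : ∀ z, h (g z) = 0) :
    (∀ v v', h (s' v') = 0 ∧ e2 (s' v') + -g (s v) = 0) ∧
    (∀ a b, h a = 0 → e2 a + -g b = 0 → ∃ v v' w w', a = s' v' + g w ∧ b = s v + (e1 w + - f w')) ∧
    (∀ v v' w w', s' v' = g w → s v = e1 w + -f w' → v = 0 ∧ v' = 0) := by
  refine ⟨fun v v' => ⟨w2.gs _, by rw [w2.es, w1.gs]; simp⟩, ?_, ?_⟩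
  · intro a b ha hab
    obtain ⟨b0, b', hb, hb0⟩ := F1.1 b
    have hab' : e2 a = g b := by rw [← sub_eq_zero, sub_eq_add_neg, hab]
    have hk : e2 (a - g b') = g b0 := by
      rw [map_sub, hab', hb, map_add, c1]; abel
    have hz : g b0 = 0 := by
      rw [← hk]; apply F2.2; rw [hk, ← c1, hb0, map_zero]
    obtain ⟨v', w, hw, hv'⟩ := w2.cp (a - g b') (by rw [hk, hz]) (by rw [map_sub, ha, hg, sub_zero])
    obtain ⟨v, w', hw', hv⟩ := w1.cp b0 hb0 hz
    refine ⟨v, v', b' + w, -w', ?_, ?_⟩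
    · rw [map_add]
      rw [sub_eq_iff_eq_add] at hv'
      rw [hv']; abel
    · rw [hb, hv, map_add, hw, map_neg]; abel
  · intro v v' w w' h1 h2
    constructor
    · obtain ⟨u0, u1, hu, hu0⟩ := F0.1 w'
      apply w1.id v (-u0) (by rw [map_neg, hu0, neg_zero])
      have h3 : s v + f u0 = e1 (w - f u1) := by
        rw [h2, hu, map_add, map_sub, c0]; abel
      have h4 : e1 (w - f u1) = 0 := by
        apply F1.2
        rw [← h3, map_add, w1.es, ← c0, hu0, map_zero, add_zero]
      rw [h4] at h3
      rw [map_neg]; exact eq_neg_of_add_eq_zero_left h3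
    · obtain ⟨u0, u1, hu, hu0⟩ := F1.1 w
      apply w2.id v' u0 hu0
      rw [h1, hu, map_add, c1]
      have : e2 (g u1) = 0 := by
        apply F2.2
        have := congrArg e2 h1
        rw [w2.es, hu, map_add, map_add, ← c1, hu0, map_zero, zero_add, c1] at this
        exact this.symm
      rw [this, add_zero]

end PartD1


section PartD2
open Polynomial
variable {k U : Type} [Field k] [Ring U] [Algebra k U] {t : k}

noncomputable def sg : k[X] →ₗ[k] k[X] := (aeval (X + 1 : k[X])).toLinearMap

lemma sg_C (c : k) : sg (C c) = C c := by simp [sg]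
lemma sg_X_pow (n : ℕ) : sg (X ^ n : k[X]) = (X + 1) ^ n := by simp [sg]

noncomputable def dl : k[X] →ₗ[k] k[X] := sg - LinearMap.id
lemma dl_apply (f : k[X]) : dl f = sg f - f := rfl
lemma dl_C (c : k) : dl (C c) = 0 := by rw [dl_apply, sg_C, sub_self]

lemma dl_ker [CharZero k] (f : k[X]) (h : dl f = 0) : ∃ c, f = C c := by
  refine ⟨f.eval 0, ?_⟩
  rw [dl_apply, sub_eq_zero] at h
  have h1 : ∀ a : k, f.eval (a + 1) = f.eval a := by
    intro a
    have := congrArg (eval a) h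
    rw [← this, sg]
    change _ = eval a (aeval (X + 1 : k[X]) f)
    rw [← comp_eq_aeval, eval_comp]; simp
  have h2 : ∀ n : ℕ, f.eval (n : k) = f.eval 0 := by
    intro n
    induction n with
    | zero => simp
    | succ n ih => push_cast; rw [h1, ih]
  apply eq_of_infinite_eval_eq
  refine Set.Infinite.mono ?_ (Set.infinite_range_of_injective (Nat.cast_injective (R := k)))
  rintro _ ⟨n, rfl⟩
  simp [h2]

lemma dl_surj [CharZero k] : Function.Surjective (dl (k := k)) := by
  rw [← LinearMap.range_eq_top, eq_top_iff]
  have key : ∀ n : ℕ, (X ^ n : k[X]) ∈ LinearMap.range (dl (k := k)) := by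
    intro n
    induction n using Nat.strong_induction_on with
    | _ n ih =>
    have h1 : dl (X ^ (n+1) : k[X]) = (∑ i ∈ Finset.range n, ((n+1).choose i : k) • (X ^ i : k[X])) + ((n + 1 : ℕ) : k) • X ^ n := by
      rw [dl_apply, sg_X_pow, add_pow, Finset.sum_range_succ, Finset.sum_range_succ]
      simp [Polynomial.smul_eq_C_mul, mul_comm]
    have h2 : ((n + 1 : ℕ) : k) • (X ^ n : k[X]) ∈ LinearMap.range (dl (k := k)) := by
      have : ((n + 1 : ℕ) : k) • (X ^ n : k[X]) = dl (X ^ (n+1) : k[X]) - (∑ i ∈ Finset.range n, ((n+1).choose i : k) • (X ^ i : k[X])) := by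
        rw [h1]; abel
      rw [this]
      refine Submodule.sub_mem _ ⟨_, rfl⟩ (Submodule.sum_mem _ fun i hi => Submodule.smul_mem _ _ (ih i (by simpa using hi)))
    have h3 := Submodule.smul_mem _ (((n + 1 : ℕ) : k)⁻¹) h2
    rwa [smul_smul, inv_mul_cancel₀ (by exact_mod_cast Nat.succ_ne_zero n), one_smul] at h3
  intro f _
  induction f using Polynomial.induction_on' with
  | add p q hp hq => exact Submodule.add_mem _ (hp trivial) (hq trivial)
  | monomial n a =>
    rw [← mul_one a, ← smul_eq_mul, ← smul_monomial, monomial_one_right_eq_X_pow]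
    exact Submodule.smul_mem _ _ (key n)

namespace PBW
variable (B : PBW k U t)

noncomputable def rho : k[X] →ₗ[k] U := (aeval B.E).toLinearMap

lemma rho_C (c : k) : B.rho (C c) = c • 1 := by simp [rho, Algebra.algebraMap_eq_smul_one]
lemma rho_X_pow (n : ℕ) : B.rho (X ^ n) = B.E ^ n := by simp [rho]

lemma rho_comm (z : U) (h : B.E * z = z * B.E + z) (f : k[X]) : B.rho f * z = z * B.rho (sg f) := by
  induction f using Polynomial.induction_on with
  | C a => rw [sg_C, rho_C]; simp
  | add p q hp hq => rw [map_add, map_add, map_add, add_mul, mul_add, hp, hq]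
  | monomial n a ih =>
    have e1 : B.rho (C a * X ^ (n + 1)) = B.rho (C a * X ^ n) * B.E := by simp [rho, pow_succ, mul_assoc]
    have e2 : B.rho (sg (C a * X ^ (n + 1))) = B.rho (sg (C a * X ^ n)) * (B.E + 1) := by simp [rho, sg, pow_succ, mul_assoc]
    have e3 : B.E * z = z * (B.E + 1) := by rw [h, mul_add, mul_one]
    rw [e1, e2, mul_assoc, e3, ← mul_assoc, ih, mul_assoc]

noncomputable def mu (i j l : ℕ) : k[X] →ₗ[k] U := (LinearMap.mulLeft k (B.x ^ i * B.y ^ j * B.D ^ l)).comp B.rho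
lemma mu_apply (i j l : ℕ) (f : k[X]) : B.mu i j l f = B.x ^ i * B.y ^ j * B.D ^ l * B.rho f := rfl

noncomputable def ka : U →ₗ[k] (ℕ × ℕ × ℕ →₀ k[X]) :=
  B.b.constr k (fun p => Finsupp.single (p.1, p.2.1, p.2.2.1) (X ^ p.2.2.2))
lemma ka_b (i j l m : ℕ) : B.ka (B.b (i, j, l, m)) = Finsupp.single (i, j, l) (X ^ m) := B.b.constr_basis _ _ _
lemma ka_mu (i j l : ℕ) (f : k[X]) : B.ka (B.mu i j l f) = Finsupp.single (i, j, l) f := by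
  induction f using Polynomial.induction_on' with
  | add p q hp hq => rw [map_add, map_add, hp, hq, Finsupp.single_add]
  | monomial n a =>
    rw [← mul_one a, ← smul_eq_mul, ← smul_monomial, monomial_one_right_eq_X_pow, map_smul, map_smul, mu_apply, rho_X_pow,
      ← B.hb, ka_b, Finsupp.smul_single]

lemma ka_inj : Function.Injective B.ka := by
  let g : (ℕ × ℕ × ℕ →₀ k[X]) →ₗ[k] U := Finsupp.lsum k (fun p => B.mu p.1 p.2.1 p.2.2)
  have : g.comp B.ka = LinearMap.id := by
    apply B.b.ext
    rintro ⟨i, j, l, m⟩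
    rw [LinearMap.comp_apply, ka_b]
    simp [g, mu_apply, rho_X_pow, B.hb]
  intro u v h
  have := congrArg g h
  change (g.comp B.ka) u = (g.comp B.ka) v at this
  simpa [‹g.comp B.ka = LinearMap.id›] using this

lemma ka_adE (u : U) (i j l : ℕ) : B.ka (B.E * u - u * B.E) (i, j, l) = ((i + j + l : ℕ) : k) • B.ka u (i, j, l) := by
  refine basis_ind B.b (P := fun u => B.ka (B.E * u - u * B.E) (i, j, l) = ((i + j + l : ℕ) : k) • B.ka u (i, j, l)) (by simp) ?_ ?_ ?_ u
  · intro u v hu hv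
    rw [mul_add, add_mul, add_sub_add_comm, map_add, Finsupp.add_apply, hu, hv, map_add, Finsupp.add_apply, smul_add]
  · intro c u hu
    rw [mul_smul_comm, smul_mul_assoc, ← smul_sub, map_smul, Finsupp.smul_apply, hu, map_smul, Finsupp.smul_apply, smul_comm]
  · rintro ⟨i', j', l', m⟩
    rw [Eb', add_sub_cancel_left, map_smul, ka_b, Finsupp.smul_apply]
    by_cases h : (i', j', l') = (i, j, l)
    · simp only [Prod.mk.injEq] at h
      obtain ⟨rfl, rfl, rfl⟩ := h
      rfl
    · rw [Finsupp.single_eq_of_ne (Ne.symm h), smul_zero, smul_zero]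

/-- weight spaces -/
noncomputable def wt (w : ℕ) : U →ₗ[k] U := actL (env_hs (k := k)) (dif k B.E - ((w : ℤ) : U ⊗[k] Uᵐᵒᵖ))

lemma dif_smul (z u : U) : dif k z • u = z * u - u * z := by
  rw [dif, sub_smul, env_smul, env_smul]; simp

lemma wt_apply (w : ℕ) (u : U) : B.wt w u = B.E * u - u * B.E - (w : k) • u := by
  change (dif k B.E - ((w : ℤ) : U ⊗[k] Uᵐᵒᵖ)) • u = _
  rw [sub_smul, dif_smul, Int.cast_smul_eq_zsmul]
  simp [Nat.cast_smul_eq_nsmul]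

lemma wt_fit (w : ℕ) : Fit (B.wt w) := by
  refine fit_of_basis B.b _ (fun p => ((p.1 + p.2.1 + p.2.2.1 : ℕ) : k) - w) ?_
  rintro ⟨i, j, l, m⟩
  rw [wt_apply, Eb', add_sub_cancel_left, sub_smul]

lemma wt_mu [CharZero k] (i j l : ℕ) (f : k[X]) : B.wt (i + j + l) (B.mu i j l f) = 0 := by
  apply B.ka_inj
  ext1 ⟨i', j', l'⟩
  rw [wt_apply, map_sub, Finsupp.sub_apply, ka_adE, map_smul, Finsupp.smul_apply, ka_mu]
  by_cases h : (i', j', l') = (i, j, l)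
  · simp only [Prod.mk.injEq] at h
    obtain ⟨rfl, rfl, rfl⟩ := h
    simp
  · rw [Finsupp.single_eq_of_ne h, smul_zero, smul_zero]; simp

lemma ka_wt [CharZero k] (w : ℕ) (u : U) (h : B.wt w u = 0) (i j l : ℕ) (hh : i + j + l ≠ w) : B.ka u (i, j, l) = 0 := by
  have this : B.ka (B.wt w u) (i, j, l) = B.ka 0 (i, j, l) := by rw [h]
  rw [wt_apply, map_sub, Finsupp.sub_apply, ka_adE, map_smul, Finsupp.smul_apply, ← sub_smul, map_zero, Finsupp.coe_zero, Pi.zero_apply, smul_eq_zero] at this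
  rcases this with h | h
  · rw [sub_eq_zero] at h; exact absurd (Nat.cast_injective h) hh
  · exact h

end PBW
end PartD2


section PartD3
open Polynomial
variable {k U : Type} [Field k] [Ring U] [Algebra k U] {t : k}
namespace PBW
variable (B : PBW k U t)

noncomputable def m0 (f : k[X]) : U := B.mu 0 0 0 f
noncomputable def m1 (f g h : k[X]) : U := B.mu 1 0 0 f + B.mu 0 1 0 g + B.mu 0 0 1 h
noncomputable def m2 (f1 f2 f3 f4 f5 f6 : k[X]) : U := B.mu 2 0 0 f1 + B.mu 1 1 0 f2 + B.mu 1 0 1 f3 + B.mu 0 2 0 f4 + B.mu 0 1 1 f5 + B.mu 0 0 2 f6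
noncomputable def m3 (f1 f2 f3 f4 f5 f6 f7 f8 f9 f10 : k[X]) : U := B.mu 3 0 0 f1 + B.mu 2 1 0 f2 + B.mu 2 0 1 f3 + B.mu 1 2 0 f4 + B.mu 1 1 1 f5 + B.mu 1 0 2 f6
  + B.mu 0 3 0 f7 + B.mu 0 2 1 f8 + B.mu 0 1 2 f9 + B.mu 0 0 3 f10

lemma m0_wt [CharZero k] (f : k[X]) : B.wt 0 (B.m0 f) = 0 := B.wt_mu 0 0 0 f
lemma m1_wt [CharZero k] (f g h : k[X]) : B.wt 1 (B.m1 f g h) = 0 := by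
  rw [m1, map_add, map_add, B.wt_mu 1 0 0, B.wt_mu 0 1 0, B.wt_mu 0 0 1]; simp
lemma m2_wt [CharZero k] (f1 f2 f3 f4 f5 f6 : k[X]) : B.wt 2 (B.m2 f1 f2 f3 f4 f5 f6) = 0 := by
  simp only [m2, map_add]
  rw [B.wt_mu 2 0 0, B.wt_mu 1 1 0, B.wt_mu 1 0 1, B.wt_mu 0 2 0, B.wt_mu 0 1 1, B.wt_mu 0 0 2]; simp

lemma m0_ex [CharZero k] (u : U) (h : B.wt 0 u = 0) : ∃ f, u = B.m0 f := by
  refine ⟨B.ka u (0, 0, 0), B.ka_inj (Finsupp.ext ?_)⟩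
  rintro ⟨i, j, l⟩
  rw [m0, ka_mu]
  by_cases hw : i + j + l = 0
  · obtain ⟨rfl, rfl, rfl⟩ : i = 0 ∧ j = 0 ∧ l = 0 := by omega
    simp
  · rw [B.ka_wt 0 u h i j l hw]
    simp [Finsupp.single_apply]; omega

lemma m1_ex [CharZero k] (u : U) (h : B.wt 1 u = 0) : ∃ f g h, u = B.m1 f g h := by
  refine ⟨B.ka u (1, 0, 0), B.ka u (0, 1, 0), B.ka u (0, 0, 1), B.ka_inj (Finsupp.ext ?_)⟩
  rintro ⟨i, j, l⟩
  simp only [m1, map_add, ka_mu, Finsupp.add_apply, Finsupp.single_apply, Prod.mk.injEq]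
  by_cases hw : i + j + l = 1
  · have hi : i ≤ 1 := by omega
    have hj : j ≤ 1 - i := by omega
    obtain rfl : l = 1 - i - j := by omega
    interval_cases i <;> interval_cases j <;> simp
  · rw [B.ka_wt 1 u h i j l hw]
    rw [if_neg (by omega), if_neg (by omega), if_neg (by omega)]; simp

lemma m2_ex [CharZero k] (u : U) (h : B.wt 2 u = 0) : ∃ f1 f2 f3 f4 f5 f6, u = B.m2 f1 f2 f3 f4 f5 f6 := by
  refine ⟨B.ka u (2, 0, 0), B.ka u (1, 1, 0), B.ka u (1, 0, 1), B.ka u (0, 2, 0), B.ka u (0, 1, 1), B.ka u (0, 0, 2), B.ka_inj (Finsupp.ext ?_)⟩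
  rintro ⟨i, j, l⟩
  simp only [m2, map_add, ka_mu, Finsupp.add_apply, Finsupp.single_apply, Prod.mk.injEq]
  by_cases hw : i + j + l = 2
  · have hi : i ≤ 2 := by omega
    have hj : j ≤ 2 - i := by omega
    obtain rfl : l = 2 - i - j := by omega
    interval_cases i <;> interval_cases j <;> simp
  · rw [B.ka_wt 2 u h i j l hw]
    repeat rw [if_neg (by omega)]
    simp

lemma m3_ex [CharZero k] (u : U) (h : B.wt 3 u = 0) : ∃ f1 f2 f3 f4 f5 f6 f7 f8 f9 f10, u = B.m3 f1 f2 f3 f4 f5 f6 f7 f8 f9 f10 := by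
  refine ⟨B.ka u (3, 0, 0), B.ka u (2, 1, 0), B.ka u (2, 0, 1), B.ka u (1, 2, 0), B.ka u (1, 1, 1), B.ka u (1, 0, 2),
    B.ka u (0, 3, 0), B.ka u (0, 2, 1), B.ka u (0, 1, 2), B.ka u (0, 0, 3), B.ka_inj (Finsupp.ext ?_)⟩
  rintro ⟨i, j, l⟩
  simp only [m3, map_add, ka_mu, Finsupp.add_apply, Finsupp.single_apply, Prod.mk.injEq]
  by_cases hw : i + j + l = 3
  · have hi : i ≤ 3 := by omega
    have hj : j ≤ 3 - i := by omega
    obtain rfl : l = 3 - i - j := by omega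
    interval_cases i <;> interval_cases j <;> simp
  · rw [B.ka_wt 3 u h i j l hw]
    repeat rw [if_neg (by omega)]
    simp

lemma m0_inj (f f' : k[X]) : B.m0 f = B.m0 f' ↔ f = f' := by
  refine ⟨fun h => ?_, fun h => by rw [h]⟩
  have := congrArg (fun u => B.ka u (0, 0, 0)) h
  simpa [m0, ka_mu, Finsupp.single_apply] using this

lemma m1_inj (f g h f' g' h' : k[X]) : B.m1 f g h = B.m1 f' g' h' ↔ f = f' ∧ g = g' ∧ h = h' := by
  refine ⟨fun h => ?_, fun ⟨h, h', h''⟩ => by rw [h, h', h'']⟩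
  have e1 := congrArg (fun u => B.ka u (1, 0, 0)) h
  have e2 := congrArg (fun u => B.ka u (0, 1, 0)) h
  have e3 := congrArg (fun u => B.ka u (0, 0, 1)) h
  simp [m1, ka_mu, Finsupp.single_apply] at e1 e2 e3
  exact ⟨e1, e2, e3⟩

lemma m2_inj (f1 f2 f3 f4 f5 f6 g1 g2 g3 g4 g5 g6 : k[X]) : B.m2 f1 f2 f3 f4 f5 f6 = B.m2 g1 g2 g3 g4 g5 g6 ↔
    f1 = g1 ∧ f2 = g2 ∧ f3 = g3 ∧ f4 = g4 ∧ f5 = g5 ∧ f6 = g6 := by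
  refine ⟨fun h => ?_, fun ⟨h1, h2, h3, h4, h5, h6⟩ => by rw [h1, h2, h3, h4, h5, h6]⟩
  have e1 := congrArg (fun u => B.ka u (2, 0, 0)) h
  have e2 := congrArg (fun u => B.ka u (1, 1, 0)) h
  have e3 := congrArg (fun u => B.ka u (1, 0, 1)) h
  have e4 := congrArg (fun u => B.ka u (0, 2, 0)) h
  have e5 := congrArg (fun u => B.ka u (0, 1, 1)) h
  have e6 := congrArg (fun u => B.ka u (0, 0, 2)) h
  simp [m2, ka_mu, Finsupp.single_apply] at e1 e2 e3 e4 e5 e6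
  exact ⟨e1, e2, e3, e4, e5, e6⟩

lemma m3_inj (f1 f2 f3 f4 f5 f6 f7 f8 f9 f10 g1 g2 g3 g4 g5 g6 g7 g8 g9 g10 : k[X]) :
    B.m3 f1 f2 f3 f4 f5 f6 f7 f8 f9 f10 = B.m3 g1 g2 g3 g4 g5 g6 g7 g8 g9 g10 ↔
    f1 = g1 ∧ f2 = g2 ∧ f3 = g3 ∧ f4 = g4 ∧ f5 = g5 ∧ f6 = g6 ∧ f7 = g7 ∧ f8 = g8 ∧ f9 = g9 ∧ f10 = g10 := by
  refine ⟨fun h => ?_, fun ⟨h1, h2, h3, h4, h5, h6, h7, h8, h9, h10⟩ => by rw [h1, h2, h3, h4, h5, h6, h7, h8, h9, h10]⟩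
  have e1 := congrArg (fun u => B.ka u (3, 0, 0)) h
  have e2 := congrArg (fun u => B.ka u (2, 1, 0)) h
  have e3 := congrArg (fun u => B.ka u (2, 0, 1)) h
  have e4 := congrArg (fun u => B.ka u (1, 2, 0)) h
  have e5 := congrArg (fun u => B.ka u (1, 1, 1)) h
  have e6 := congrArg (fun u => B.ka u (1, 0, 2)) h
  have e7 := congrArg (fun u => B.ka u (0, 3, 0)) h
  have e8 := congrArg (fun u => B.ka u (0, 2, 1)) h
  have e9 := congrArg (fun u => B.ka u (0, 1, 2)) h
  have e10 := congrArg (fun u => B.ka u (0, 0, 3)) h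
  simp [m3, ka_mu, Finsupp.single_apply] at e1 e2 e3 e4 e5 e6 e7 e8 e9 e10
  exact ⟨e1, e2, e3, e4, e5, e6, e7, e8, e9, e10⟩

lemma m1_add (f1 f2 f3 g1 g2 g3 : k[X]) : B.m1 f1 f2 f3 + B.m1 g1 g2 g3 = B.m1 (f1 + g1) (f2 + g2) (f3 + g3) := by
  simp only [m1, map_add]; abel
lemma m1_smul (c : k) (f1 f2 f3 : k[X]) : c • B.m1 f1 f2 f3 = B.m1 (c • f1) (c • f2) (c • f3) := by
  simp only [m1, map_smul, smul_add]
lemma m2_add (f1 f2 f3 f4 f5 f6 g1 g2 g3 g4 g5 g6 : k[X]) : B.m2 f1 f2 f3 f4 f5 f6 + B.m2 g1 g2 g3 g4 g5 g6 =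
    B.m2 (f1 + g1) (f2 + g2) (f3 + g3) (f4 + g4) (f5 + g5) (f6 + g6) := by
  simp only [m2, map_add]; abel
lemma m2_neg (f1 f2 f3 f4 f5 f6 : k[X]) : -B.m2 f1 f2 f3 f4 f5 f6 = B.m2 (-f1) (-f2) (-f3) (-f4) (-f5) (-f6) := by
  simp only [m2, map_neg]; abel
lemma m2_smul (c : k) (f1 f2 f3 f4 f5 f6 : k[X]) : c • B.m2 f1 f2 f3 f4 f5 f6 = B.m2 (c • f1) (c • f2) (c • f3) (c • f4) (c • f5) (c • f6) := by
  simp only [m2, map_smul, smul_add]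
lemma m2_zero : B.m2 0 0 0 0 0 0 = 0 := by simp [m2]
lemma m1_zero : B.m1 0 0 0 = 0 := by simp [m1]
lemma m3_zero : B.m3 0 0 0 0 0 0 0 0 0 0 = 0 := by simp [m3]
lemma m3_add (f1 f2 f3 f4 f5 f6 f7 f8 f9 f10 g1 g2 g3 g4 g5 g6 g7 g8 g9 g10 : k[X]) :
    B.m3 f1 f2 f3 f4 f5 f6 f7 f8 f9 f10 + B.m3 g1 g2 g3 g4 g5 g6 g7 g8 g9 g10 =
    B.m3 (f1 + g1) (f2 + g2) (f3 + g3) (f4 + g4) (f5 + g5) (f6 + g6) (f7 + g7) (f8 + g8) (f9 + g9) (f10 + g10) := by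
  simp only [m3, map_add]; abel
lemma m3_neg (f1 f2 f3 f4 f5 f6 f7 f8 f9 f10 : k[X]) :
    -B.m3 f1 f2 f3 f4 f5 f6 f7 f8 f9 f10 =
    B.m3 (-f1) (-f2) (-f3) (-f4) (-f5) (-f6) (-f7) (-f8) (-f9) (-f10) := by
  simp only [m3, map_neg]; abel

end PBW
end PartD3


section PartD4
open Polynomial
variable {k U : Type} [Field k] [Ring U] [Algebra k U] {t : k}
namespace PBW
variable (B : PBW k U t)

lemma rW_smul (u : U) : B.rW • u = B.D * u - u * B.D - (B.y * u + u * B.y + t • (B.x * u)) := by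
  rw [rW, sub_smul, dif_smul, rS, add_smul, add_smul, lft, rgt, env_smul, env_smul, lft, smul_tmul', env_smul]
  simp

lemma rq_smul (u : U) : B.rq • u = t • (u * B.y) := by
  rw [rq, rgt, TensorProduct.smul_tmul', env_smul]
  simp

lemma yx' (u : U) : B.y * (B.x * u) = B.x * (B.y * u) := by rw [← mul_assoc, B.yx, mul_assoc]
lemma Dx' (u : U) : B.D * (B.x * u) = B.x * (B.D * u) := by rw [← mul_assoc, B.Dx, mul_assoc]
lemma Dy' (u : U) : B.D * (B.y * u) = B.y * (B.D * u) + (B.y * (B.y * u) + t • (B.x * (B.y * u))) := by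
  rw [← mul_assoc, B.Dy]; simp only [add_mul, mul_assoc, smul_mul_assoc]
lemma rx (f : k[X]) : B.rho f * B.x = B.x * B.rho (sg f) := B.rho_comm _ B.Ex f
lemma ry (f : k[X]) : B.rho f * B.y = B.y * B.rho (sg f) := B.rho_comm _ B.Ey f
lemma rD (f : k[X]) : B.rho f * B.D = B.D * B.rho (sg f) := B.rho_comm _ B.ED f

lemma X_m0 (f : k[X]) : dif k B.x • B.m0 f = B.m1 (-dl f) 0 0 := by
  simp only [dif_smul, rW_smul, rq_smul, m0, m1, m2, m3, mu_apply, pow_zero, pow_succ, one_mul, mul_one, mul_add, add_mul, mul_assoc, B.rx, B.ry, B.rD,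
    B.yx, B.Dx, B.Dy, yx', Dx', Dy', mul_smul_comm, smul_mul_assoc, dl_apply, map_add, map_sub, map_neg, map_smul, map_zero, mul_sub, mul_neg, mul_zero]
  module
lemma Y_m0 (f : k[X]) : dif k B.y • B.m0 f = B.m1 0 (-dl f) 0 := by
  simp only [dif_smul, rW_smul, rq_smul, m0, m1, m2, m3, mu_apply, pow_zero, pow_succ, one_mul, mul_one, mul_add, add_mul, mul_assoc, B.rx, B.ry, B.rD,
    B.yx, B.Dx, B.Dy, yx', Dx', Dy', mul_smul_comm, smul_mul_assoc, dl_apply, map_add, map_sub, map_neg, map_smul, map_zero, mul_sub, mul_neg, mul_zero]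
  module
lemma D_m0 (f : k[X]) : dif k B.D • B.m0 f = B.m1 0 0 (-dl f) := by
  simp only [dif_smul, rW_smul, rq_smul, m0, m1, m2, m3, mu_apply, pow_zero, pow_succ, one_mul, mul_one, mul_add, add_mul, mul_assoc, B.rx, B.ry, B.rD,
    B.yx, B.Dx, B.Dy, yx', Dx', Dy', mul_smul_comm, smul_mul_assoc, dl_apply, map_add, map_sub, map_neg, map_smul, map_zero, mul_sub, mul_neg, mul_zero]
  module
lemma X_m1 (f g h : k[X]) : dif k B.x • B.m1 f g h = B.m2 (-dl f) (-dl g) (-dl h) 0 0 0 := by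
  simp only [dif_smul, rW_smul, rq_smul, m0, m1, m2, m3, mu_apply, pow_zero, pow_succ, one_mul, mul_one, mul_add, add_mul, mul_assoc, B.rx, B.ry, B.rD,
    B.yx, B.Dx, B.Dy, yx', Dx', Dy', mul_smul_comm, smul_mul_assoc, dl_apply, map_add, map_sub, map_neg, map_smul, map_zero, mul_sub, mul_neg, mul_zero]
  module
lemma Y_m1 (f g h : k[X]) : dif k B.y • B.m1 f g h = B.m2 0 (-dl f - t • sg h) 0 (-dl g - sg h) (-dl h) 0 := by
  simp only [dif_smul, rW_smul, rq_smul, m0, m1, m2, m3, mu_apply, pow_zero, pow_succ, one_mul, mul_one, mul_add, add_mul, mul_assoc, B.rx, B.ry, B.rD,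
    B.yx, B.Dx, B.Dy, yx', Dx', Dy', mul_smul_comm, smul_mul_assoc, dl_apply, map_add, map_sub, map_neg, map_smul, map_zero, mul_sub, mul_neg, mul_zero]
  module
lemma D_m1 (f g h : k[X]) : dif k B.D • B.m1 f g h = B.m2 0 (t • g) (-dl f) g (-dl g) (-dl h) := by
  simp only [dif_smul, rW_smul, rq_smul, m0, m1, m2, m3, mu_apply, pow_zero, pow_succ, one_mul, mul_one, mul_add, add_mul, mul_assoc, B.rx, B.ry, B.rD,
    B.yx, B.Dx, B.Dy, yx', Dx', Dy', mul_smul_comm, smul_mul_assoc, dl_apply, map_add, map_sub, map_neg, map_smul, map_zero, mul_sub, mul_neg, mul_zero]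
  module
lemma q_m1 (f g h : k[X]) : B.rq • B.m1 f g h =
    B.m2 0 (t • sg f + (t * t) • sg h) 0 (t • sg g + t • sg h) (t • sg h) 0 := by
  simp only [dif_smul, rW_smul, rq_smul, m0, m1, m2, m3, mu_apply, pow_zero, pow_succ, one_mul, mul_one, mul_add, add_mul, mul_assoc, B.rx, B.ry, B.rD,
    B.yx, B.Dx, B.Dy, yx', Dx', Dy', mul_smul_comm, smul_mul_assoc, dl_apply, map_add, map_sub, map_neg, map_smul, map_zero, mul_sub, mul_neg, mul_zero]
  module
lemma W_m1 (f g h : k[X]) : B.rW • B.m1 f g h =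
    B.m2 (-(t • f)) (-f - sg f - t • sg h) (-dl f - t • h) (-sg g - sg h) (-dl g - h - sg h) (-dl h) := by
  simp only [dif_smul, rW_smul, rq_smul, m0, m1, m2, m3, mu_apply, pow_zero, pow_succ, one_mul, mul_one, mul_add, add_mul, mul_assoc, B.rx, B.ry, B.rD,
    B.yx, B.Dx, B.Dy, yx', Dx', Dy', mul_smul_comm, smul_mul_assoc, dl_apply, map_add, map_sub, map_neg, map_smul, map_zero, mul_sub, mul_neg, mul_zero]
  module
lemma X_m2 (f1 f2 f3 f4 f5 f6 : k[X]) : dif k B.x • B.m2 f1 f2 f3 f4 f5 f6 =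
    B.m3 (-dl f1) (-dl f2) (-dl f3) (-dl f4) (-dl f5) (-dl f6) 0 0 0 0 := by
  simp only [dif_smul, rW_smul, rq_smul, m0, m1, m2, m3, mu_apply, pow_zero, pow_succ, one_mul, mul_one, mul_add, add_mul, mul_assoc, B.rx, B.ry, B.rD,
    B.yx, B.Dx, B.Dy, yx', Dx', Dy', mul_smul_comm, smul_mul_assoc, dl_apply, map_add, map_sub, map_neg, map_smul, map_zero, mul_sub, mul_neg, mul_zero]
  module
lemma Y_m2 (f1 f2 f3 f4 f5 f6 : k[X]) : dif k B.y • B.m2 f1 f2 f3 f4 f5 f6 =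
    B.m3 0 (-dl f1 - t • sg f3 - (t * t) • sg f6) 0 (-dl f2 - sg f3 - t • sg f5 - (3 * t) • sg f6) (-dl f3 - (2 * t) • sg f6) 0
      (-dl f4 - sg f5 - (2 : k) • sg f6) (-dl f5 - (2 : k) • sg f6) (-dl f6) 0 := by
  simp only [dif_smul, rW_smul, rq_smul, m0, m1, m2, m3, mu_apply, pow_zero, pow_succ, one_mul, mul_one, mul_add, add_mul, mul_assoc, B.rx, B.ry, B.rD,
    B.yx, B.Dx, B.Dy, yx', Dx', Dy', mul_smul_comm, smul_mul_assoc, dl_apply, map_add, map_sub, map_neg, map_smul, map_zero, mul_sub, mul_neg, mul_zero]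
  module
lemma W_m2 (f : k[X]) : B.rW • B.m2 0 0 0 0 0 f =
    B.m3 0 (-((t * t) • sg f)) 0 (-((3 * t) • sg f)) (-((2 * t) • sg f)) (-(t • f)) (-((2 : k) • sg f)) (-((2 : k) • sg f)) (-f - sg f) (-dl f) := by
  simp only [dif_smul, rW_smul, rq_smul, m0, m1, m2, m3, mu_apply, pow_zero, pow_succ, one_mul, mul_one, mul_add, add_mul, mul_assoc, B.rx, B.ry, B.rD,
    B.yx, B.Dx, B.Dy, yx', Dx', Dy', mul_smul_comm, smul_mul_assoc, dl_apply, map_add, map_sub, map_neg, map_smul, map_zero, mul_sub, mul_neg, mul_zero, zero_mul, smul_add]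
  module
end PBW
end PartD4


section PartD5
open Polynomial
variable {k U : Type} [Field k] [Ring U] [Algebra k U] {t : k}

noncomputable def iI [CharZero k] : k[X] →ₗ[k] k[X] :=
  (LinearMap.exists_rightInverse_of_surjective (dl (k := k)) (LinearMap.range_eq_top.2 dl_surj)).choose
lemma dl_iI [CharZero k] (f : k[X]) : dl (iI f) = f :=
  LinearMap.congr_fun (LinearMap.exists_rightInverse_of_surjective (dl (k := k)) (LinearMap.range_eq_top.2 dl_surj)).choose_spec f
lemma sg_eq (f : k[X]) : sg f = dl f + f := by rw [dl_apply]; abel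
lemma dl_one : dl (1 : k[X]) = 0 := by rw [← C_1, dl_C]
lemma dl_ker' [CharZero k] (f : k[X]) (h : dl f = 0) : ∃ c : k, f = c • 1 := by
  obtain ⟨c, hc⟩ := dl_ker f h
  exact ⟨c, by rw [hc, smul_eq_C_mul, mul_one]⟩
lemma dl_ker2 [CharZero k] (f g : k[X]) (h : dl f = g) : ∃ c : k, f = iI g + c • 1 := by
  obtain ⟨c, hc⟩ := dl_ker' (f - iI g) (by rw [map_sub, dl_iI, h, sub_self])
  exact ⟨c, by rw [← hc]; abel⟩

lemma kabs0 {R A : Type} [Ring R] [AddCommGroup A] [Module R A] {X Y D W q E : R} (K : KRel X Y D W q E) (u : A) :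
    Y • X • u + -(X • Y • u) = 0 ∧ D • X • u + -(X • D • u) = 0 ∧ -(q • X • u) + W • Y • u + -(Y • D • u) = 0 := by
  have k1 := K.YX 1
  have k2 := K.DX 1
  have k3 := K.YD 1
  simp only [one_mul] at k1 k2 k3
  simp only [smul_smul, k1, k2, k3, sub_smul]
  refine ⟨?_, ?_, ?_⟩ <;> abel

lemma kabs1 {R A : Type} [Ring R] [AddCommGroup A] [Module R A] {X Y D W q E : R} (K : KRel X Y D W q E) (a b c : A) :
    W • (Y • a + -(X • b)) + -(Y • (D • a + -(X • c)) + -(X • (-(q • a) + W • b + -(Y • c)))) = 0 := by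
  have k1 := K.YX 1
  have k3 := K.YD 1
  have k4 := K.qX 1
  have k5 := K.WX 1
  simp only [one_mul] at k1 k3 k4 k5
  simp only [smul_add, smul_neg, smul_smul, k1, k3, ← k4, k5, sub_smul]
  abel

namespace PBW
variable (B : PBW k U t)

noncomputable def h0 : U →ₗ[k] (U × U) × U := f30 (env_hs (k := k)) (dif k B.x) (dif k B.y) (dif k B.D)
noncomputable def h1 : (U × U) × U →ₗ[k] U × (U × U) := f31 (env_hs (k := k)) (dif k B.x) (dif k B.y) (dif k B.D) B.rW B.rq
noncomputable def h2 : U × (U × U) →ₗ[k] U := f32 (env_hs (k := k)) (dif k B.x) (dif k B.y) B.rW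
noncomputable def e1 : (U × U) × U →ₗ[k] (U × U) × U := ((B.wt 1).prodMap (B.wt 1)).prodMap (B.wt 1)
noncomputable def e2 : U × (U × U) →ₗ[k] U × (U × U) := (B.wt 2).prodMap ((B.wt 2).prodMap (B.wt 2))

lemma h0_apply (u : U) : B.h0 u = ((dif k B.x • u, dif k B.y • u), dif k B.D • u) := rfl
lemma h1_apply (a b c : U) : B.h1 ((a, b), c) = (dif k B.y • a + -(dif k B.x • b),
  (dif k B.D • a + -(dif k B.x • c), -(B.rq • a) + B.rW • b + -(dif k B.y • c))) := rfl
lemma h2_apply (p q r : U) : B.h2 (p, (q, r)) = B.rW • p + -(dif k B.y • q + -(dif k B.x • r)) := rfl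
lemma e1_apply (a b c : U) : B.e1 ((a, b), c) = ((B.wt 1 a, B.wt 1 b), B.wt 1 c) := rfl
lemma e2_apply (a b c : U) : B.e2 (a, (b, c)) = (B.wt 2 a, (B.wt 2 b, B.wt 2 c)) := rfl
lemma F0_apply (u : U) : B.F0 u = (B.h0 u, B.wt 0 u) := rfl
lemma F1_apply (a b) : B.F1 (a, b) = (B.h1 a, B.e1 a + -B.h0 b) := rfl
lemma F2_apply (a b) : B.F2 (a, b) = (B.h2 a, B.e2 a + -B.h1 b) := rfl
lemma F3_apply (a b) : B.F3 (a, b) = B.wt 3 a + -B.h2 b := rfl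

lemma h1h0 (u : U) : B.h1 (B.h0 u) = 0 := by
  rw [h0_apply, h1_apply]
  obtain ⟨e1, e2, e3⟩ := kabs0 B.krel u
  rw [e1, e2, e3]; rfl

lemma h2h1 (z) : B.h2 (B.h1 z) = 0 := by
  obtain ⟨⟨a, b⟩, c⟩ := z
  rw [h1_apply, h2_apply]
  exact kabs1 B.krel a b c

lemma comm1 (r s : U ⊗[k] Uᵐᵒᵖ) (n m : ℕ) (h : r * (s - ((n : ℤ) : U ⊗[k] Uᵐᵒᵖ)) = (s - ((m : ℤ) : U ⊗[k] Uᵐᵒᵖ)) * r) (u : U) :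
    r • ((s - ((n : ℤ) : U ⊗[k] Uᵐᵒᵖ)) • u) = (s - ((m : ℤ) : U ⊗[k] Uᵐᵒᵖ)) • (r • u) := by
  rw [smul_smul, smul_smul, h]

lemma wtc (r : U ⊗[k] Uᵐᵒᵖ) (h : ∀ n : ℤ, 1 * r * (dif k B.E - n) = 1 * (dif k B.E - (n + 1 : ℤ)) * r) (n : ℕ) (u : U) :
    r • (B.wt n u) = B.wt (n + 1) (r • u) := by
  have := h n
  rw [one_mul, one_mul] at this
  exact comm1 r (dif k B.E) n (n + 1) this u

lemma h0e (u : U) : B.h0 (B.wt 0 u) = B.e1 (B.h0 u) := by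
  have K := B.krel
  rw [h0_apply, h0_apply, e1_apply, B.wtc _ (K.XE 1), B.wtc _ (K.YE 1), B.wtc _ (K.DE 1)]
lemma h1e (z) : B.h1 (B.e1 z) = B.e2 (B.h1 z) := by
  have K := B.krel
  obtain ⟨⟨a, b⟩, c⟩ := z
  rw [h1_apply, e1_apply, e2_apply, h1_apply]
  simp only [B.wtc _ (K.XE 1), B.wtc _ (K.YE 1), B.wtc _ (K.DE 1), B.wtc _ (K.WE 1), B.wtc _ (K.qE 1), map_add, map_neg]
lemma h2e (z) : B.h2 (B.e2 z) = B.wt 3 (B.h2 z) := by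
  have K := B.krel
  obtain ⟨a, b, c⟩ := z
  rw [h2_apply, e2_apply, h2_apply]
  simp only [B.wtc _ (K.XE 1), B.wtc _ (K.YE 1), B.wtc _ (K.WE 1), map_add, map_neg]

lemma h0_m (f : k[X]) : B.h0 (B.m0 f) = ((B.m1 (-dl f) 0 0, B.m1 0 (-dl f) 0), B.m1 0 0 (-dl f)) := by
  rw [h0_apply, X_m0, Y_m0, D_m0]

lemma h1_m (a1 a2 a3 b1 b2 b3 c1 c2 c3 : k[X]) : B.h1 ((B.m1 a1 a2 a3, B.m1 b1 b2 b3), B.m1 c1 c2 c3) =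
    (B.m2 (dl b1) (-dl a1 - t • sg a3 + dl b2) (dl b3) (-dl a2 - sg a3) (-dl a3) 0,
     (B.m2 (dl c1) (t • a2 + dl c2) (-dl a1 + dl c3) a2 (-dl a2) (-dl a3),
      B.m2 (-(t • b1)) (-(t • sg a1) - (t * t) • sg a3 - b1 - sg b1 - t • sg b3 + dl c1 + t • sg c3) (-dl b1 - t • b3)
        (-(t • sg a2) - t • sg a3 - sg b2 - sg b3 + dl c2 + sg c3) (-(t • sg a3) - dl b2 - b3 - sg b3 + dl c3) (-dl b3))) := by
  rw [h1_apply]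
  simp only [X_m1, Y_m1, D_m1, W_m1, q_m1, m2_neg, m2_add]
  refine Prod.ext ?_ (Prod.ext ?_ ?_) <;> dsimp only <;> congr 1 <;> module

lemma h2_m (p q1 q2 q3 q4 q5 q6 r1 r2 r3 r4 r5 r6 : k[X]) :
    B.h2 (B.m2 0 0 0 0 0 p, (B.m2 q1 q2 q3 q4 q5 q6, B.m2 r1 r2 r3 r4 r5 r6)) =
    B.m3 (-dl r1) (-((t * t) • sg p) + dl q1 + t • sg q3 + (t * t) • sg q6 - dl r2) (-dl r3)
     (-((3 * t) • sg p) + dl q2 + sg q3 + t • sg q5 + (3 * t) • sg q6 - dl r4)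
     (-((2 * t) • sg p) + dl q3 + (2 * t) • sg q6 - dl r5) (-(t • p) - dl r6)
     (-((2 : k) • sg p) + dl q4 + sg q5 + (2 : k) • sg q6) (-((2 : k) • sg p) + dl q5 + (2 : k) • sg q6)
     (-p - sg p + dl q6) (-dl p) := by
  rw [h2_apply]
  simp only [X_m2, Y_m2, W_m2, m3_neg, m3_add]
  congr 1 <;> module
end PBW
end PartD5


section PartD6
open Polynomial
variable {k U : Type} [Field k] [CharZero k] [Ring U] [Algebra k U] {t : k}
namespace PBW
variable (B : PBW k U t)

noncomputable def s0 : k →ₗ[k] U where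
  toFun c := B.m0 (c • 1)
  map_add' c d := by rw [m0, m0, m0, ← map_add, add_smul]
  map_smul' c d := by rw [m0, m0, RingHom.id_apply, ← map_smul, smul_smul, smul_eq_mul]
lemma s0_apply (c : k) : B.s0 c = B.m0 (c • 1) := rfl

lemma m0_zero : B.m0 0 = 0 := by simp [m0]

lemma wh0 : WH (0 : PUnit →ₗ[k] U) B.h0 0 (B.wt 0) B.s0 where
  es v := B.m0_wt _
  gs v := by
    rw [s0_apply, h0_m]; simp [dl_one, m1_zero]
  cp z hz hg := by
    obtain ⟨f, rfl⟩ := B.m0_ex z hz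
    rw [h0_m] at hg
    simp only [Prod.mk_eq_zero, ← m1_zero B, m1_inj] at hg
    obtain ⟨c, hc⟩ := dl_ker' f (by simpa using hg.1.1.1)
    exact ⟨c, 0, rfl, by simp [s0_apply, hc]⟩
  id v w _ h := by
    rw [s0_apply, LinearMap.zero_apply, ← m0_zero B, m0_inj] at h
    simpa using h

noncomputable def s1 : k × k →ₗ[k] (U × U) × U where
  toFun v := ((0, 0), B.m1 (v.1 • 1) (v.2 • 1) 0)
  map_add' c d := by simp [m1_add, add_smul]
  map_smul' c d := by simp [m1_smul, smul_smul]
lemma s1_apply (v : k × k) : B.s1 v = ((0, 0), B.m1 (v.1 • 1) (v.2 • 1) 0) := rfl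
lemma s1_apply' (v : k × k) : B.s1 v = ((B.m1 0 0 0, B.m1 0 0 0), B.m1 (v.1 • 1) (v.2 • 1) 0) := by rw [m1_zero]; rfl

lemma e1_ex (w) (h : B.e1 w = 0) : ∃ a1 a2 a3 b1 b2 b3 c1 c2 c3, w = ((B.m1 a1 a2 a3, B.m1 b1 b2 b3), B.m1 c1 c2 c3) := by
  obtain ⟨⟨a, b⟩, c⟩ := w
  rw [e1_apply] at h
  simp only [Prod.mk_eq_zero] at h
  obtain ⟨a1, a2, a3, rfl⟩ := B.m1_ex a h.1.1
  obtain ⟨b1, b2, b3, rfl⟩ := B.m1_ex b h.1.2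
  obtain ⟨c1, c2, c3, rfl⟩ := B.m1_ex c h.2
  exact ⟨a1, a2, a3, b1, b2, b3, c1, c2, c3, rfl⟩
lemma e1_m (a1 a2 a3 b1 b2 b3 c1 c2 c3 : k[X]) : B.e1 ((B.m1 a1 a2 a3, B.m1 b1 b2 b3), B.m1 c1 c2 c3) = 0 := by
  simp [e1_apply, m1_wt]
lemma e2_ex (w) (h : B.e2 w = 0) : ∃ a1 a2 a3 a4 a5 a6 b1 b2 b3 b4 b5 b6 c1 c2 c3 c4 c5 c6,
    w = (B.m2 a1 a2 a3 a4 a5 a6, (B.m2 b1 b2 b3 b4 b5 b6, B.m2 c1 c2 c3 c4 c5 c6)) := by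
  obtain ⟨a, b, c⟩ := w
  rw [e2_apply] at h
  simp only [Prod.mk_eq_zero] at h
  obtain ⟨a1, a2, a3, a4, a5, a6, rfl⟩ := B.m2_ex a h.1
  obtain ⟨b1, b2, b3, b4, b5, b6, rfl⟩ := B.m2_ex b h.2.1
  obtain ⟨c1, c2, c3, c4, c5, c6, rfl⟩ := B.m2_ex c h.2.2
  exact ⟨a1, a2, a3, a4, a5, a6, b1, b2, b3, b4, b5, b6, c1, c2, c3, c4, c5, c6, rfl⟩
lemma e2_m (a1 a2 a3 a4 a5 a6 b1 b2 b3 b4 b5 b6 c1 c2 c3 c4 c5 c6 : k[X]) :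
    B.e2 (B.m2 a1 a2 a3 a4 a5 a6, (B.m2 b1 b2 b3 b4 b5 b6, B.m2 c1 c2 c3 c4 c5 c6)) = 0 := by
  simp [e2_apply, m2_wt]

lemma wh1 (ht : t ≠ 0) : WH B.h0 B.h1 (B.wt 0) B.e1 B.s1 where
  es v := by rw [s1_apply', e1_m]
  gs v := by
    rw [s1_apply', h1_m]
    simp [dl_one, m2_zero]
  cp z hz hg := by
    obtain ⟨a1, a2, a3, b1, b2, b3, c1, c2, c3, rfl⟩ := B.e1_ex z hz
    rw [h1_m] at hg
    simp only [Prod.mk_eq_zero, ← m2_zero B, m2_inj, sg_eq] at hg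
    obtain ⟨⟨P1, P2, P3, P4, P5, -⟩, ⟨Q1, Q2, Q3, Q4, Q5, Q6⟩, R1, R2, R3, R4, R5, R6⟩ := hg
    have a3z : a3 = 0 := by linear_combination (norm := module) -P4 + P5 + Q5
    subst Q4 a3z
    have b1z : b1 = 0 := by simpa [ht] using R1
    subst b1z
    have b3z : b3 = 0 := by
      have : (2 : k) • b3 = 0 := by
        simp only [map_zero] at *
        linear_combination (norm := module) -R5 + Q3 - P2 - P3 
      simpa using this
    subst b3z
    have Q1s := Q1
    simp only [map_zero, smul_zero, neg_zero, sub_zero, zero_add, add_zero, Q1, zero_sub] at R2 R4 R5 P2 Q3 Q2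
    have c3z : c3 = a1 := by
      have : t • (c3 - a1) = 0 := by
        linear_combination (norm := module) R2 - t • Q3
      rw [smul_eq_zero_iff_right ht] at this
      exact sub_eq_zero.1 this
    subst c3z
    have b2z : b2 = c3 := by linear_combination (norm := module) -R4 + Q2 - P2
    subst b2z
    obtain ⟨γ, rfl⟩ := dl_ker' c1 Q1s
    obtain ⟨δ, rfl⟩ := dl_ker' c2 Q2
    refine ⟨(γ, δ), B.m0 (-iI b2), B.m0_wt _, ?_⟩
    rw [s1_apply', h0_m]
    simp [dl_iI, m1_add]
  id v w hw h := by
    obtain ⟨f, rfl⟩ := B.m0_ex w hw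
    rw [s1_apply', h0_m] at h
    simp only [Prod.mk.injEq, m1_inj] at h
    have h1 := h.2.1
    have h2 := h.2.2.1
    ext
    · simpa using h1
    · simpa using h2

noncomputable def q6 (v : (k × k) × (k × k)) : k[X] := (2 * v.1.1) • iI 1 + v.1.2 • 1
noncomputable def q5 (v : (k × k) × (k × k)) : k[X] := iI ((2 * v.1.1) • 1 - (2 : k) • sg (q6 v))
noncomputable def q4 (v : (k × k) × (k × k)) : k[X] := iI ((2 * v.1.1) • 1 - sg (q5 v) - (2 : k) • sg (q6 v))
noncomputable def r2 (t : k) (v : (k × k) × (k × k)) : k[X] := iI ((t * t) • sg (q6 v) - (t * t * v.1.1) • 1)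
noncomputable def r4 (t : k) (v : (k × k) × (k × k)) : k[X] := iI (t • sg (q5 v) + (3 * t) • sg (q6 v) - (3 * t * v.1.1) • 1)
noncomputable def r5 (t : k) (v : (k × k) × (k × k)) : k[X] := iI ((2 * t) • sg (q6 v) - (2 * t * v.1.1) • 1)
noncomputable def r6 (t : k) (v : (k × k) × (k × k)) : k[X] := iI (-(t * v.1.1) • 1) + v.2.2 • 1

lemma qr_add (t : k) (v w : (k × k) × (k × k)) : q6 (v + w) = q6 v + q6 w ∧ q5 (v + w) = q5 v + q5 w ∧ q4 (v + w) = q4 v + q4 w ∧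
    r2 t (v + w) = r2 t v + r2 t w ∧ r4 t (v + w) = r4 t v + r4 t w ∧ r5 t (v + w) = r5 t v + r5 t w ∧ r6 t (v + w) = r6 t v + r6 t w := by
  have a1 : q6 (v + w) = q6 v + q6 w := by simp only [q6, Prod.fst_add, Prod.snd_add]; module
  have a2 : q5 (v + w) = q5 v + q5 w := by
    simp only [q5, a1, Prod.fst_add, ← map_add]; congr 1; simp only [map_add]; module
  refine ⟨a1, a2, ?_, ?_, ?_, ?_, ?_⟩
  · simp only [q4, a1, a2, Prod.fst_add, ← map_add]; congr 1; simp only [map_add]; module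
  · simp only [r2, a1, a2, Prod.fst_add, ← map_add]; congr 1; simp only [map_add]; module
  · simp only [r4, a1, a2, Prod.fst_add, ← map_add]; congr 1; simp only [map_add]; module
  · simp only [r5, a1, a2, Prod.fst_add, ← map_add]; congr 1; simp only [map_add]; module
  · simp only [r6, Prod.fst_add, Prod.snd_add, map_smul]; module

lemma qr_smul (t : k) (c : k) (v : (k × k) × (k × k)) : q6 (c • v) = c • q6 v ∧ q5 (c • v) = c • q5 v ∧ q4 (c • v) = c • q4 v ∧
    r2 t (c • v) = c • r2 t v ∧ r4 t (c • v) = c • r4 t v ∧ r5 t (c • v) = c • r5 t v ∧ r6 t (c • v) = c • r6 t v := by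
  have a1 : q6 (c • v) = c • q6 v := by simp only [q6, Prod.smul_fst, Prod.smul_snd, smul_eq_mul]; module
  have a2 : q5 (c • v) = c • q5 v := by
    simp only [q5, a1, Prod.smul_fst, ← map_smul, smul_eq_mul]; congr 1; simp only [map_smul]; module
  refine ⟨a1, a2, ?_, ?_, ?_, ?_, ?_⟩
  · simp only [q4, a1, a2, Prod.smul_fst, ← map_smul, smul_eq_mul]; congr 1; simp only [map_smul]; module
  · simp only [r2, a1, a2, Prod.smul_fst, ← map_smul, smul_eq_mul]; congr 1; simp only [map_smul]; module
  · simp only [r4, a1, a2, Prod.smul_fst, ← map_smul, smul_eq_mul]; congr 1; simp only [map_smul]; module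
  · simp only [r5, a1, a2, Prod.smul_fst, ← map_smul, smul_eq_mul]; congr 1; simp only [map_smul]; module
  · simp only [r6, Prod.smul_fst, Prod.smul_snd, map_smul, smul_eq_mul]; module

noncomputable def s2 : (k × k) × (k × k) →ₗ[k] U × (U × U) where
  toFun v := (B.m2 0 0 0 0 0 (v.1.1 • 1), (B.m2 0 0 0 (q4 v) (q5 v) (q6 v), B.m2 0 (r2 t v) (v.2.1 • 1) (r4 t v) (r5 t v) (r6 t v)))
  map_add' v w := by
    obtain ⟨a1, a2, a3, a4, a5, a6, a7⟩ := qr_add t v w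
    rw [a1, a2, a3, a4, a5, a6, a7]
    simp [m2_add, add_smul]
  map_smul' c v := by
    obtain ⟨a1, a2, a3, a4, a5, a6, a7⟩ := qr_smul t c v
    rw [a1, a2, a3, a4, a5, a6, a7]
    simp [m2_smul, mul_smul]
lemma s2_apply (v) : B.s2 v =
  (B.m2 0 0 0 0 0 (v.1.1 • 1), (B.m2 0 0 0 (q4 v) (q5 v) (q6 v), B.m2 0 (r2 t v) (v.2.1 • 1) (r4 t v) (r5 t v) (r6 t v))) := rfl

end PBW
end PartD6


section PartD7
open Polynomial
variable {k U : Type} [Field k] [CharZero k] [Ring U] [Algebra k U] {t : k}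
namespace PBW
variable (B : PBW k U t)

lemma s2_coc (v) : B.h2 (B.s2 v) = 0 := by
  rw [s2_apply, h2_m, ← m3_zero B, m3_inj]
  have e6 : dl (q6 v) = (2 * v.1.1) • 1 := by simp [q6, dl_iI, dl_one]
  simp only [q5, q4, r2, r4, r5, r6, dl_iI, e6, sg_eq, map_smul, map_add, dl_one, map_zero, smul_zero, add_zero, neg_zero, zero_add]
  refine ⟨trivial, ?_, trivial, ?_, ?_, ?_, ?_, ?_, ?_, trivial⟩ <;> module

lemma s2_id (ht : t ≠ 0) (v w) (hw : B.e1 w = 0) (h : B.s2 v = B.h1 w) : v = 0 := by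
  obtain ⟨a1, a2, a3, b1, b2, b3, c1, c2, c3, rfl⟩ := B.e1_ex w hw
  rw [s2_apply, h1_m] at h
  simp only [Prod.mk.injEq, m2_inj, sg_eq] at h
  obtain ⟨⟨P1, P2, P3, P4, P5, P6⟩, ⟨Q1, Q2, Q3, Q4, Q5, Q6⟩, R1, R2, R3, R4, R5, R6⟩ := h
  obtain ⟨⟨l, κ⟩, m, n⟩ := v
  dsimp only at *
  have l0 : l = 0 := by simpa using P6
  subst l0
  have z3 : dl a3 = 0 := by linear_combination (norm := module) P5
  have κ0 : κ = 0 := by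
    simpa [q6, z3] using Q6
  subst κ0
  have n0 : n = 0 := by
    rw [← P3] at R6
    simpa [r6] using R6
  subst n0
  have q50 : dl a2 = 0 := by
    simpa [q5, q6, eq_comm] using Q5
  have q40 : a2 = 0 := by
    simpa [q4, q5, q6, eq_comm] using Q4
  have a30 : a3 = 0 := by linear_combination (norm := module) P4 - q50 - z3
  subst a30
  have b10 : b1 = 0 := by simpa [ht, eq_comm] using R1
  subst b10
  have b30 : b3 = 0 := by
    have : (2 : k) • b3 = 0 := by
      simp [r5, q6] at R5 P2 Q3
      linear_combination (norm := module) R5 + P3 - Q3 + P2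
    simpa using this
  subst b30
  have m0 : m = 0 := by simpa using R3
  rw [m0]; rfl

lemma s2_cp1 (p1 p2 p3 p4 p5 p6 q1 q2 q3 q4 q5 q6 r1 r2 r3 r4 r5 r6 : k[X]) : ∃ w p6' q4' q5' q6' r1' r2' r3' r4' r5' r6', B.e1 w = 0 ∧
    (B.m2 p1 p2 p3 p4 p5 p6, (B.m2 q1 q2 q3 q4 q5 q6, B.m2 r1 r2 r3 r4 r5 r6)) =
    (B.m2 0 0 0 0 0 p6', (B.m2 0 0 0 q4' q5' q6', B.m2 r1' r2' r3' r4' r5' r6')) + B.h1 w := by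
  let a3 := -iI p5
  let a2 := -iI (p4 + sg a3)
  refine ⟨((B.m1 0 a2 a3, B.m1 (iI p1) (iI (p2 + t • sg a3)) (iI p3)), B.m1 (iI q1) (iI (q2 - t • a2)) (iI q3)), ?_⟩
  rw [h1_m]
  simp only [Prod.mk_add_mk, Prod.mk.injEq, m2_add, m2_inj, zero_add, ← sub_eq_iff_eq_add]
  refine ⟨_, _, _, _, _, _, _, _, _, _, e1_m _ _ _ _ _ _ _ _ _ _, ⟨?_, ?_, ?_, ?_, ?_, rfl⟩, ⟨?_, ?_, ?_, rfl, rfl, rfl⟩, rfl, rfl, rfl, rfl, rfl, rfl⟩ <;>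
    simp only [a2, a3, dl_iI, map_neg, map_zero] <;> module

lemma s2_cp2 (ht : t ≠ 0) (p q4 q5 q6 r1 r2 r3 r4 r5 r6 : k[X])
    (h : B.h2 (B.m2 0 0 0 0 0 p, (B.m2 0 0 0 q4 q5 q6, B.m2 r1 r2 r3 r4 r5 r6)) = 0) : ∃ v w, B.e1 w = 0 ∧
    (B.m2 0 0 0 0 0 p, (B.m2 0 0 0 q4 q5 q6, B.m2 r1 r2 r3 r4 r5 r6)) = B.s2 v + B.h1 w := by
  rw [h2_m, ← m3_zero B, m3_inj] at h
  obtain ⟨T1, T2, T3, T4, T5, T6, T7, T8, T9, T10⟩ := h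
  simp only [map_zero, add_zero, smul_zero] at T1 T2 T3 T4 T5 T6 T7 T8 T9 T10
  obtain ⟨l, rfl⟩ := dl_ker' p (neg_eq_zero.1 T10)
  simp only [sg_eq (_ • (1 : k[X])), map_smul, dl_one, smul_zero, zero_add] at T2 T4 T5 T6 T7 T8 T9
  obtain ⟨κ, h6⟩ := dl_ker2 q6 ((2 * l) • 1) (by linear_combination (norm := module) T9)
  obtain ⟨e5, h5⟩ := dl_ker2 q5 ((2 * l) • 1 - (2 : k) • sg q6) (by linear_combination (norm := module) T8)
  obtain ⟨e4, h4⟩ := dl_ker2 q4 ((2 * l) • 1 - sg q5 - (2 : k) • sg q6) (by linear_combination (norm := module) T7)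
  obtain ⟨ρ1, k1⟩ := dl_ker' r1 (neg_eq_zero.1 T1)
  obtain ⟨ρ2, k2⟩ := dl_ker2 r2 ((t * t) • sg q6 - (t * t * l) • 1) (by linear_combination (norm := module) -T2)
  obtain ⟨ρ3, k3⟩ := dl_ker' r3 (neg_eq_zero.1 T3)
  obtain ⟨ρ4, k4⟩ := dl_ker2 r4 (t • sg q5 + (3 * t) • sg q6 - (3 * t * l) • 1) (by linear_combination (norm := module) -T4)
  obtain ⟨ρ5, k5⟩ := dl_ker2 r5 ((2 * t) • sg q6 - (2 * t * l) • 1) (by linear_combination (norm := module) -T5)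
  obtain ⟨ρ6, k6⟩ := dl_ker2 r6 (-(t * l) • 1) (by linear_combination (norm := module) -T6)
  clear T1 T2 T3 T4 T5 T6 T7 T8 T9 T10
  obtain ⟨β1, f1⟩ : ∃ β1, ρ1 = -(t * β1) := ⟨-(ρ1 / t), by field_simp⟩
  obtain ⟨β3, f3⟩ : ∃ β3, ρ5 = -(2 * t * e5) - 2 * β3 := ⟨-(ρ5 + 2 * t * e5) / 2, by ring⟩
  obtain ⟨γ3, g3⟩ : ∃ γ3, ρ2 = - (t * t * e5) - 2 * β1 - t * β3 + t * γ3 :=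
    ⟨(ρ2 + t * t * e5 + 2 * β1 + t * β3) / t, by field_simp; ring⟩
  obtain ⟨β2, f2⟩ : ∃ β2, ρ4 = - (t * e5) - 2 * t * e4 - β2 - β3 + γ3 :=
    ⟨- (t * e5) - 2 * t * e4 - ρ4 - β3 + γ3, by ring⟩
  obtain ⟨μ, f⟩ : ∃ μ, ρ3 = μ - t * β3 := ⟨ρ3 + t * β3, by ring⟩
  subst f1 f3 g3 f2 f
  let v : (k × k) × (k × k) := ((l, κ), (μ, ρ6))
  have v6 : PBW.q6 v = q6 := by
    rw [h6, PBW.q6, map_smul]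
  have v5 : PBW.q5 v = q5 - e5 • 1 := by
    rw [PBW.q5, v6, h5]; abel
  have v4 : PBW.q4 v = q4 + e5 • iI 1 - e4 • 1 := by
    rw [PBW.q4, v6, v5, h4]
    simp only [map_sub, map_smul, sg_eq (1 : k[X]), dl_one, map_add, zero_add, v]; module
  have w2 : PBW.r2 t v = r2 - (- (t * t * e5) - 2 * β1 - t * β3 + t * γ3) • 1 := by
    rw [PBW.r2, v6, k2]; abel
  have w4 : PBW.r4 t v = r4 - (t * e5) • iI 1 - (- (t * e5) - 2 * t * e4 - β2 - β3 + γ3) • 1 := by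
    rw [PBW.r4, v6, v5, k4]
    simp only [map_sub, map_smul, sg_eq (1 : k[X]), dl_one, map_add, zero_add, v]; module
  have w5 : PBW.r5 t v = r5 - (-(2 * t * e5) - 2 * β3) • 1 := by
    rw [PBW.r5, v6, k5]; abel
  have w6 : PBW.r6 t v = r6 := by rw [PBW.r6, k6]
  refine ⟨v, ((B.m1 0 (e4 • 1 - e5 • iI 1) (e5 • 1), B.m1 (β1 • 1) ((t * e5) • iI 1 + β2 • 1) (β3 • 1)),
    B.m1 0 (- (t • iI (e4 • 1 - e5 • iI 1))) (γ3 • 1)), e1_m _ _ _ _ _ _ _ _ _ _, ?_⟩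
  rw [h1_m, s2_apply]
  simp only [Prod.mk_add_mk, Prod.mk.injEq, m2_add, m2_inj, v4, v5, v6, w2, w4, w5, w6, k1, k3]
  simp only [sg_eq, map_sub, map_add, map_smul, map_neg, map_zero, dl_iI, dl_one, smul_zero, v]
  refine ⟨⟨?_, ?_, ?_, ?_, ?_, ?_⟩, ⟨?_, ?_, ?_, ?_, ?_, ?_⟩, ?_, ?_, ?_, ?_, ?_, ?_⟩ <;> module

lemma wh2 (ht : t ≠ 0) : WH B.h1 B.h2 B.e1 B.e2 B.s2 where
  es v := B.e2_m _ _ _ _ _ _ _ _ _ _ _ _ _ _ _ _ _ _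
  gs v := B.s2_coc v
  cp z hz hg := by
    obtain ⟨p1, p2, p3, p4, p5, p6, q1, q2, q3, q4, q5, q6, r1, r2, r3, r4, r5, r6, rfl⟩ := B.e2_ex z hz
    obtain ⟨w, p6', q4', q5', q6', r1', r2', r3', r4', r5', r6', hw, he⟩ := B.s2_cp1 p1 p2 p3 p4 p5 p6 q1 q2 q3 q4 q5 q6 r1 r2 r3 r4 r5 r6
    rw [he] at hg ⊢
    rw [map_add, h2h1, add_zero] at hg
    obtain ⟨v, w', hw', he'⟩ := B.s2_cp2 ht _ _ _ _ _ _ _ _ _ _ hg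
    refine ⟨v, w' + w, by rw [map_add, hw, hw', add_zero], ?_⟩
    rw [he', map_add, add_assoc]
  id v w hw h := B.s2_id ht v w hw h

lemma h2_onto (z) (hz : B.wt 3 z = 0) : ∃ w, B.e2 w = 0 ∧ z = B.h2 w := by
  obtain ⟨T1, T2, T3, T4, T5, T6, T7, T8, T9, T10, rfl⟩ := B.m3_ex z hz
  let p := -iI T10
  let q6 := iI (T9 + p + sg p)
  let q5 := iI (T8 + (2 : k) • sg p - (2 : k) • sg q6)
  let q4 := iI (T7 + (2 : k) • sg p - sg q5 - (2 : k) • sg q6)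
  refine ⟨(B.m2 0 0 0 0 0 p, (B.m2 0 0 0 q4 q5 q6, B.m2 (-iI T1) (-iI (T2 + (t * t) • sg p - (t * t) • sg q6)) (-iI T3)
    (-iI (T4 + (3 * t) • sg p - t • sg q5 - (3 * t) • sg q6)) (-iI (T5 + (2 * t) • sg p - (2 * t) • sg q6)) (-iI (T6 + t • p)))),
    e2_m _ _ _ _ _ _ _ _ _ _ _ _ _ _ _ _ _ _ _, ?_⟩
  have d1 : dl p = -T10 := by simp only [p, map_neg, dl_iI]
  have d2 : dl q6 = T9 + p + sg p := dl_iI _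
  have d3 : dl q5 = T8 + (2 : k) • sg p - (2 : k) • sg q6 := dl_iI _
  have d4 : dl q4 = T7 + (2 : k) • sg p - sg q5 - (2 : k) • sg q6 := dl_iI _
  rw [h2_m, m3_inj, d1, d2, d3, d4]
  simp only [map_neg, dl_iI, map_zero]
  refine ⟨?_, ?_, ?_, ?_, ?_, ?_, ?_, ?_, ?_, ?_⟩ <;> module

lemma wh3 : WH B.h2 (0 : U →ₗ[k] PUnit) B.e2 (B.wt 3) (0 : PUnit →ₗ[k] U) where
  es v := by simp
  gs v := rfl
  cp z hz _ := by
    obtain ⟨w, hw, h⟩ := B.h2_onto z hz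
    exact ⟨0, w, hw, by simp [h]⟩
  id v w hw h := rfl

end PBW
end PartD7


section PartD8
variable {k U : Type} [Field k] [CharZero k] [Ring U] [Algebra k U] {t : k}
namespace PBW
variable (B : PBW k U t)

lemma fit_e1 : Fit B.e1 := ((B.wt_fit 1).prodMap (B.wt_fit 1)).prodMap (B.wt_fit 1)
lemma fit_e2 : Fit B.e2 := (B.wt_fit 2).prodMap ((B.wt_fit 2).prodMap (B.wt_fit 2))
lemma fit_zero : Fit (0 : PUnit →ₗ[k] PUnit) := ⟨fun c => ⟨c, 0, by simp, rfl⟩, fun _ _ => rfl⟩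

theorem hh_final (B : PBW k U t) (ht : t ≠ 0) :
    Nonempty (HH k U 0 ≃ₗ[k] k) ∧ Nonempty (HH k U 1 ≃ₗ[k] (k × k) × k) ∧ Nonempty (HH k U 2 ≃ₗ[k] ((k × k) × (k × k)) × (k × k)) ∧
    Nonempty (HH k U 3 ≃ₗ[k] PUnit.{1} × ((k × k) × (k × k))) ∧ ∀ n, 4 ≤ n → Subsingleton (HH k U n) := by
  have w0 := B.wh0
  have w1 := B.wh1 ht
  have w2 := B.wh2 ht
  have w3 := B.wh3
  obtain ⟨c11, c12, c13⟩ := cone_coh w0 w1 fit_zero (B.wt_fit 0) B.fit_e1 (by simp) B.h0e (by simp) B.h1h0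
  obtain ⟨c21, c22, c23⟩ := cone_coh w1 w2 (B.wt_fit 0) B.fit_e1 B.fit_e2 B.h0e B.h1e B.h1h0 B.h2h1
  obtain ⟨c31, c32, c33⟩ := cone_coh w2 w3 B.fit_e1 B.fit_e2 (B.wt_fit 3) B.h1e B.h2e B.h2h1 (fun _ => rfl)
  refine B.hh_main B.s0 (B.s1.prodMap B.s0) (B.s2.prodMap B.s1) ((0 : PUnit →ₗ[k] U).prodMap B.s2) ⟨?_, ?_, ?_⟩ ⟨?_, ?_, ?_⟩ ⟨?_, ?_, ?_⟩ ⟨?_, ?_, ?_⟩ ?_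
  · intro v; rw [F0_apply, w0.gs, w0.es]; rfl
  · intro z hz
    rw [F0_apply, Prod.mk_eq_zero] at hz
    obtain ⟨v, w, -, h⟩ := w0.cp z hz.2 hz.1
    exact ⟨v, by simpa using h⟩
  · intro v h
    exact w0.id v 0 rfl (by simpa using h)
  · rintro ⟨v, v'⟩
    rw [LinearMap.prodMap_apply, F1_apply, (c11 v' v).1, (c11 v' v).2]; rfl
  · rintro ⟨a, b⟩ h
    rw [F1_apply, Prod.mk_eq_zero] at h
    obtain ⟨v, v', w, w', h1, h2⟩ := c12 a b h.1 h.2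
    refine ⟨(v', v), w, ?_⟩
    rw [LinearMap.prodMap_apply, F0_apply, h1, h2]; simp
  · rintro ⟨v, v'⟩ w h
    rw [LinearMap.prodMap_apply, F0_apply, Prod.mk.injEq] at h
    obtain ⟨h1, h2⟩ := c13 v' v w 0 h.1 (by rw [h.2]; simp)
    rw [h1, h2]; rfl
  · rintro ⟨v, v'⟩
    rw [LinearMap.prodMap_apply, F2_apply, (c21 v' v).1, (c21 v' v).2]; rfl
  · rintro ⟨a, b⟩ h
    rw [F2_apply, Prod.mk_eq_zero] at h
    obtain ⟨v, v', w, w', h1, h2⟩ := c22 a b h.1 h.2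
    refine ⟨(v', v), (w, w'), ?_⟩
    rw [LinearMap.prodMap_apply, F1_apply, h1, h2]; rfl
  · rintro ⟨v, v'⟩ ⟨w, w'⟩ h
    rw [LinearMap.prodMap_apply, F1_apply, Prod.mk.injEq] at h
    obtain ⟨h1, h2⟩ := c23 v' v w w' h.1 h.2
    rw [h1, h2]; rfl
  · rintro ⟨v, v'⟩
    rw [LinearMap.prodMap_apply, F3_apply, (c31 v' v).2]
  · rintro ⟨a, b⟩ h
    rw [F3_apply] at h
    obtain ⟨v, v', w, w', h1, h2⟩ := c32 a b rfl h
    refine ⟨(v', v), (w, w'), ?_⟩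
    rw [LinearMap.prodMap_apply, F2_apply, h1, h2]; rfl
  · rintro ⟨v, v'⟩ ⟨w, w'⟩ h
    rw [LinearMap.prodMap_apply, F2_apply, Prod.mk.injEq] at h
    obtain ⟨h1, h2⟩ := c33 v' v w w' h.1 h.2
    rw [h1, h2]; rfl
  · intro z
    obtain ⟨z0, z', h, h0⟩ := (B.wt_fit 3).1 z
    obtain ⟨w, -, hw⟩ := B.h2_onto z0 h0
    refine ⟨(z', -w), ?_⟩
    rw [F3_apply, h, hw, map_neg, neg_neg, add_comm]

end PBW
end PartD8

/-- The Hilbert series of `HH^•(Diff 𝒜)` for a central arrangement `𝒜` of three lines is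
`1 + 3t + 6t² + 4t³`. -/
theorem hilbert_series_HH_DiffA (k : Type) [Field k] [CharZero k] (t : k) (ht : t ≠ 0) :
    Module.finrank k (HH k (DiffA k t) 0) = 1 ∧
    Module.finrank k (HH k (DiffA k t) 1) = 3 ∧
    Module.finrank k (HH k (DiffA k t) 2) = 6 ∧
    Module.finrank k (HH k (DiffA k t) 3) = 4 ∧
    ∀ n : ℕ, 4 ≤ n → Subsingleton (HH k (DiffA k t) n) := by
  obtain ⟨⟨i0⟩, ⟨i1⟩, ⟨i2⟩, ⟨i3⟩, h⟩ := (dpbw k t).hh_final ht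
  refine ⟨?_, ?_, ?_, ?_, h⟩
  · rw [i0.finrank_eq]; simp
  · rw [i1.finrank_eq]; simp
  · rw [i2.finrank_eq]; simp
  · rw [i3.finrank_eq]; simp [Module.finrank_zero_of_subsingleton]
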